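/- If m is an even positive integer and n is an odd positive integer, then cr(K_{1,1,m,n}) ≥ (1/4)(cr(K_{m+1,n+2}) + cr(K_{m+3,n+2}) + 2·cr(K_{2,m,n}) − m(n+1) − (1/4)(n+1)²). -/

import Mathlib

open SimpleGraph

variable {V : Type*}

/-- A drawing of a simple graph in the plane: an injective placement of the
vertices in `ℝ²` together with, for each edge, a continuous arc joining the
positions of its endpoints (parametrised compatibly in both directions),
such that no arc passes through the position of a vertex other than its
endpoints. -/
structure Drawing (G : SimpleGraph V) where
  pos : V → ℝ × ℝ
  pos_inj : Function.Injective pos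
  arc : V → V → ℝ → ℝ × ℝ
  arc_cont : ∀ ⦃a b⦄, G.Adj a b → ContinuousOn (arc a b) (Set.Icc 0 1)
  arc_zero : ∀ ⦃a b⦄, G.Adj a b → arc a b 0 = pos a
  arc_one : ∀ ⦃a b⦄, G.Adj a b → arc a b 1 = pos b
  arc_symm : ∀ ⦃a b⦄, G.Adj a b → ∀ t, arc b a t = arc a b (1 - t)
  arc_avoid : ∀ ⦃a b⦄, G.Adj a b → ∀ c, c ≠ a → c ≠ b →
      pos c ∉ arc a b '' Set.Icc 0 1

namespace Drawing

variable {G : SimpleGraph V} (D : Drawing G)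

/-- The set of points of the plane used by the edge `e`. -/
def edgePoints (e : Sym2 V) : Set (ℝ × ℝ) :=
  {p | ∃ a b, e = s(a, b) ∧ G.Adj a b ∧ p ∈ D.arc a b '' Set.Icc 0 1}

/-- The positions of the endpoints of an edge. -/
def ends (e : Sym2 V) : Set (ℝ × ℝ) := {p | ∃ a ∈ e, p = D.pos a}

/-- `p` is a crossing of the (distinct) edges `e` and `f` in the drawing `D`:
a common point of the two edges other than an endpoint. -/
def IsCrossing (e f : Sym2 V) (p : ℝ × ℝ) : Prop :=
  e ∈ G.edgeSet ∧ f ∈ G.edgeSet ∧ e ≠ f ∧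
    p ∈ D.edgePoints e ∧ p ∈ D.edgePoints f ∧ p ∉ D.ends e ∧ p ∉ D.ends f

/-- The crossings between an edge of `A` and an edge of `B`: a crossing is
recorded as a point of the plane together with the unordered pair of edges
crossing there. -/
def crossings (A B : Set (Sym2 V)) : Set ((ℝ × ℝ) × Sym2 (Sym2 V)) :=
  {q | ∃ e f, q.2 = s(e, f) ∧ e ∈ A ∧ f ∈ B ∧ D.IsCrossing e f q.1}

/-- `cr_D(A, B)`: the number of crossings between an edge of `A` and an
edge of `B`. -/
noncomputable def crBetween (A B : Set (Sym2 V)) : ℕ := Nat.card (D.crossings A B)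

/-- `cr(D)`: the total number of crossings of the drawing `D`. -/
noncomputable def crNum : ℕ := D.crBetween G.edgeSet G.edgeSet

/-- A good drawing: no edge crosses itself (each arc is a simple arc),
no two adjacent edges cross, no two edges cross more than once, and no three
edges cross at a common point. -/
structure IsGood : Prop where
  arc_inj : ∀ ⦃a b⦄, G.Adj a b → Set.InjOn (D.arc a b) (Set.Icc 0 1)
  adj_no_cross : ∀ e f : Sym2 V, (∃ a, a ∈ e ∧ a ∈ f) → ∀ p, ¬ D.IsCrossing e f p
  cross_once : ∀ e f : Sym2 V, {p | D.IsCrossing e f p}.Subsingleton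
  no_triple : ∀ p, ∀ e f g : Sym2 V, e ≠ f → e ≠ g → f ≠ g →
      ¬ (D.IsCrossing e f p ∧ D.IsCrossing f g p ∧ D.IsCrossing e g p)

end Drawing

/-- The crossing number of a graph: the minimum number of crossings among
all good drawings of `G` in the plane. -/
noncomputable def crossingNumber (G : SimpleGraph V) : ℕ :=
  sInf {n | ∃ D : Drawing G, D.IsGood ∧ D.crNum = n}

/-- The Zarankiewicz function `Z(m,n) = ⌊m/2⌋⌊(m-1)/2⌋⌊n/2⌋⌊(n-1)/2⌋`. -/
def Z (m n : ℕ) : ℕ := m / 2 * ((m - 1) / 2) * (n / 2) * ((n - 1) / 2)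

/-- The complete bipartite graph `K_{a,b}`. -/
abbrev bipK (a b : ℕ) : SimpleGraph (Fin a ⊕ Fin b) :=
  completeBipartiteGraph (Fin a) (Fin b)

/-- The complete tripartite graph `K_{a,b,c}`. -/
abbrev triK (a b c : ℕ) : SimpleGraph (Σ i : Fin 3, ![Fin a, Fin b, Fin c] i) :=
  completeMultipartiteGraph ![Fin a, Fin b, Fin c]

/-- The complete 4-partite graph `K_{a,b,c,d}`. -/
abbrev quadK (a b c d : ℕ) : SimpleGraph (Σ i : Fin 4, ![Fin a, Fin b, Fin c, Fin d] i) :=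
  completeMultipartiteGraph ![Fin a, Fin b, Fin c, Fin d]

/-- `E(V₁, V₂)`: the set of pairs `{v₁, v₂}` with `v₁ ∈ V₁` and `v₂ ∈ V₂`. -/
def pairEdges {α : Type*} (V₁ V₂ : Set α) : Set (Sym2 α) :=
  {e | ∃ a ∈ V₁, ∃ b ∈ V₂, e = s(a, b)}

namespace CrK

/-- one admissible step inside `S` whose interior avoids `X` -/
def Step (S X : Set ℂ) (z w : ℂ) : Prop :=
  segment ℝ z w ⊆ S ∧ (z ≠ w → ∀ q ∈ openSegment ℝ z w, q ∉ X)

lemma Step.symm {S X : Set ℂ} {z w : ℂ} (h : Step S X z w) : Step S X w z := by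
  refine ⟨by rw [segment_symm]; exact h.1, fun hne q hq => h.2 (Ne.symm hne) q ?_⟩
  rw [openSegment_symm]; exact hq

lemma Step.sub {S X : Set ℂ} {z w z' : ℂ} (h : Step S X z w) (hz : z' ∈ segment ℝ z w) :
    Step S X z z' := by
  refine ⟨((convex_segment z w).segment_subset (left_mem_segment ℝ z w) hz).trans h.1, ?_⟩
  intro hne q hq
  rw [segment_eq_image'] at hz
  obtain ⟨t, ⟨ht0, ht1⟩, rfl⟩ := hz
  rw [openSegment_eq_image'] at hq
  obtain ⟨s, ⟨hs0, hs1⟩, rfl⟩ := hq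
  have ht : t ≠ 0 := by rintro rfl; simp at hne
  have ht0' : 0 < t := lt_of_le_of_ne ht0 (Ne.symm ht)
  have hzw : z ≠ w := by rintro rfl; simp at hne
  refine h.2 hzw _ ?_
  rw [openSegment_eq_image']
  refine ⟨s * t, ⟨by positivity, by nlinarith⟩, ?_⟩
  simp only [add_sub_cancel_left, smul_smul]

def Ch (S X : Set ℂ) (N : ℕ) (a b : ℂ) : Prop :=
  ∃ p : ℕ → ℂ, p 0 = a ∧ p N = b ∧ ∀ j < N, Step S X (p j) (p (j + 1))

lemma Ch.zero {S X : Set ℂ} (a : ℂ) : Ch S X 0 a a := ⟨fun _ => a, rfl, rfl, by simp⟩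

lemma Ch.one {S X : Set ℂ} {a b : ℂ} (h : Step S X a b) : Ch S X 1 a b :=
  ⟨fun j => if j = 0 then a else b, by simp, by simp, by
    intro j hj
    obtain rfl : j = 0 := by omega
    simpa using h⟩

lemma Ch.trans {S X : Set ℂ} {a b c : ℂ} {N M : ℕ} (h : Ch S X N a b) (h' : Ch S X M b c) :
    Ch S X (N + M) a c := by
  obtain ⟨p, p0, pN, hp⟩ := h
  obtain ⟨q, q0, qN, hq⟩ := h'
  refine ⟨fun j => if j ≤ N then p j else q (j - N), by simp [p0], ?_, ?_⟩
  · by_cases hM : M = 0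
    · subst hM; simp [pN, ← qN, q0]
    · simp [hM, qN]
  · intro j hj
    by_cases h1 : j + 1 ≤ N
    · have : j ≤ N := by omega
      simp only [this, h1, if_true]; exact hp j (by omega)
    · by_cases h2 : j ≤ N
      · obtain rfl : j = N := by omega
        simp only [le_refl, if_true, h1, if_false]
        have := hq 0 (by omega)
        rw [q0, ← pN] at this
        simpa using this
      · simp only [h2, h1, if_false]
        have := hq (j - N) (by omega)
        rwa [show j - N + 1 = j + 1 - N by omega] at this

lemma Ch.of_rtg {S X : Set ℂ} {a b : ℂ} (h : Relation.ReflTransGen (Step S X) a b) :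
    ∃ N, Ch S X N a b := by
  induction h with
  | refl => exact ⟨0, Ch.zero a⟩
  | tail _ h ih => obtain ⟨N, hN⟩ := ih; exact ⟨N + 1, hN.trans (Ch.one h)⟩

lemma overlap {o p q z : ℂ} (h1 : z ∈ segment ℝ p o) (h2 : z ∈ segment ℝ o q) (hz : z ≠ o) :
    q ∈ segment ℝ p o ∨ p ∈ segment ℝ o q := by
  rw [segment_symm, segment_eq_image'] at h1
  rw [segment_eq_image'] at h2
  obtain ⟨s, ⟨hs0, hs1⟩, rfl⟩ := h1
  obtain ⟨t, ⟨ht0, ht1⟩, h⟩ := h2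
  simp only [add_right_inj] at h
  have hs : 0 < s := lt_of_le_of_ne hs0 (by rintro rfl; simp at hz)
  have ht : 0 < t := lt_of_le_of_ne ht0 (by
    rintro rfl; simp only [zero_smul] at h; apply hz; simp [← h])
  rcases le_total s t with hst | hst
  · left
    rw [segment_symm, segment_eq_image']
    refine ⟨s / t, ⟨by positivity, by rw [div_le_one ht]; exact hst⟩, ?_⟩
    have : q - o = (s / t) • (p - o) := by
      rw [div_eq_inv_mul, mul_smul, ← h, smul_smul, inv_mul_cancel₀ ht.ne', one_smul]
    simp only [← this]; ring
  · right
    rw [segment_eq_image']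
    refine ⟨t / s, ⟨by positivity, by rw [div_le_one hs]; exact hst⟩, ?_⟩
    have : p - o = (t / s) • (q - o) := by
      rw [div_eq_inv_mul, mul_smul, h, smul_smul, inv_mul_cancel₀ hs.ne', one_smul]
    simp only [← this]; ring

lemma min_chain {S X : Set ℂ} {a b : ℂ} (h : Relation.ReflTransGen (Step S X) a b) :
    ∃ (N : ℕ) (p : ℕ → ℂ), p 0 = a ∧ p N = b ∧ (∀ j < N, Step S X (p j) (p (j + 1))) ∧
      (∀ j < N, p j ≠ p (j + 1)) ∧
      (∀ i j, i < j → j < N → ∀ z, z ∈ segment ℝ (p i) (p (i + 1)) →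
        z ∈ segment ℝ (p j) (p (j + 1)) → j = i + 1 ∧ z = p j) := by
  classical
  have hex := Ch.of_rtg h
  obtain ⟨p, p0, pN, hp⟩ := Nat.find_spec hex
  set N := Nat.find hex with hN
  have key : ∀ i j L, i ≤ j → j ≤ N → Ch S X L (p i) (p j) → j - i ≤ L := by
    intro i j L hij hj hL
    have h1 : Ch S X i a (p i) := ⟨p, p0, rfl, fun k hk => hp k (by omega)⟩
    have h2 : Ch S X (N - j) (p j) b := ⟨fun k => p (j + k), rfl, by
      simp only; rw [show j + (N - j) = N by omega, pN], fun k hk => by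
        have := hp (j + k) (by omega)
        simpa [add_assoc] using this⟩
    have := Nat.find_min' hex ((h1.trans hL).trans h2)
    omega
  refine ⟨N, p, p0, pN, hp, ?_, ?_⟩
  · intro j hj he
    have := key j (j + 1) 0 (by omega) (by omega) (by rw [← he]; exact Ch.zero _)
    omega
  · intro i j hij hj z hz1 hz2
    have s1 : Step S X (p i) z := (hp i (by omega)).sub hz1
    have s2 : Step S X z (p (j + 1)) := ((hp j hj).symm.sub (by rw [segment_symm]; exact hz2)).symm
    have := key i (j + 1) 2 (by omega) (by omega) ((Ch.one s1).trans (Ch.one s2))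
    obtain rfl : j = i + 1 := by omega
    refine ⟨rfl, ?_⟩
    by_contra hne
    have hs : Step S X (p i) (p (i + 1 + 1)) := by
      rcases overlap hz1 hz2 hne with h' | h'
      · exact (hp i (by omega)).sub h'
      · exact ((hp (i + 1) hj).symm.sub (by rw [segment_symm]; exact h')).symm
    have := key i (i + 1 + 1) 1 (by omega) (by omega) (Ch.one hs)
    omega

end CrK

namespace CrK
open Metric Filter Topology

lemma sep_compact {ι : Type*} [Finite ι] (K : ι → Set ℂ) (hK : ∀ i, IsCompact (K i)) :
    ∀ᶠ ε in 𝓝[>] (0 : ℝ), ∀ i j, Disjoint (K i) (K j) →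
      Disjoint (thickening ε (K i)) (thickening ε (K j)) := by
  rw [eventually_all]; intro i
  rw [eventually_all]; intro j
  rw [eventually_imp_distrib_left]; intro h
  obtain ⟨δ, hδ, h'⟩ := h.exists_thickenings (hK i) (hK j).isClosed
  filter_upwards [Ioo_mem_nhdsGT hδ] with ε hε
  exact h'.mono (thickening_mono hε.2.le _) (thickening_mono hε.2.le _)

/-- cone over the part of `K` on the sphere -/
def cone (K : Set ℂ) (p : ℂ) (r : ℝ) : Set ℂ :=
  {q | ∃ z ∈ K, Dist.dist z p = r ∧ q ∈ segment ℝ p z}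

lemma cone_compact {K : Set ℂ} (hK : IsCompact K) (p : ℂ) (r : ℝ) : IsCompact (cone K p r) := by
  have h1 : IsCompact (K ∩ sphere p r) := hK.inter_right isClosed_sphere
  have h2 : IsCompact ((Set.Icc (0 : ℝ) 1) ×ˢ (K ∩ sphere p r)) := isCompact_Icc.prod h1
  have : cone K p r = (fun x : ℝ × ℂ => p + x.1 • (x.2 - p)) ''
      ((Set.Icc (0 : ℝ) 1) ×ˢ (K ∩ sphere p r)) := by
    ext q
    constructor
    · rintro ⟨z, hz, hd, hq⟩
      rw [segment_eq_image'] at hq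
      obtain ⟨t, ht, rfl⟩ := hq
      exact ⟨(t, z), ⟨ht, hz, hd⟩, rfl⟩
    · rintro ⟨⟨t, z⟩, ⟨ht, hz, hd⟩, rfl⟩
      refine ⟨z, hz, hd, ?_⟩
      rw [segment_eq_image']
      exact ⟨t, ht, rfl⟩
  rw [this]
  exact h2.image (by fun_prop)

lemma cone_point {K : Set ℂ} {p q : ℂ} {r : ℝ} (hr : 0 < r) (hq : q ∈ cone K p r) :
    Dist.dist q p ≤ r ∧ (Dist.dist q p = r → q ∈ K) ∧ ∃ z ∈ K, Dist.dist z p = r ∧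
      q = p + ((Dist.dist q p / r : ℝ) : ℂ) * (z - p) := by
  obtain ⟨z, hz, hd, hq⟩ := hq
  rw [segment_eq_image'] at hq
  obtain ⟨t, ⟨h0, h1⟩, rfl⟩ := hq
  have : Dist.dist (p + t • (z - p)) p = t * r := by
    rw [_root_.dist_eq_norm, add_sub_cancel_left, norm_smul, ← _root_.dist_eq_norm, hd]
    simp [abs_of_nonneg h0]
  simp only [this]
  refine ⟨by nlinarith, fun h => ?_, z, hz, hd, ?_⟩
  · have : t = 1 := by
      have : (t - 1) * r = 0 := by linarith
      rcases mul_eq_zero.mp this with h | h <;> linarith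
    simpa [this] using hz
  · rw [mul_div_cancel_right₀ _ hr.ne']; simp

lemma reach (f : ℝ → ℂ) (hf : Continuous f) (X S : Set ℂ) (r ε : ℝ) (hr : 0 < r) (hε : 0 < ε)
    (hsep : ∀ p ∈ X, ∀ q ∈ X, p ≠ q → 2 * r < Dist.dist p q)
    (hth : ∀ q ∈ thickening ε (Set.range f \ ⋃ p ∈ X, ball p r), q ∉ X)
    (hS1 : thickening ε (Set.range f \ ⋃ p ∈ X, ball p r) ⊆ S)
    (hS2 : ∀ p ∈ X, cone (Set.range f) p r ⊆ S) (s t : ℝ) (hs : f s ∈ X) (ht : f t ∈ X) :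
    Relation.ReflTransGen (Step S X) (f s) (f t) := by
  set O := Set.range f \ ⋃ p ∈ X, ball p r with hO
  let R : ℝ → ℂ → Prop := fun t z => (z ∈ X ∧ f t ∈ ball z r) ∨ (z = f t ∧ f t ∈ O)
  have hRex : ∀ t, ∃ z, R t z := by
    intro t
    by_cases h : f t ∈ O
    · exact ⟨f t, Or.inr ⟨rfl, h⟩⟩
    · simp only [hO, Set.mem_diff, Set.mem_range_self, true_and, not_not, Set.mem_iUnion] at h
      obtain ⟨p, hp, h⟩ := h
      exact ⟨p, Or.inl ⟨hp, h⟩⟩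
  have hsym : ∀ z w, Relation.ReflTransGen (Step S X) z w → Relation.ReflTransGen (Step S X) w z := by
    intro z w h
    induction h with
    | refl => exact .refl
    | tail _ h ih => exact .head h.symm ih
  have huniq : ∀ q, ∀ p ∈ X, ∀ p' ∈ X, q ∈ ball p r → q ∈ ball p' r → p = p' := by
    intro q p hp p' hp' h h'
    by_contra hne
    have := hsep p hp p' hp' hne
    rw [Metric.mem_ball] at h h'
    have := _root_.dist_triangle_left p p' q
    linarith
  have hnO : ∀ q, q ∈ O → ∀ p ∈ X, q ∉ ball p r := by
    intro q hq p hp h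
    exact hq.2 (Set.mem_biUnion hp h)
  let P : ℝ → ℝ → Prop := fun s t => ∀ z w, R s z → R t w → Relation.ReflTransGen (Step S X) z w
  haveI : Std.Symm P := ⟨fun s t h z w hz hw => hsym _ _ (h w z hw hz)⟩
  have hst : P s t := by
    refine PreconnectedSpace.induction₂ P ?_ ⟨?_⟩ s t
    · intro t
      by_cases h : f t ∈ O
      · obtain ⟨δ, hδ, hc⟩ := Metric.continuous_iff.mp hf t ε hε
        filter_upwards [ball_mem_nhds t hδ] with s hs
        rintro z w (⟨hz, hz'⟩ | ⟨rfl, -⟩) hw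
        · exact absurd hz' (hnO _ h z hz)
        have hball : ∀ q, q ∈ ball (f t) ε → Step S X (f t) q := by
          intro q hq
          have hsub : segment ℝ (f t) q ⊆ thickening ε O := by
            refine ((convex_ball (f t) ε).segment_subset (mem_ball_self hε) hq).trans ?_
            exact ball_subset_thickening h ε
          exact ⟨hsub.trans hS1, fun _ x hx => hth x (hsub (openSegment_subset_segment _ _ _ hx))⟩
        rcases hw with ⟨hw, hw'⟩ | ⟨rfl, -⟩
        · have hc2 : ContinuousOn (fun s => Dist.dist (f s) w) (Set.uIcc t s) := by fun_prop
          have hmem : r ∈ Set.uIcc (Dist.dist (f t) w) (Dist.dist (f s) w) := by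
            have := hnO _ h w hw
            rw [Metric.mem_ball, not_lt] at this
            rw [Metric.mem_ball] at hw'
            exact Set.mem_uIcc.mpr (Or.inr ⟨hw'.le, this⟩)
          obtain ⟨s', hs', hd⟩ := intermediate_value_uIcc hc2 hmem
          have hd : Dist.dist (f s') w = r := hd
          have h1 : Step S X (f t) (f s') := by
            apply hball
            rw [Metric.mem_ball]
            apply hc
            have : |s' - t| ≤ |s - t| := by
              have := Set.abs_sub_left_of_mem_uIcc hs'
              exact this
            exact lt_of_le_of_lt this hs
          have h2 : Step S X w (f s') := by
            refine ⟨fun q hq => hS2 w hw ⟨f s', ⟨s', rfl⟩, hd, hq⟩, fun hne q hq hqX => ?_⟩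
            rw [openSegment_eq_image'] at hq
            obtain ⟨θ, ⟨h0, h1⟩, rfl⟩ := hq
            have hdist : Dist.dist w (w + θ • (f s' - w)) = θ * r := by
              rw [_root_.dist_comm, _root_.dist_eq_norm, add_sub_cancel_left, norm_smul, ← _root_.dist_eq_norm, hd]
              simp [abs_of_nonneg h0.le]
            have hne' : w ≠ w + θ • (f s' - w) := by
              rw [← _root_.dist_pos, hdist]; positivity
            have := hsep w hw _ hqX hne'
            simp only [hdist] at this
            nlinarith
          exact (Relation.ReflTransGen.single h1).tail h2.symm
        · exact .single (hball _ (by rw [Metric.mem_ball]; exact hc s hs))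
      · simp only [hO, Set.mem_diff, Set.mem_range_self, true_and, not_not, Set.mem_iUnion] at h
        obtain ⟨p, hp, h⟩ := h
        filter_upwards [hf.continuousAt (isOpen_ball.mem_nhds h)] with s hs
        have : ∀ t z, f t ∈ ball p r → R t z → z = p := by
          rintro t z ht (⟨hz, hz'⟩ | ⟨-, hz⟩)
          · exact huniq _ _ hz _ hp hz' ht
          · exact absurd ht (hnO _ hz p hp)
        intro z w hz hw
        rw [this t z h hz, this s w hs hw]
    · intro a b c hab hbc z w hz hw
      obtain ⟨y, hy⟩ := hRex b
      exact (hab z y hz hy).trans (hbc y w hy hw)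
  exact hst _ _ (Or.inl ⟨hs, mem_ball_self hr⟩) (Or.inl ⟨ht, mem_ball_self hr⟩)

theorem polyline {E : Type*} [Finite E] (X : Set ℂ) (hX : X.Finite) (K : E → Set ℂ)
    (a b : E → ℂ) (ha : ∀ e, a e ∈ X) (hb : ∀ e, b e ∈ X)
    (hj : ∀ e, JoinedIn (K e) (a e) (b e)) (hint : ∀ e f, e ≠ f → K e ∩ K f ⊆ X) :
    ∃ (N : E → ℕ) (p : E → ℕ → ℂ), (∀ e, p e 0 = a e) ∧ (∀ e, p e (N e) = b e) ∧
      (∀ e, ∀ j < N e, p e j ≠ p e (j + 1)) ∧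
      (∀ e i j, i < j → j < N e → ∀ z, z ∈ segment ℝ (p e i) (p e (i + 1)) →
        z ∈ segment ℝ (p e j) (p e (j + 1)) → j = i + 1 ∧ z = p e j) ∧
      (∀ e, ∀ j < N e, ∀ z ∈ openSegment ℝ (p e j) (p e (j + 1)), z ∉ X) ∧
      (∀ e, ∀ j < N e, ∀ z ∈ segment ℝ (p e j) (p e (j + 1)), z ∈ X → z ∈ K e) ∧
      (∀ e f, e ≠ f → ∀ i < N e, ∀ j < N f, ∀ z, z ∈ segment ℝ (p e i) (p e (i + 1)) →
        z ∈ segment ℝ (p f j) (p f (j + 1)) → z ∈ X) := by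
  classical
  haveI : Finite X := hX
  have hF : ∀ e, ∃ f : ℝ → ℂ, Continuous f ∧ Set.range f ⊆ K e ∧ IsCompact (Set.range f) ∧
      f 0 = a e ∧ f 1 = b e := by
    intro e
    obtain ⟨γ, hγ⟩ := hj e
    refine ⟨γ.extend, γ.continuous_extend, ?_, ?_, γ.extend_zero, γ.extend_one⟩
    · rw [γ.extend_range]; rintro _ ⟨t, rfl⟩; exact hγ t
    · rw [γ.extend_range]; exact isCompact_range γ.continuous
  choose f hf hfK hfc hf0 hf1 using hF
  -- choose r
  have hr1 : ∀ᶠ r in 𝓝[>] (0 : ℝ), ∀ p q : X, p ≠ q → 2 * r < Dist.dist (p : ℂ) q := by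
    rw [eventually_all]; intro p; rw [eventually_all]; intro q
    rw [eventually_imp_distrib_left]; intro h
    have : 0 < Dist.dist (p : ℂ) q := _root_.dist_pos.mpr (fun h' => h (Subtype.ext h'))
    filter_upwards [Ioo_mem_nhdsGT (half_pos this)] with r hr
    linarith [hr.2]
  have hr2 : ∀ᶠ r in 𝓝[>] (0 : ℝ), ∀ (p : X) (e : E), (p : ℂ) ∉ Set.range (f e) →
      ∀ z ∈ Set.range (f e), r < Dist.dist z p := by
    rw [eventually_all]; intro p; rw [eventually_all]; intro e
    rw [eventually_imp_distrib_left]; intro h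
    obtain ⟨ε, hε, h'⟩ := Metric.isOpen_iff.mp (hfc e).isClosed.isOpen_compl _ h
    filter_upwards [Ioo_mem_nhdsGT hε] with r hr z hz
    by_contra hcon
    exact h' (show z ∈ ball (p : ℂ) ε by rw [Metric.mem_ball]; linarith [hr.2]) hz
  obtain ⟨r, hr1, hr2, hr⟩ := (hr1.and (hr2.and self_mem_nhdsWithin)).exists
  have hr : 0 < r := hr
  have hsep : ∀ p ∈ X, ∀ q ∈ X, p ≠ q → 2 * r < Dist.dist p q := fun p hp q hq h =>
    hr1 ⟨p, hp⟩ ⟨q, hq⟩ (fun h' => h (congrArg Subtype.val h'))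
  set O : E → Set ℂ := fun e => Set.range (f e) \ ⋃ p ∈ X, ball p r with hO
  have hOc : ∀ e, IsCompact (O e) := fun e =>
    (hfc e).diff (isOpen_biUnion fun _ _ => isOpen_ball)
  have hOX : ∀ e, ∀ z ∈ O e, ∀ p ∈ X, r ≤ Dist.dist z p := by
    intro e z hz p hp
    by_contra hcon
    exact hz.2 (Set.mem_biUnion hp (by rw [Metric.mem_ball]; linarith))
  let fam : (E ⊕ (E × X)) ⊕ X → Set ℂ := fun i => match i with
    | .inl (.inl e) => O e
    | .inl (.inr (e, p)) => cone (Set.range (f e)) p r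
    | .inr p => {(p : ℂ)}
  have hfam : ∀ i, IsCompact (fam i) := by
    rintro ((e | ⟨e, p⟩) | p)
    · exact hOc e
    · exact cone_compact (hfc e) _ _
    · exact isCompact_singleton
  obtain ⟨ε, hε1, hε⟩ := ((sep_compact fam hfam).and self_mem_nhdsWithin).exists
  have hε : 0 < ε := hε
  have hOx : ∀ e, ∀ q ∈ thickening ε (O e), q ∉ X := by
    intro e q hq hqX
    have := hε1 (.inl (.inl e)) (.inr ⟨q, hqX⟩) (by
      rw [Set.disjoint_left]; rintro z hz rfl
      have := hOX e z hz z hqX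
      simp at this; linarith)
    exact (Set.disjoint_left.mp this) hq (self_subset_thickening hε _ rfl)
  have hcX : ∀ e, ∀ p ∈ X, ∀ z ∈ cone (Set.range (f e)) p r, p ∈ Set.range (f e) := by
    intro e p hp z hz
    by_contra hcon
    obtain ⟨w, hw, hd, -⟩ := hz
    have := hr2 ⟨p, hp⟩ e hcon w hw
    simp only at this; linarith
  have hcXe : ∀ e, ∀ p ∈ X, ∀ z ∈ cone (Set.range (f e)) p r, z ∈ X → z = p := by
    intro e p hp z hz hzX
    by_contra hne
    have h1 := (cone_point hr hz).1
    have := hsep z hzX p hp hne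
    linarith
  have hOO : ∀ e e', e ≠ e' → Disjoint (thickening ε (O e)) (thickening ε (O e')) := by
    intro e e' hne
    refine hε1 (.inl (.inl e)) (.inl (.inl e')) ?_
    rw [Set.disjoint_left]; intro z hz hz'
    have hzX := hint e e' hne ⟨hfK e hz.1, hfK e' hz'.1⟩
    have := hOX e z hz z hzX
    simp at this; linarith
  have hOC : ∀ e e', e ≠ e' → ∀ p ∈ X, Disjoint (thickening ε (O e)) (cone (Set.range (f e')) p r) := by
    intro e e' hne p hp
    refine (hε1 (.inl (.inl e)) (.inl (.inr (e', ⟨p, hp⟩))) ?_).mono_right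
      (self_subset_thickening hε _)
    rw [Set.disjoint_left]; intro z hz hz'
    have h1 := hOX e z hz p hp
    have h2 := cone_point hr hz'
    have hzK := h2.2.1 (le_antisymm h2.1 h1)
    have hzX := hint e e' hne ⟨hfK e hz.1, hfK e' hzK⟩
    have := hOX e z hz z hzX
    simp at this; linarith
  let S : E → Set ℂ := fun e => thickening ε (O e) ∪ ⋃ p ∈ X, cone (Set.range (f e)) p r
  have hSX : ∀ e, ∀ z ∈ S e, z ∈ X → z ∈ K e := by
    rintro e z (hz | hz) hzX
    · exact absurd hzX (hOx e z hz)
    · simp only [Set.mem_iUnion] at hz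
      obtain ⟨p, hp, hz⟩ := hz
      rw [hcXe e p hp z hz hzX]
      exact hfK e (hcX e p hp z hz)
  have hSS : ∀ e e', e ≠ e' → ∀ z, z ∈ S e → z ∈ S e' → z ∈ X := by
    intro e e' hne z hz hz'
    simp only [S, Set.mem_union, Set.mem_iUnion] at hz hz'
    rcases hz with hz | ⟨p, hp, hz⟩ <;> rcases hz' with hz' | ⟨p', hp', hz'⟩
    · exact absurd hz' (Set.disjoint_left.mp (hOO e e' hne) hz)
    · exact absurd hz' (Set.disjoint_left.mp (hOC e e' hne p' hp') hz)
    · exact absurd hz (Set.disjoint_left.mp (hOC e' e (Ne.symm hne) p hp) hz')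
    · have h1 := cone_point hr hz
      have h2 := cone_point hr hz'
      by_cases hpp : p = p'
      · subst hpp
        obtain ⟨w, hw, hwd, hzw⟩ := h1.2.2
        obtain ⟨w', hw', hwd', hzw'⟩ := h2.2.2
        by_cases hzp : z = p
        · rw [hzp]; exact hp
        · exfalso
          have hd : ((Dist.dist z p / r : ℝ) : ℂ) ≠ 0 := by
            rw [Ne, Complex.ofReal_eq_zero]
            have := _root_.dist_pos.mpr hzp
            positivity
          have hww : w = w' := by
            have := hzw.symm.trans hzw'
            have := mul_left_cancel₀ hd (add_left_cancel this)
            exact sub_left_injective this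
          subst hww
          have hwX := hint e e' hne ⟨hfK e hw, hfK e' hw'⟩
          have hwp : w ≠ p := by rintro rfl; simp at hwd; linarith
          have := hsep w hwX p hp hwp
          linarith
      · exfalso
        have := hsep p hp p' hp' hpp
        have := _root_.dist_triangle_left p p' z
        linarith [h1.1, h2.1]
  have hmain : ∀ e, Relation.ReflTransGen (Step (S e) X) (a e) (b e) := by
    intro e
    have := reach (f e) (hf e) X (S e) r ε hr hε hsep (hOx e) (Set.subset_union_left)
      (fun p hp z hz => Or.inr (Set.mem_biUnion hp hz)) 0 1
      (by rw [hf0]; exact ha e) (by rw [hf1]; exact hb e)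
    rwa [hf0, hf1] at this
  choose N p h0 hN hst hne hsimp using fun e => min_chain (hmain e)
  refine ⟨N, p, h0, hN, hne, hsimp, fun e j hj => (hst e j hj).2 (hne e j hj),
    fun e j hj z hz => hSX e z ((hst e j hj).1 hz), ?_⟩
  intro e e' hee i hi j hj z hz hz'
  exact hSS e e' hee z ((hst e i hi).1 hz) ((hst e' j hj).1 hz')

end CrK

namespace CrK
open Metric Filter Topology

/-- unit rotation by angle `δ k` -/
noncomputable def wr (δ : ℝ) (k : SignType) : ℂ := Complex.exp ((δ * (k : ℝ) : ℝ) * Complex.I)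

lemma wr_norm (δ : ℝ) (k : SignType) : ‖wr δ k‖ = 1 := Complex.norm_exp_ofReal_mul_I _

lemma wr_im (δ : ℝ) (k : SignType) : (wr δ k).im = k * Real.sin δ := by
  rw [wr, Complex.exp_ofReal_mul_I_im]; rcases k <;> simp

lemma wr_re (δ : ℝ) (k : SignType) : (wr δ k).re = Real.cos (δ * k) := by
  rw [wr, Complex.exp_ofReal_mul_I_re]

lemma wr_neg (δ : ℝ) (k : SignType) : wr δ (-k) = (starRingEnd ℂ) (wr δ k) := by
  apply Complex.ext
  · rw [wr_re, Complex.conj_re, wr_re]; rcases k <;> simp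
  · rw [wr_im, Complex.conj_im, wr_im]; rcases k <;> simp

lemma sign_inj {k l : SignType} (h : (k : ℝ) = l) : k = l := by
  revert h; rcases k <;> rcases l <;> simp <;> norm_num

lemma wr_inj {δ : ℝ} (h0 : 0 < δ) (h1 : δ < 1) {k l : SignType} (h : wr δ k = wr δ l) : k = l := by
  have hs : 0 < Real.sin δ := Real.sin_pos_of_pos_of_lt_pi h0 (by linarith [Real.pi_gt_three])
  have := congrArg Complex.im h
  rw [wr_im, wr_im] at this
  exact sign_inj (mul_right_cancel₀ hs.ne' this)

lemma wr_tendsto (k : SignType) : Tendsto (fun δ => wr δ k) (𝓝[>] 0) (𝓝 1) := by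
  have : Continuous (fun δ => wr δ k) := by unfold wr; fun_prop
  have h : Tendsto (fun δ => wr δ k) (𝓝[>] 0) (𝓝 (wr 0 k)) := (this.tendsto 0).mono_left nhdsWithin_le_nhds
  simpa [wr] using h

lemma norm_add_sq' (z w : ℂ) : ‖z + w‖ ^ 2 = (z.re + w.re) ^ 2 + (z.im + w.im) ^ 2 := by
  rw [← Complex.normSq_eq_norm_sq, Complex.normSq_apply]; simp; ring

lemma sq_of_norm {z : ℂ} {r : ℝ} (h : ‖z‖ = r) : z.re ^ 2 + z.im ^ 2 = r ^ 2 := by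
  rw [← h, ← Complex.normSq_eq_norm_sq, Complex.normSq_apply]; ring

/-- a point of the chord on the circle is an end point -/
lemma chord_sphere {o A B z : ℂ} {ρ : ℝ} (hA : Dist.dist A o = ρ) (hB : Dist.dist B o = ρ)
    (hz : z ∈ segment ℝ A B) : Dist.dist z o ≤ ρ ∧ (Dist.dist z o = ρ → z = A ∨ z = B) := by
  have hA' : A ∈ closedBall o ρ := by simp [hA]
  have hB' : B ∈ closedBall o ρ := by simp [hB]
  refine ⟨(convex_closedBall o ρ).segment_subset hA' hB' hz, fun h => ?_⟩
  by_contra hne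
  push Not at hne
  by_cases hAB : A = B
  · subst hAB; simp at hz; exact hne.1 hz
  have : z ∈ openSegment ℝ A B := mem_openSegment_of_ne_left_right hne.1.symm hne.2.symm hz
  have hρ : ρ ≠ 0 := by
    rintro rfl; rw [_root_.dist_eq_zero] at hA hB; exact hAB (hA.trans hB.symm)
  have := (strictConvex_closedBall ℝ o ρ).openSegment_subset hA' hB' hAB this
  rw [interior_closedBall _ hρ, Metric.mem_ball] at this
  linarith

/-- two chords of a circle with distinct ends meet in at most one point -/
lemma chord_chord {o A B C D : ℂ} {ρ : ℝ} (hA : Dist.dist A o = ρ) (hB : Dist.dist B o = ρ)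
    (hC : Dist.dist C o = ρ) (hCA : C ≠ A) (hCB : C ≠ B) :
    (segment ℝ A B ∩ segment ℝ C D).Subsingleton := by
  rintro z ⟨hz1, hz2⟩ z' ⟨hz1', hz2'⟩
  rw [segment_eq_image'] at hz1 hz2 hz1' hz2'
  obtain ⟨s, -, rfl⟩ := hz1
  obtain ⟨s', -, rfl⟩ := hz1'
  obtain ⟨t, -, ht⟩ := hz2
  obtain ⟨t', -, ht'⟩ := hz2'
  simp only [Complex.real_smul] at *
  by_contra hne
  have htt : (t : ℂ) - t' ≠ 0 := by
    intro h
    have : t = t' := by exact_mod_cast sub_eq_zero.mp h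
    subst this
    exact hne (ht.symm.trans ht')
  have h1 : D - C = ((s : ℂ) - s') / (t - t') * (B - A) := by
    field_simp
    linear_combination ht - ht'
  have h2 : C = A + ((s - t * ((s - s') / (t - t')) : ℝ) : ℂ) * (B - A) := by
    push_cast
    linear_combination ht - t * h1
  set μ := s - t * ((s - s') / (t - t'))
  have e1 := sq_of_norm (_root_.dist_eq_norm A o ▸ hA)
  have e2 := sq_of_norm (_root_.dist_eq_norm B o ▸ hB)
  have e3 := sq_of_norm (_root_.dist_eq_norm C o ▸ hC)
  rw [h2] at e3
  simp at e1 e2 e3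
  have e4 : μ * (1 - μ) * ((B.re - A.re) ^ 2 + (B.im - A.im) ^ 2) = 0 := by
    linear_combination e1 * (1 - μ) + e2 * μ - e3
  rcases mul_eq_zero.mp e4 with h | h
  · rcases mul_eq_zero.mp h with h | h
    · apply hCA; rw [h2, h]; simp
    · apply hCB; rw [h2, show μ = 1 by linarith]; simp
  · have hx : B.re = A.re := by nlinarith [sq_nonneg (B.re - A.re), sq_nonneg (B.im - A.im)]
    have hy : B.im = A.im := by nlinarith [sq_nonneg (B.re - A.re), sq_nonneg (B.im - A.im)]
    apply hCA; rw [h2, show B = A from Complex.ext hx hy]; simp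

lemma exists_sqrt (z : ℂ) : ∃ c : ℂ, c ^ 2 = z := ⟨z ^ (1 / 2 : ℂ), by
  rw [← Complex.cpow_nat_mul]; norm_num⟩

/-- parallel chords through a bend are disjoint -/
lemma chord_parallel {A B : ℂ} (hA : ‖A‖ = 1) (hB : ‖B‖ = 1) (hAB : A ≠ B) :
    ∀ᶠ δ in 𝓝[>] (0 : ℝ), ∀ k l : SignType, k ≠ l → ∀ ρ : ℝ, 0 < ρ → ∀ o : ℂ,
      Disjoint (segment ℝ (o + ρ * A * wr δ (-k)) (o + ρ * B * wr δ k))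
        (segment ℝ (o + ρ * A * wr δ (-l)) (o + ρ * B * wr δ l)) := by
  obtain ⟨c, hc⟩ := exists_sqrt (A * B)
  have hcn : ‖c‖ = 1 := by
    have : ‖c‖ ^ 2 = 1 := by rw [← norm_pow, hc, norm_mul, hA, hB, one_mul]
    nlinarith [norm_nonneg c]
  have hcc : c * (starRingEnd ℂ) c = 1 := by
    rw [Complex.mul_conj, Complex.normSq_eq_norm_sq, hcn]; simp
  set α := B * (starRingEnd ℂ) c with hα
  have hα' : A * (starRingEnd ℂ) c = (starRingEnd ℂ) α := by
    have hBB : B * (starRingEnd ℂ) B = 1 := by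
      rw [Complex.mul_conj, Complex.normSq_eq_norm_sq, hB]; simp
    rw [hα, map_mul, Complex.conj_conj]
    calc A * (starRingEnd ℂ) c = A * (B * (starRingEnd ℂ) B) * (starRingEnd ℂ) c := by rw [hBB, mul_one]
      _ = c ^ 2 * (starRingEnd ℂ) B * (starRingEnd ℂ) c := by rw [hc]; ring
      _ = (starRingEnd ℂ) B * c * (c * (starRingEnd ℂ) c) := by ring
      _ = _ := by rw [hcc, mul_one]
  have him : α.im ≠ 0 := by
    intro h
    apply hAB
    have h2 : (starRingEnd ℂ) α = α := Complex.conj_eq_iff_im.mpr h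
    rw [← hα', hα] at h2
    have : (starRingEnd ℂ) c ≠ 0 := fun h0 => by rw [h0, mul_zero] at hcc; exact zero_ne_one hcc
    exact mul_right_cancel₀ this h2
  have hre : |α.re| ≤ 1 := (Complex.abs_re_le_norm α).trans (by rw [hα, norm_mul, hB, RCLike.norm_conj, hcn, one_mul])
  have hpos : 0 < |α.im| := abs_pos.mpr him
  filter_upwards [Ioo_mem_nhdsGT (lt_min one_pos (half_pos hpos))] with δ hδ k l hkl ρ hρ o
  have h0 := hδ.1
  have h1 : δ < 1 := hδ.2.trans_le (min_le_left _ _)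
  have h2 : δ < |α.im| / 2 := hδ.2.trans_le (min_le_right _ _)
  have hs1 : δ / 2 < Real.sin δ := by
    have := Real.sin_gt_sub_cube h0
    have : δ ^ 3 ≤ δ := by
      have h3 : δ ^ 2 ≤ 1 := by nlinarith
      nlinarith
    linarith
  have hc1 : 1 - Real.cos δ ≤ δ ^ 2 / 2 := by
    have := Real.one_sub_sq_div_two_le_cos (x := δ); linarith
  have hc0 : 0 ≤ 1 - Real.cos δ := by linarith [Real.cos_le_one δ]
  -- the functional
  have key : ∀ k : SignType, ∀ z ∈ segment ℝ (o + ρ * A * wr δ (-k)) (o + ρ * B * wr δ k),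
      ((z - o) * (starRingEnd ℂ) c).re = ρ * (α * wr δ k).re := by
    intro k z hz
    rw [segment_eq_image'] at hz
    obtain ⟨t, -, rfl⟩ := hz
    have e1 : ρ * A * wr δ (-k) * (starRingEnd ℂ) c = ρ * (starRingEnd ℂ) (α * wr δ k) := by
      rw [map_mul, ← hα', wr_neg]; ring
    have e2 : ρ * B * wr δ k * (starRingEnd ℂ) c = ρ * (α * wr δ k) := by rw [hα]; ring
    have : (o + ρ * A * wr δ (-k) + t • (o + ρ * B * wr δ k - (o + ρ * A * wr δ (-k))) - o)
        * (starRingEnd ℂ) c = ρ * (starRingEnd ℂ) (α * wr δ k) + t * (ρ * (α * wr δ k) -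
          ρ * (starRingEnd ℂ) (α * wr δ k)) := by
      rw [← e1, ← e2, Complex.real_smul]; ring
    rw [this]
    simp
  rw [Set.disjoint_left]
  intro z hz hz'
  have h3 := mul_left_cancel₀ hρ.ne' ((key k z hz).symm.trans (key l z hz'))
  clear_value α
  rw [Complex.mul_re, Complex.mul_re, wr_im, wr_im, wr_re, wr_re] at h3
  have habs : |α.re * (1 - Real.cos δ)| ≤ δ ^ 2 / 2 := by
    rw [abs_mul, abs_of_nonneg hc0]
    nlinarith [abs_nonneg α.re]
  have habs2 : δ ^ 2 / 2 < |α.im * Real.sin δ| := by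
    rw [abs_mul, abs_of_pos (by linarith : 0 < Real.sin δ)]
    nlinarith
  have hcon1 : α.re * (1 - Real.cos δ) ≠ α.im * Real.sin δ := by
    intro h; rw [h] at habs; linarith
  have hcon2 : α.re * (1 - Real.cos δ) ≠ -(α.im * Real.sin δ) := by
    intro h; rw [h, abs_neg] at habs; linarith
  have hcon3 : α.im * Real.sin δ ≠ 0 := by
    intro h; rw [h, abs_zero] at habs2; nlinarith
  revert h3 hkl
  rcases k <;> rcases l <;> simp <;> intro h
  all_goals first
    | (apply hcon1; linarith)
    | (apply hcon2; linarith)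
    | (have : α.im * Real.sin δ = 0 := by linarith
       exact (mul_ne_zero_iff.mp hcon3).2 ((mul_eq_zero.mp this).resolve_left (mul_ne_zero_iff.mp hcon3).1))
    | skip
end CrK

namespace CrK
open Metric Filter Topology

lemma wr_neg' (δ : ℝ) (k : SignType) : wr δ (-k) = (wr δ k).re - (wr δ k).im * Complex.I := by
  rw [wr_neg]; apply Complex.ext <;> simp

section net
variable {I : Type*} (P : I → Bool → ℂ)

noncomputable def dir (i : I) (s : Bool) : ℂ :=
  (P i (!s) - P i s) / (‖P i true - P i false‖ : ℝ)

noncomputable def port (ρ δ : ℝ) (i : I) (s : Bool) (k : SignType) : ℂ :=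
  P i s + ρ * dir P i s * wr δ (if s then -k else k)

def strip (ρ δ : ℝ) (i : I) (k : SignType) : Set ℂ :=
  segment ℝ (port P ρ δ i false k) (port P ρ δ i true k)

lemma dir_true (i : I) : dir P i true = - dir P i false := by
  simp only [dir, Bool.not_true, Bool.not_false]; rw [← neg_div, neg_sub]

lemma dir_norm {i : I} (h : P i false ≠ P i true) (s : Bool) : ‖dir P i s‖ = 1 := by
  have : ‖P i true - P i false‖ ≠ 0 := norm_ne_zero_iff.mpr (sub_ne_zero.mpr h.symm)
  have key : ‖dir P i false‖ = 1 := by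
    rw [dir, norm_div, Bool.not_false, Complex.norm_real, norm_norm, div_self this]
  cases s
  · exact key
  · rw [dir_true, norm_neg, key]

lemma dir_mul {i : I} (h : P i false ≠ P i true) :
    P i true = P i false + dir P i false * (‖P i true - P i false‖ : ℝ) := by
  have : ((‖P i true - P i false‖ : ℝ) : ℂ) ≠ 0 := by
    exact_mod_cast norm_ne_zero_iff.mpr (sub_ne_zero.mpr h.symm)
  rw [dir, Bool.not_false, div_mul_cancel₀ _ this]; ring

lemma port_dist {ρ δ : ℝ} (hρ : 0 < ρ) {i : I} (h : P i false ≠ P i true) (s : Bool) (k : SignType) :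
    Dist.dist (port P ρ δ i s k) (P i s) = ρ := by
  rw [_root_.dist_eq_norm, port, add_sub_cancel_left, norm_mul, norm_mul, wr_norm, dir_norm P h]
  simp [abs_of_pos hρ]

lemma strip_coord {ρ δ : ℝ} {i : I} (h : P i false ≠ P i true) (k : SignType) {z : ℂ}
    (hρ : 0 < ρ) (hρ2 : 2 * ρ ≤ ‖P i true - P i false‖)
    (hz : z ∈ strip P ρ δ i k) : ∃ x : ℝ, z = P i false + dir P i false * (x + (ρ * (wr δ k).im : ℝ) * Complex.I) ∧
      ρ * (wr δ k).re ≤ x ∧ x ≤ ‖P i true - P i false‖ - ρ * (wr δ k).re := by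
  have hm := dir_mul P h
  set ℓ := ‖P i true - P i false‖
  have hw : (wr δ k).re ≤ 1 := (Complex.re_le_norm _).trans (wr_norm δ k).le
  rw [strip, segment_eq_image'] at hz
  obtain ⟨t, ⟨h0, h1⟩, rfl⟩ := hz
  refine ⟨ρ * (wr δ k).re + t * (ℓ - 2 * ρ * (wr δ k).re), ?_, ?_, ?_⟩
  · have hwk : wr δ k = (wr δ k).re + (wr δ k).im * Complex.I := (Complex.re_add_im _).symm
    have hwk' : wr δ (-k) = (wr δ k).re - (wr δ k).im * Complex.I := wr_neg' δ k
    simp only [port, Bool.false_eq_true, if_false, if_true, dir_true, hm, Complex.real_smul]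
    rw [hwk']
    push_cast
    linear_combination (ρ * dir P i false * (1 - t)) * hwk
  · have : 0 ≤ ℓ - 2 * ρ * (wr δ k).re := by nlinarith
    nlinarith
  · have : 0 ≤ ℓ - 2 * ρ * (wr δ k).re := by nlinarith
    nlinarith

lemma norm_sq_xy (x y : ℝ) : ‖(x : ℂ) + (y : ℝ) * Complex.I‖ ^ 2 = x ^ 2 + y ^ 2 := by
  rw [← Complex.normSq_eq_norm_sq, Complex.normSq_apply]; simp; ring

lemma strip_near {ρ δ : ℝ} (hδ0 : 0 < δ) (hδ1 : δ < 1) {i : I} (h : P i false ≠ P i true)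
    (k : SignType) {z y : ℂ} (hρ : 0 < ρ) (hρ2 : 2 * ρ ≤ ‖P i true - P i false‖)
    (hz : z ∈ strip P ρ δ i k)
    (hy : y = P i false ∨ y = P i true ∨ ∀ w ∈ segment ℝ (P i false) (P i true), 2 * ρ < Dist.dist w y)
    (hd : Dist.dist z y ≤ ρ) : ∃ s, y = P i s ∧ z = port P ρ δ i s k := by
  obtain ⟨x, hzx, hx1, hx2⟩ := strip_coord P h k hρ hρ2 hz
  have hm := dir_mul P h
  have hn := dir_norm P h false
  set ℓ := ‖P i true - P i false‖ with hℓ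
  have hsq := sq_of_norm (wr_norm δ k)
  have hcos : 0 < (wr δ k).re := by
    rw [wr_re]; apply Real.cos_pos_of_mem_Ioo
    have := Real.pi_gt_three
    rcases k <;> constructor <;> simp <;> linarith
  have hwk : wr δ k = (wr δ k).re + (wr δ k).im * Complex.I := (Complex.re_add_im _).symm
  have hwk' : wr δ (-k) = (wr δ k).re - (wr δ k).im * Complex.I := wr_neg' δ k
  have hcρ : 0 < ρ * (wr δ k).re := by positivity
  rcases hy with rfl | rfl | hy
  · refine ⟨false, rfl, ?_⟩
    rw [_root_.dist_eq_norm, hzx, add_sub_cancel_left, norm_mul, hn, one_mul] at hd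
    have h2 := norm_sq_xy x (ρ * (wr δ k).im)
    have h3 : ‖(x : ℂ) + (ρ * (wr δ k).im : ℝ) * Complex.I‖ ^ 2 ≤ ρ ^ 2 := by
      gcongr
    have h4 : x = ρ * (wr δ k).re := by
      by_contra hne
      have : ρ * (wr δ k).re < x := lt_of_le_of_ne hx1 (Ne.symm hne)
      nlinarith
    rw [hzx, h4, port]
    simp only [Bool.false_eq_true, if_false]
    conv_rhs => rw [hwk]
    push_cast; ring
  · refine ⟨true, rfl, ?_⟩
    have : z - P i true = dir P i false * (((x - ℓ : ℝ) : ℂ) + (ρ * (wr δ k).im : ℝ) * Complex.I) := by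
      rw [hzx, hm]; push_cast; ring
    rw [_root_.dist_eq_norm, this, norm_mul, hn, one_mul] at hd
    have h2 := norm_sq_xy (x - ℓ) (ρ * (wr δ k).im)
    have h3 : ‖((x - ℓ : ℝ) : ℂ) + (ρ * (wr δ k).im : ℝ) * Complex.I‖ ^ 2 ≤ ρ ^ 2 := by
      gcongr
    have h4 : x = ℓ - ρ * (wr δ k).re := by
      by_contra hne
      have : x < ℓ - ρ * (wr δ k).re := lt_of_le_of_ne hx2 hne
      nlinarith
    rw [hzx, h4, port, dir_true, hm]
    simp only [if_true]
    rw [hwk']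
    push_cast; ring
  · exfalso
    have hxl : 0 ≤ x ∧ x ≤ ℓ := ⟨by linarith, by linarith⟩
    have hℓ0 : 0 < ℓ := by linarith
    have hw : P i false + dir P i false * x ∈ segment ℝ (P i false) (P i true) := by
      rw [segment_eq_image']
      refine ⟨x / ℓ, ⟨by have := hxl.1; positivity, by rw [div_le_one hℓ0]; exact hxl.2⟩, ?_⟩
      rw [hm]
      have : (ℓ : ℂ) ≠ 0 := by exact_mod_cast hℓ0.ne'
      simp only [Complex.real_smul]; push_cast; field_simp; ring
    have h1 := hy _ hw
    have h2 : Dist.dist (P i false + dir P i false * x) z ≤ ρ := by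
      rw [_root_.dist_eq_norm, hzx]
      have : P i false + dir P i false * x - (P i false + dir P i false * (x + (ρ * (wr δ k).im : ℝ) * Complex.I))
        = - (dir P i false * ((ρ * (wr δ k).im : ℝ) * Complex.I)) := by ring
      rw [this, norm_neg, norm_mul, hn, one_mul, norm_mul, Complex.norm_I, mul_one, Complex.norm_real,
        Real.norm_eq_abs, abs_mul, abs_of_pos hρ]
      have := (Complex.abs_im_le_norm (wr δ k)).trans (wr_norm δ k).le
      nlinarith
    linarith [_root_.dist_triangle (P i false + dir P i false * x) z y]

lemma strip_same {ρ δ : ℝ} (hδ0 : 0 < δ) (hδ1 : δ < 1) {i : I} (h : P i false ≠ P i true)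
    {k l : SignType} (hρ : 0 < ρ) (hρ2 : 2 * ρ ≤ ‖P i true - P i false‖) (hkl : k ≠ l) :
    Disjoint (strip P ρ δ i k) (strip P ρ δ i l) := by
  rw [Set.disjoint_left]; intro z hz hz'
  obtain ⟨x, hzx, -, -⟩ := strip_coord P h k hρ hρ2 hz
  obtain ⟨x', hzx', -, -⟩ := strip_coord P h l hρ hρ2 hz'
  have hd : dir P i false ≠ 0 := by
    rw [← norm_ne_zero_iff, dir_norm P h]; exact one_ne_zero
  have := mul_left_cancel₀ hd (add_left_cancel (hzx.symm.trans hzx'))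
  have := congrArg Complex.im this
  simp only [wr_im] at this
  simp at this
  have hs : 0 < Real.sin δ := Real.sin_pos_of_pos_of_lt_pi hδ0 (by linarith [Real.pi_gt_three])
  rcases this with h | h
  · rcases h with h | h
    · exact hkl (sign_inj h)
    · exact hs.ne' h
  · exact hρ.ne' h

end net
end CrK

namespace CrK
open Metric Filter Topology

section net
variable {I : Type*} (P : I → Bool → ℂ)

lemma dir_openSegment {i : I} (h : P i false ≠ P i true) (s : Bool) {t : ℝ} (h0 : 0 < t)
    (h1 : t < ‖P i true - P i false‖) :
    P i s + dir P i s * t ∈ openSegment ℝ (P i false) (P i true) := by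
  have hm := dir_mul P h
  set ℓ := ‖P i true - P i false‖ with hℓ
  have hℓ0 : 0 < ℓ := h0.trans h1
  have hc : (ℓ : ℂ) ≠ 0 := by exact_mod_cast hℓ0.ne'
  rw [openSegment_eq_image']
  cases s
  · refine ⟨t / ℓ, ⟨by positivity, by rwa [div_lt_one hℓ0]⟩, ?_⟩
    rw [hm]; simp only [Complex.real_smul]; push_cast; field_simp; ring
  · refine ⟨1 - t / ℓ, ⟨sub_pos.mpr ((div_lt_one hℓ0).mpr h1), sub_lt_self _ (by positivity)⟩, ?_⟩
    rw [dir_true, hm]; simp only [Complex.real_smul]; push_cast; field_simp; ring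

lemma dir_ne (hne : ∀ i, P i false ≠ P i true)
    (hdis : ∀ i j, i ≠ j → Disjoint (openSegment ℝ (P i false) (P i true))
      (openSegment ℝ (P j false) (P j true)))
    {i j : I} {s t : Bool} (hst : (i, s) ≠ (j, t)) (hP : P i s = P j t) :
    dir P i s ≠ dir P j t := by
  intro hd
  by_cases hij : i = j
  · subst hij
    cases s <;> cases t <;> simp at hst
    · exact hne i hP
    · exact hne i hP.symm
  · have hpos : ∀ i, 0 < ‖P i true - P i false‖ := fun i =>
      norm_pos_iff.mpr (sub_ne_zero.mpr (hne i).symm)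
    obtain ⟨r, hr0, hr⟩ := exists_between (lt_min (hpos i) (hpos j))
    refine Set.disjoint_left.mp (hdis i j hij)
      (dir_openSegment P (hne i) s hr0 (hr.trans_le (min_le_left _ _))) ?_
    rw [hP, hd]
    exact dir_openSegment P (hne j) t hr0 (hr.trans_le (min_le_right _ _))

def core (ρ : ℝ) (i : I) : Set ℂ :=
  segment ℝ (P i false + ρ * dir P i false) (P i true + ρ * dir P i true)

lemma core_sub {ρ : ℝ} {i : I} (h : P i false ≠ P i true) (hρ : 0 < ρ)
    (hρ2 : 2 * ρ ≤ ‖P i true - P i false‖) :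
    core P ρ i ⊆ openSegment ℝ (P i false) (P i true) := by
  apply (convex_openSegment _ _).segment_subset
  · rw [mul_comm]; exact dir_openSegment P h false hρ (by linarith)
  · rw [mul_comm]; exact dir_openSegment P h true hρ (by linarith)

lemma segment_compact (a b : ℂ) : IsCompact (segment ℝ a b) := by
  rw [segment_eq_image']
  exact isCompact_Icc.image (by fun_prop)

theorem network [Finite I] (Y : Set ℂ) (hYf : Y.Finite) (hne : ∀ i, P i false ≠ P i true)
    (hopen : ∀ i, ∀ z ∈ openSegment ℝ (P i false) (P i true), z ∉ Y)
    (hdis : ∀ i j, i ≠ j → Disjoint (openSegment ℝ (P i false) (P i true))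
      (openSegment ℝ (P j false) (P j true))) :
    ∃ ρ : ℝ, 0 < ρ ∧ (∀ y ∈ Y, ∀ y' ∈ Y, y ≠ y' → 2 * ρ < Dist.dist y y') ∧
    ∀ᶠ δ in 𝓝[>] (0 : ℝ), (0 < δ ∧ δ < 1) ∧
      (∀ i k, ∀ z ∈ strip P ρ δ i k, ∀ y ∈ Y, Dist.dist z y ≤ ρ → ∃ s, y = P i s ∧ z = port P ρ δ i s k) ∧
      (∀ i k j l, (i, k) ≠ (j, l) → Disjoint (strip P ρ δ i k) (strip P ρ δ j l)) ∧
      (∀ i s k j t l, P i s = P j t → (i, s, k) ≠ (j, t, l) → port P ρ δ i s k ≠ port P ρ δ j t l) ∧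
      (∀ i j, i ≠ j → P i true = P j false → ∀ k l, k ≠ l →
        Disjoint (segment ℝ (port P ρ δ i true k) (port P ρ δ j false k))
          (segment ℝ (port P ρ δ i true l) (port P ρ δ j false l))) := by
  classical
  have : Finite Y := hYf
  have hpos : ∀ i, 0 < ‖P i true - P i false‖ := fun i =>
    norm_pos_iff.mpr (sub_ne_zero.mpr (hne i).symm)
  have hr1 : ∀ᶠ r in 𝓝[>] (0 : ℝ), ∀ p q : Y, p ≠ q → 2 * r < Dist.dist (p : ℂ) q := by
    rw [eventually_all]; intro p; rw [eventually_all]; intro q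
    rw [eventually_imp_distrib_left]; intro h
    have : 0 < Dist.dist (p : ℂ) q := _root_.dist_pos.mpr (fun h' => h (Subtype.ext h'))
    filter_upwards [Ioo_mem_nhdsGT (half_pos this)] with r hr
    linarith [hr.2]
  have hr2 : ∀ᶠ r in 𝓝[>] (0 : ℝ), ∀ (y : Y) (i : I), (y : ℂ) ∉ segment ℝ (P i false) (P i true) →
      ∀ z ∈ segment ℝ (P i false) (P i true), 2 * r < Dist.dist z y := by
    rw [eventually_all]; intro p; rw [eventually_all]; intro e
    rw [eventually_imp_distrib_left]; intro h
    obtain ⟨ε, hε, h'⟩ := Metric.isOpen_iff.mp (segment_compact _ _).isClosed.isOpen_compl _ h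
    filter_upwards [Ioo_mem_nhdsGT (half_pos hε)] with r hr z hz
    by_contra hcon
    exact h' (show z ∈ ball (p : ℂ) ε by rw [Metric.mem_ball]; linarith [hr.2]) hz
  have hr3 : ∀ᶠ r in 𝓝[>] (0 : ℝ), ∀ i, 2 * r ≤ ‖P i true - P i false‖ := by
    rw [eventually_all]; intro i
    filter_upwards [Ioo_mem_nhdsGT (half_pos (hpos i))] with r hr
    linarith [hr.2]
  obtain ⟨ρ, hr1, hr2, hr3, hρ⟩ := (hr1.and (hr2.and (hr3.and self_mem_nhdsWithin))).exists
  have hρ : 0 < ρ := hρ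
  refine ⟨ρ, hρ, fun y hy y' hy' h => hr1 ⟨y, hy⟩ ⟨y', hy'⟩ (fun h' => h (congrArg Subtype.val h')), ?_⟩
  obtain ⟨ε, hε1, hε⟩ := ((sep_compact (core P ρ) (fun i => segment_compact _ _)).and
    self_mem_nhdsWithin).exists
  have hε : 0 < ε := hε
  have hd1 : ∀ᶠ δ in 𝓝[>] (0 : ℝ), ∀ k, ρ * ‖wr δ k - 1‖ < ε := by
    rw [eventually_all]; intro k
    have : Tendsto (fun δ => ρ * ‖wr δ k - 1‖) (𝓝[>] 0) (𝓝 (ρ * ‖(1 : ℂ) - 1‖)) :=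
      (((wr_tendsto k).sub_const 1).norm).const_mul ρ
    apply this.eventually_lt_const
    simpa using hε
  have hd2 : ∀ᶠ δ in 𝓝[>] (0 : ℝ), ∀ i s k j t l, P i s = P j t → (i, s) ≠ (j, t) →
      port P ρ δ i s k ≠ port P ρ δ j t l := by
    simp only [eventually_all, eventually_imp_distrib_left]
    intro i s k j t l hP hst
    have h1 : Tendsto (fun δ => port P ρ δ i s k) (𝓝[>] 0) (𝓝 (P i s + ρ * dir P i s * 1)) :=
      ((wr_tendsto _).const_mul _).const_add _
    have h2 : Tendsto (fun δ => port P ρ δ j t l) (𝓝[>] 0) (𝓝 (P j t + ρ * dir P j t * 1)) :=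
      ((wr_tendsto _).const_mul _).const_add _
    have h3 := (h1.sub h2).eventually_ne (b₂ := 0) (by
      rw [hP, mul_one, mul_one, sub_ne_zero]
      intro h
      have h3 := add_left_cancel h
      have hρc : (ρ : ℂ) ≠ 0 := by exact_mod_cast hρ.ne'
      exact dir_ne P hne hdis hst hP (mul_left_cancel₀ hρc h3))
    filter_upwards [h3] with δ hδ
    exact sub_ne_zero.mp hδ
  have hd3 : ∀ᶠ δ in 𝓝[>] (0 : ℝ), (∀ i j, i ≠ j → P i true = P j false → ∀ k l, k ≠ l →
        Disjoint (segment ℝ (port P ρ δ i true k) (port P ρ δ j false k))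
          (segment ℝ (port P ρ δ i true l) (port P ρ δ j false l))) := by
    simp only [eventually_all (ι := I), eventually_imp_distrib_left]
    intro i j hij hP
    have := chord_parallel (dir_norm P (hne i) true) (dir_norm P (hne j) false)
      (dir_ne P hne hdis (s := true) (t := false) (by simp) hP)
    filter_upwards [this] with δ hδ k l hkl
    have := hδ k l hkl ρ hρ (P i true)
    simpa only [port, Bool.false_eq_true, if_false, if_true, hP] using this
  filter_upwards [Ioo_mem_nhdsGT one_pos, hd1, hd2, hd3] with δ hδ hd1 hd2 hd3
  refine ⟨hδ, ?_, ?_, ?_, hd3⟩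
  · intro i k z hz y hy hd
    refine strip_near P hδ.1 hδ.2 (hne i) k hρ (hr3 i) hz ?_ hd
    by_cases hys : y ∈ segment ℝ (P i false) (P i true)
    · by_contra hcon
      push Not at hcon
      exact hopen i y (mem_openSegment_of_ne_left_right (Ne.symm hcon.1) (Ne.symm hcon.2.1) hys) hy
    · exact Or.inr (Or.inr (hr2 ⟨y, hy⟩ i hys))
  · intro i k j l hne'
    by_cases hij : i = j
    · subst hij
      exact strip_same P hδ.1 hδ.2 (hne i) hρ (hr3 i) (by simpa using hne')
    · have hstrip : ∀ i k, strip P ρ δ i k ⊆ thickening ε (core P ρ i) := by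
        intro i k
        have hconv : Convex ℝ (thickening ε (core P ρ i)) := (convex_segment _ _).thickening ε
        have hp : ∀ s, P i s + ρ * dir P i s ∈ core P ρ i →
            port P ρ δ i s k ∈ thickening ε (core P ρ i) := by
          intro s hs
          rw [mem_thickening_iff]
          refine ⟨_, hs, ?_⟩
          rw [_root_.dist_eq_norm, port]
          have : ∀ w : ℂ, P i s + ρ * dir P i s * w - (P i s + ρ * dir P i s) =
            ρ * dir P i s * (w - 1) := fun w => by ring
          rw [this, norm_mul, norm_mul, dir_norm P (hne i), Complex.norm_real, Real.norm_eq_abs,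
            abs_of_pos hρ, mul_one]
          exact hd1 _
        exact hconv.segment_subset (hp false (left_mem_segment ℝ _ _))
          (hp true (right_mem_segment ℝ _ _))
      refine (hε1 i j ?_).mono (hstrip i k) (hstrip j l)
      exact (hdis i j hij).mono (core_sub P (hne i) hρ (hr3 i)) (core_sub P (hne j) hρ (hr3 j))
  · intro i s k j t l hP hst
    by_cases hij : (i, s) = (j, t)
    · obtain ⟨rfl, rfl⟩ := Prod.mk.injEq _ _ _ _ ▸ hij
      intro h
      have hρc : (ρ : ℂ) ≠ 0 := by exact_mod_cast hρ.ne'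
      have hd : dir P i s ≠ 0 := by
        rw [← norm_ne_zero_iff, dir_norm P (hne i)]; exact one_ne_zero
      have := wr_inj hδ.1 hδ.2 (mul_left_cancel₀ (mul_ne_zero hρc hd) (add_left_cancel h))
      apply hst
      cases s
      · simpa using this
      · simpa using this
    · exact hd2 i s k j t l hP hij

end net
end CrK

namespace CrK
open Metric Filter Topology

lemma joinedIn_seg {S : Set ℂ} {a b : ℂ} (h : segment ℝ a b ⊆ S) : JoinedIn S a b :=
  (((convex_segment a b).isPathConnected ⟨a, left_mem_segment ℝ a b⟩).joinedIn a
    (left_mem_segment ℝ a b) b (right_mem_segment ℝ a b)).mono h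

section tube
variable {E : Type*} (N : E → ℕ) (p : E → ℕ → ℂ)

/-- end points of the segments of all chains -/
def chP (i : Σ e, Fin (N e)) (s : Bool) : ℂ := p i.1 (if s then i.2 + 1 else i.2)

def tubeT (ρ δ : ℝ) (e : E) (k : SignType) : Set ℂ :=
  {z | (∃ (j : ℕ) (hj : j < N e), z ∈ strip (chP N p) ρ δ ⟨e, ⟨j, hj⟩⟩ k) ∨
    ∃ (j : ℕ) (hj : j + 1 < N e), z ∈ segment ℝ
      (port (chP N p) ρ δ ⟨e, ⟨j, Nat.lt_of_succ_lt hj⟩⟩ true k)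
      (port (chP N p) ρ δ ⟨e, ⟨j + 1, hj⟩⟩ false k)}

lemma tube_joined (ρ δ : ℝ) (e : E) (k : SignType) (j : ℕ) (hj : j < N e) :
    JoinedIn (tubeT N p ρ δ e k) (port (chP N p) ρ δ ⟨e, ⟨0, by omega⟩⟩ false k)
      (port (chP N p) ρ δ ⟨e, ⟨j, hj⟩⟩ true k) := by
  induction j with
  | zero => exact joinedIn_seg fun z hz => Or.inl ⟨0, hj, hz⟩
  | succ j ih =>
    refine (ih (by omega)).trans (JoinedIn.trans (joinedIn_seg (b := port (chP N p) ρ δ ⟨e, ⟨j + 1, hj⟩⟩ false k) ?_)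
      (joinedIn_seg ?_))
    · exact fun z hz => Or.inr ⟨j, hj, hz⟩
    · exact fun z hz => Or.inl ⟨j + 1, hj, hz⟩

theorem tube [Finite E] (X : Set ℂ) (hX : X.Finite) (hN : ∀ e, 0 < N e)
    (hne : ∀ e, ∀ j < N e, p e j ≠ p e (j + 1))
    (hsimp : ∀ e i j, i < j → j < N e → ∀ z, z ∈ segment ℝ (p e i) (p e (i + 1)) →
        z ∈ segment ℝ (p e j) (p e (j + 1)) → j = i + 1 ∧ z = p e j)
    (hop : ∀ e, ∀ j < N e, ∀ z ∈ openSegment ℝ (p e j) (p e (j + 1)), z ∉ X)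
    (hef : ∀ e f, e ≠ f → ∀ i < N e, ∀ j < N f, ∀ z, z ∈ segment ℝ (p e i) (p e (i + 1)) →
        z ∈ segment ℝ (p f j) (p f (j + 1)) → z ∈ X) :
    ∃ ρ : ℝ, 0 < ρ ∧ ∃ u : E → Bool → ℂ, (∀ e b, ‖u e b‖ = 1) ∧
      (∀ e b f c, (e, b) ≠ (f, c) → p e (if b then N e else 0) = p f (if c then N f else 0) →
        u e b ≠ u f c) ∧
      (∀ y ∈ X, ∀ y' ∈ X, y ≠ y' → 2 * ρ < Dist.dist y y') ∧
      ∀ᶠ δ in 𝓝[>] (0 : ℝ), ∃ T : E → SignType → Set ℂ,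
        (∀ e k, JoinedIn (T e k) (p e 0 + ρ * u e false * wr δ k)
          (p e (N e) + ρ * u e true * wr δ (-k))) ∧
        (∀ e k, ∀ x ∈ X, (∀ j, 0 < j → j < N e → p e j ≠ x) → ∀ z ∈ T e k, Dist.dist z x ≤ ρ →
          ∃ b : Bool, x = p e (if b then N e else 0) ∧
            z = x + ρ * u e b * wr δ (if b then -k else k)) ∧
        (∀ e k l, k ≠ l → Disjoint (T e k) (T e l)) ∧
        (∀ e f k l, e ≠ f → ∀ z ∈ T e k, z ∈ T f l → ∃ q ∈ X, Dist.dist z q ≤ ρ ∧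
          (∃ i, 0 < i ∧ i < N e ∧ p e i = q) ∧ (∃ j, 0 < j ∧ j < N f ∧ p f j = q)) ∧
        (∀ e f k l, e ≠ f → ∀ q ∈ X, (T e k ∩ T f l ∩ closedBall q ρ).Subsingleton) := by
  classical
  set P := chP N p with hP
  have pinj : ∀ e i j, i < j → j ≤ N e → p e i ≠ p e j := by
    intro e i j hij hj h
    by_cases hjN : j < N e
    · have h1 := hsimp e i j hij hjN (p e i) (left_mem_segment ℝ _ _) (by
        rw [h]; exact left_mem_segment ℝ _ _)
      have := hne e i (by omega)
      rw [h1.1] at h1; rw [← h1.2] at this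
      exact this rfl
    · obtain ⟨j, rfl⟩ : ∃ j', j = j' + 1 := ⟨j - 1, by omega⟩
      by_cases hi : i = j
      · subst hi; exact hne e i (by omega) h
      · have h1 := hsimp e i j (by omega) (by omega) (p e i) (left_mem_segment ℝ _ _) (by
          rw [h]; exact right_mem_segment ℝ _ _)
        exact hne e j (by omega) (h1.2.symm.trans h)
  have pinj' : ∀ e i j, i ≤ N e → j ≤ N e → p e i = p e j → i = j := by
    intro e i j hi hj h
    rcases lt_trichotomy i j with h' | h' | h'
    · exact absurd h (pinj e i j h' hj)
    · exact h'
    · exact absurd h.symm (pinj e j i h' hi)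
  have notend : ∀ {a b z : ℂ}, a ≠ b → z ∈ openSegment ℝ a b → z ≠ a ∧ z ≠ b := by
    intro a b z hab hz
    constructor
    · rintro rfl; exact hab (left_mem_openSegment_iff.mp hz)
    · rintro rfl; exact hab (right_mem_openSegment_iff.mp hz)
  let Y : Set ℂ := X ∪ Set.range (fun i : Σ e, Fin (N e + 1) => p i.1 i.2)
  have hYf : Y.Finite := hX.union (Set.finite_range _)
  have hYp : ∀ e j, j ≤ N e → p e j ∈ Y := fun e j hj => Or.inr ⟨⟨e, ⟨j, by omega⟩⟩, rfl⟩
  have hPne : ∀ i, P i false ≠ P i true := fun i => hne i.1 i.2 i.2.2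
  have hopenX : ∀ i, ∀ z ∈ openSegment ℝ (P i false) (P i true), z ∉ X :=
    fun i z hz => hop i.1 i.2 i.2.2 z hz
  have hnode : ∀ e, ∀ j < N e, ∀ k ≤ N e, p e k ∈ segment ℝ (p e j) (p e (j + 1)) → k = j ∨ k = j + 1 := by
    intro e j hj k hk h
    by_contra hcon
    push Not at hcon
    rcases lt_or_ge k j with hkj | hkj
    · have := hsimp e k j hkj hj _ (left_mem_segment ℝ _ _) h
      exact hcon.1 (pinj' e k j hk hj.le this.2)
    · obtain ⟨k, rfl⟩ : ∃ k', k = k' + 1 := ⟨k - 1, by omega⟩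
      have := hsimp e j k (by omega) (by omega) _ h (right_mem_segment ℝ _ _)
      exact absurd (pinj' e _ _ hk (by omega) this.2) (by omega)
  have hopenY : ∀ i, ∀ z ∈ openSegment ℝ (P i false) (P i true), z ∉ Y := by
    rintro ⟨e, j⟩ z hz (hzX | ⟨⟨f, k⟩, rfl⟩)
    · exact hopenX _ z hz hzX
    · have hz' := openSegment_subset_segment ℝ _ _ hz
      obtain ⟨h1, h2⟩ := notend (hPne _) hz
      by_cases hfe : f = e
      · subst hfe
        rcases hnode f j j.2 k (by omega) hz' with h | h
        · apply h1; simp [hP, chP, h]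
        · apply h2; simp [hP, chP, h]
      · refine hopenX ⟨e, j⟩ _ hz ?_
        by_cases hk : (k : ℕ) < N f
        · exact hef f e hfe k hk j j.2 _ (left_mem_segment ℝ _ _) hz'
        · have hk' : (k : ℕ) = N f - 1 + 1 := by have := hN f; omega
          refine hef f e hfe (N f - 1) (by have := hN f; omega) j j.2 _ ?_ hz'
          simp only [hk']; exact right_mem_segment ℝ _ _
  have hdis : ∀ i j, i ≠ j → Disjoint (openSegment ℝ (P i false) (P i true))
      (openSegment ℝ (P j false) (P j true)) := by
    rintro ⟨e, i⟩ ⟨f, j⟩ hij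
    rw [Set.disjoint_left]; intro z hz hz'
    have hz1 := openSegment_subset_segment ℝ _ _ hz
    have hz2 := openSegment_subset_segment ℝ _ _ hz'
    by_cases hfe : e = f
    · subst hfe
      have hij' : (i : ℕ) ≠ j := by
        intro h; apply hij; rw [Fin.ext h]
      rcases lt_or_gt_of_ne hij' with h | h
      · have := hsimp e i j h j.2 z hz1 hz2
        exact (notend (hPne _) hz').1 this.2
      · have := hsimp e j i h i.2 z hz2 hz1
        exact (notend (hPne _) hz).1 this.2
    · exact hopenX _ z hz (hef e f hfe i i.2 j j.2 z hz1 hz2)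
  obtain ⟨ρ, hρ, hsep, hev⟩ := network P Y hYf hPne hopenY hdis
  let fl : E → Bool → Σ e, Fin (N e) := fun e b =>
    ⟨e, ⟨if b then N e - 1 else 0, by have := hN e; split <;> omega⟩⟩
  have hfl : ∀ e b, P (fl e b) b = p e (if b then N e else 0) := by
    intro e b; cases b
    · simp [hP, chP, fl]
    · have := hN e
      simp [hP, chP, fl, show N e - 1 + 1 = N e by omega]
  refine ⟨ρ, hρ, fun e b => dir P (fl e b) b, fun e b => dir_norm P (hPne _) b, ?_,
    fun y hy y' hy' => hsep y (Or.inl hy) y' (Or.inl hy'), ?_⟩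
  · intro e b f c hne' hp
    refine dir_ne P hPne hdis ?_ (by rw [hfl, hfl, hp])
    intro h
    apply hne'
    have h1 := congrArg (fun x : (Σ e, Fin (N e)) × Bool => x.1.1) h
    have h2 := congrArg (fun x : (Σ e, Fin (N e)) × Bool => x.2) h
    exact Prod.ext h1 h2
  filter_upwards [hev] with δ hδ
  obtain ⟨hδ01, G1, G2, G3, G5⟩ := hδ
  have hport : ∀ e b k, port P ρ δ (fl e b) b k =
      p e (if b then N e else 0) + ρ * dir P (fl e b) b * wr δ (if b then -k else k) := by
    intro e b k; rw [port, hfl]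
  have hball : ∀ y ∈ Y, ∀ y' ∈ Y, ∀ z, Dist.dist z y ≤ ρ → Dist.dist z y' ≤ ρ → y = y' := by
    intro y hy y' hy' z h1 h2
    by_contra hcon
    have := hsep y hy y' hy' hcon
    linarith [_root_.dist_triangle_left y y' z]
  -- chord facts
  have hch : ∀ e j (hj : j + 1 < N e) k z, z ∈ segment ℝ
      (port P ρ δ ⟨e, ⟨j, Nat.lt_of_succ_lt hj⟩⟩ true k)
      (port P ρ δ ⟨e, ⟨j + 1, hj⟩⟩ false k) → Dist.dist z (p e (j + 1)) ≤ ρ ∧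
      (Dist.dist z (p e (j + 1)) = ρ → z = (port P ρ δ ⟨e, ⟨j, Nat.lt_of_succ_lt hj⟩⟩ true k) ∨
        z = (port P ρ δ ⟨e, ⟨j + 1, hj⟩⟩ false k)) := by
    intro e j hj k z hz
    exact chord_sphere (port_dist P hρ (hPne ⟨e, ⟨j, Nat.lt_of_succ_lt hj⟩⟩) true k)
      (port_dist P hρ (hPne ⟨e, ⟨j + 1, hj⟩⟩) false k) hz
  have hstch : ∀ e f k l, (e, k) ≠ (f, l) → ∀ z i (hi : i < N e) j (hj : j + 1 < N f),
      z ∈ strip P ρ δ ⟨e, ⟨i, hi⟩⟩ k → z ∉ segment ℝ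
      (port P ρ δ ⟨f, ⟨j, Nat.lt_of_succ_lt hj⟩⟩ true l)
      (port P ρ δ ⟨f, ⟨j + 1, hj⟩⟩ false l) := by
    intro e f k l hne' z i hi j hj hz hz'
    have h1 := hch f j hj l z hz'
    obtain ⟨s, hs, hzs⟩ := G1 _ k z hz _ (hYp f (j + 1) hj.le) h1.1
    have hd : Dist.dist z (p f (j + 1)) = ρ := by rw [hzs, hs]; exact port_dist P hρ (hPne _) s k
    rcases h1.2 hd with h | h
    · refine G3 _ _ _ _ _ _ ?_ ?_ (hzs.symm.trans h)
      · exact hs.symm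
      · intro h; apply hne'
        have h1 := congrArg (fun x : (Σ e, Fin (N e)) × Bool × SignType => (x.1.1, x.2.2)) h
        exact h1
    · refine G3 _ _ _ _ _ _ ?_ ?_ (hzs.symm.trans h)
      · exact hs.symm
      · intro h; apply hne'
        have h1 := congrArg (fun x : (Σ e, Fin (N e)) × Bool × SignType => (x.1.1, x.2.2)) h
        exact h1
  have hmeet : ∀ e f k l, (e, k) ≠ (f, l) → ∀ z, z ∈ tubeT N p ρ δ e k → z ∈ tubeT N p ρ δ f l →
      ∃ (i : ℕ) (hi : i + 1 < N e) (j : ℕ) (hj : j + 1 < N f), p e (i + 1) = p f (j + 1) ∧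
        z ∈ segment ℝ (port P ρ δ ⟨e, ⟨i, Nat.lt_of_succ_lt hi⟩⟩ true k)
          (port P ρ δ ⟨e, ⟨i + 1, hi⟩⟩ false k) ∧
        z ∈ segment ℝ (port P ρ δ ⟨f, ⟨j, Nat.lt_of_succ_lt hj⟩⟩ true l)
          (port P ρ δ ⟨f, ⟨j + 1, hj⟩⟩ false l) := by
    rintro e f k l hne' z (⟨i, hi, hz⟩ | ⟨i, hi, hz⟩) (⟨j, hj, hz'⟩ | ⟨j, hj, hz'⟩)
    · refine absurd hz' (Set.disjoint_left.mp (G2 _ k _ l ?_) hz)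
      intro h; apply hne'
      exact congrArg (fun x : (Σ e, Fin (N e)) × SignType => (x.1.1, x.2)) h
    · exact absurd hz' (hstch e f k l hne' z i hi j hj hz)
    · exact absurd hz (hstch f e l k (Ne.symm hne') z j hj i hi hz')
    · exact ⟨i, hi, j, hj, hball _ (hYp e _ hi.le) _ (hYp f _ hj.le) z (hch e i hi k z hz).1
        (hch f j hj l z hz').1, hz, hz'⟩
  refine ⟨tubeT N p ρ δ, ?_, ?_, ?_, ?_, ?_⟩
  · intro e k
    have := tube_joined N p ρ δ e k (N e - 1) (by have := hN e; omega)
    have h1 := hport e false k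
    have h2 := hport e true k
    simp only [if_true, Bool.false_eq_true, if_false] at h1 h2
    rw [← h1, ← h2]
    exact this
  · rintro e k x hx hxj z (⟨j, hj, hz⟩ | ⟨j, hj, hz⟩) hd
    · obtain ⟨s, hs, hzs⟩ := G1 _ k z hz x (Or.inl hx) hd
      have hfs : (⟨e, ⟨j, hj⟩⟩ : Σ e, Fin (N e)) = fl e s := by
        cases s
        · have : j = 0 := by
            by_contra h
            exact hxj j (by omega) hj hs.symm
          subst this; rfl
        · have : j = N e - 1 := by
            by_contra h
            exact hxj (j + 1) (by omega) (by omega) hs.symm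
          subst this; rfl
      rw [hfs] at hs hzs
      refine ⟨s, by rw [hs, hfl], ?_⟩
      rw [hzs, hs]; rfl
    · exfalso
      refine hxj (j + 1) (by omega) hj ?_
      exact hball _ (hYp e _ hj.le) _ (Or.inl hx) z (hch e j hj k z hz).1 hd
  · intro e k l hkl
    rw [Set.disjoint_left]; intro z hz hz'
    obtain ⟨i, hi, j, hj, hij, h1, h2⟩ := hmeet e e k l (by simpa using hkl) z hz hz'
    have : i = j := by have := pinj' e _ _ hi.le hj.le hij; omega
    subst this
    refine Set.disjoint_left.mp (G5 _ _ ?_ ?_ k l hkl) h1 h2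
    · intro h
      have := (Sigma.mk.inj_iff.mp h).2
      simp at this
    · rfl
  · intro e f k l hef' z hz hz'
    obtain ⟨i, hi, j, hj, hij, h1, h2⟩ := hmeet e f k l (by simp [hef']) z hz hz'
    refine ⟨p e (i + 1), ?_, (hch e i hi k z h1).1, ⟨i + 1, by omega, hi, rfl⟩, ⟨j + 1, by omega, hj, hij.symm⟩⟩
    refine hef e f hef' (i + 1) hi (j + 1) hj _ (left_mem_segment ℝ _ _) ?_
    rw [hij]; exact left_mem_segment ℝ _ _
  · rintro e f k l hef' q hq z ⟨⟨hz, hz'⟩, hd⟩ w ⟨⟨hw, hw'⟩, hdw⟩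
    obtain ⟨i, hi, j, hj, hij, h1, h2⟩ := hmeet e f k l (by simp [hef']) z hz hz'
    obtain ⟨i', hi', j', hj', hij', h1', h2'⟩ := hmeet e f k l (by simp [hef']) w hw hw'
    have e1 := hball _ (hYp e _ hi.le) _ (Or.inl hq) z (hch e i hi k z h1).1 hd
    have e2 := hball _ (hYp e _ hi'.le) _ (Or.inl hq) w (hch e i' hi' k w h1').1 hdw
    have : i = i' := by have := pinj' e _ _ hi.le hi'.le (e1.trans e2.symm); omega
    subst this
    have : j = j' := by have := pinj' f _ _ hj.le hj'.le (hij.symm.trans hij'); omega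
    subst this
    have hne1 : ∀ x : Fin (N e), ∀ y : Fin (N f), ∀ s t : Bool, ((⟨e, x⟩ : Σ e, Fin (N e)), s, k) ≠ (⟨f, y⟩, t, l) := by
      intro x y s t h
      exact hef' (congrArg (fun x : (Σ e, Fin (N e)) × Bool × SignType => x.1.1) h)
    refine chord_chord (o := p e (i + 1)) (ρ := ρ) (port_dist P hρ (hPne ⟨e, ⟨i, Nat.lt_of_succ_lt hi⟩⟩) true k)
      (port_dist P hρ (hPne ⟨e, ⟨i + 1, hi⟩⟩) false k) ?_ ?_ ?_ ⟨h1, h2⟩ ⟨h1', h2'⟩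
    · rw [hij]; exact port_dist P hρ (hPne ⟨f, ⟨j, Nat.lt_of_succ_lt hj⟩⟩) true l
    · exact (G3 (⟨e, ⟨i, Nat.lt_of_succ_lt hi⟩⟩) true k ⟨f, ⟨j, Nat.lt_of_succ_lt hj⟩⟩ true l hij (hne1 _ _ _ _)).symm
    · exact (G3 (⟨e, ⟨i + 1, hi⟩⟩) false k ⟨f, ⟨j, Nat.lt_of_succ_lt hj⟩⟩ true l hij (hne1 _ _ _ _)).symm

end tube
end CrK

namespace CrK
open Metric Filter Topology

/-- A system of arcs (connected sets joining nodes) in general position. -/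
structure Sys (W E : Type*) where
  pos : W → ℂ
  inj : Function.Injective pos
  v : E → Bool → W
  ne : ∀ e, v e false ≠ v e true
  K : E → Set ℂ
  joined : ∀ e, JoinedIn (K e) (pos (v e false)) (pos (v e true))
  avoid : ∀ e w, pos w ∈ K e → ∃ b, w = v e b
  adj : ∀ e f b c, e ≠ f → v e b = v f c → K e ∩ K f ⊆ {pos (v e b)}
  once : ∀ e f, e ≠ f → (∀ b c, v e b ≠ v f c) → (K e ∩ K f).Subsingleton
  triple : ∀ e f g, e ≠ f → e ≠ g → f ≠ g → ∀ z, z ∈ K e → z ∈ K f → z ∈ K g → ∃ w, z = pos w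

namespace Sys
variable {W E : Type*} (S : Sys W E)

def Cross (e f : E) : Prop :=
  e ≠ f ∧ (∀ b c, S.v e b ≠ S.v f c) ∧ (S.K e ∩ S.K f).Nonempty

lemma Cross.symm {S : Sys W E} {e f : E} (h : S.Cross e f) : S.Cross f e :=
  ⟨h.1.symm, fun b c => (h.2.1 c b).symm, by rw [Set.inter_comm]; exact h.2.2⟩

/-- vertices and crossing points -/
def X : Set ℂ := Set.range S.pos ∪
  ⋃ q : {q : E × E // q.1 ≠ q.2 ∧ ∀ b c, S.v q.1 b ≠ S.v q.2 c}, S.K q.1.1 ∩ S.K q.1.2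

lemma X_finite [Finite W] [Finite E] : S.X.Finite := by
  refine (Set.finite_range _).union (Set.finite_iUnion fun q => ?_)
  exact (S.once _ _ q.2.1 q.2.2).finite

lemma inter_X (e f : E) (h : e ≠ f) : S.K e ∩ S.K f ⊆ S.X := by
  intro z hz
  by_cases hs : ∀ b c, S.v e b ≠ S.v f c
  · exact Or.inr (Set.mem_iUnion.2 ⟨⟨(e, f), h, hs⟩, hz⟩)
  · push Not at hs
    obtain ⟨b, c, hbc⟩ := hs
    exact Or.inl ⟨_, (S.adj e f b c h hbc hz).symm⟩

lemma pos_X (w : W) : S.pos w ∈ S.X := Or.inl ⟨w, rfl⟩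

end Sys

lemma chain_inj {N : ℕ} {p : ℕ → ℂ} (hne : ∀ j < N, p j ≠ p (j + 1))
    (hsimp : ∀ i j, i < j → j < N → ∀ z, z ∈ segment ℝ (p i) (p (i + 1)) →
        z ∈ segment ℝ (p j) (p (j + 1)) → j = i + 1 ∧ z = p j) :
    ∀ i j, i < j → j ≤ N → p i ≠ p j := by
  intro i j hij hj h
  by_cases hjN : j < N
  · have h1 := hsimp i j hij hjN (p i) (left_mem_segment ℝ _ _) (by
      rw [h]; exact left_mem_segment ℝ _ _)
    have := hne i (by omega)
    rw [h1.1] at h1; rw [← h1.2] at this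
    exact this rfl
  · obtain ⟨j, rfl⟩ : ∃ j', j = j' + 1 := ⟨j - 1, by omega⟩
    by_cases hi : i = j
    · subst hi; exact hne i (by omega) h
    · have h1 := hsimp i j (by omega) (by omega) (p i) (left_mem_segment ℝ _ _) (by
        rw [h]; exact right_mem_segment ℝ _ _)
      exact hne j (by omega) (h1.2.symm.trans h)

/-- The tube data attached to a system. -/
structure TubeData {W E : Type*} (S : Sys W E) (ρ : ℝ) (u : E → Bool → ℂ) (δ : ℝ)
    (T : E → SignType → Set ℂ) : Prop where
  joined : ∀ e k, JoinedIn (T e k) (S.pos (S.v e false) + ρ * u e false * wr δ k)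
          (S.pos (S.v e true) + ρ * u e true * wr δ (-k))
  ball : ∀ e k w, ∀ z ∈ T e k, Dist.dist z (S.pos w) ≤ ρ →
          ∃ b : Bool, w = S.v e b ∧ z = S.pos w + ρ * u e b * wr δ (if b then -k else k)
  disj : ∀ e k l, k ≠ l → Disjoint (T e k) (T e l)
  cross : ∀ e f k l, e ≠ f → ∀ z ∈ T e k, z ∈ T f l → S.Cross e f
  once : ∀ e f k l, e ≠ f → (T e k ∩ T f l).Subsingleton
  triple : ∀ e f g i j k, e ≠ f → e ≠ g → f ≠ g → ∀ z, z ∈ T e i → z ∈ T f j → z ∉ T g k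

theorem tubeSys {W E : Type*} [Finite W] [Finite E] (S : Sys W E) :
    ∃ ρ : ℝ, 0 < ρ ∧ ∃ u : E → Bool → ℂ, (∀ e b, ‖u e b‖ = 1) ∧
      (∀ e b f c, (e, b) ≠ (f, c) → S.v e b = S.v f c → u e b ≠ u f c) ∧
      (∀ w w', w ≠ w' → 2 * ρ < Dist.dist (S.pos w) (S.pos w')) ∧
      ∀ᶠ δ in 𝓝[>] (0 : ℝ), ∃ T : E → SignType → Set ℂ, TubeData S ρ u δ T := by
  obtain ⟨N, p, h0, h1, hne, hsimp, hop, hK, hef⟩ := polyline S.X S.X_finite S.K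
    (fun e => S.pos (S.v e false)) (fun e => S.pos (S.v e true)) (fun e => S.pos_X _)
    (fun e => S.pos_X _) S.joined (fun e f h => S.inter_X e f h)
  have hN : ∀ e, 0 < N e := by
    intro e
    rcases Nat.eq_zero_or_pos (N e) with h | h
    · have := h1 e; rw [h, h0 e] at this
      exact absurd (S.inj this) (S.ne e)
    · exact h
  have hend : ∀ e (b : Bool), p e (if b then N e else 0) = S.pos (S.v e b) := by
    intro e b; cases b
    · simpa using h0 e
    · simpa using h1 e
  obtain ⟨ρ, hρ, u, hu, hud, hsep, hev⟩ := tube N p S.X S.X_finite hN hne hsimp hop hef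
  have pinj := fun e => chain_inj (hne e) (hsimp e)
  have hint : ∀ e j, 0 < j → j < N e → ∀ w, p e j ≠ S.pos w := by
    intro e j h0j hjN w h
    have hk : S.pos w ∈ S.K e := by
      refine hK e j hjN _ ?_ (S.pos_X w)
      rw [← h]; exact left_mem_segment ℝ _ _
    obtain ⟨b, rfl⟩ := S.avoid e w hk
    rw [← hend] at h
    cases b
    · exact pinj e 0 j h0j hjN.le (by simpa using h.symm)
    · exact pinj e j (N e) hjN le_rfl (by simpa using h)
  have hintK : ∀ e j, 0 < j → j < N e → p e j ∈ S.X → p e j ∈ S.K e := by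
    intro e j h0j hjN h
    exact hK e j hjN _ (left_mem_segment ℝ _ _) h
  refine ⟨ρ, hρ, u, hu, ?_, ?_, ?_⟩
  · intro e b f c h1 h2
    exact hud e b f c h1 (by rw [hend, hend, h2])
  · intro w w' h
    exact hsep _ (S.pos_X w) _ (S.pos_X w') (fun h' => h (S.inj h'))
  filter_upwards [hev] with δ hδ
  obtain ⟨T, t1, t2, t3, t4, t5⟩ := hδ
  have key : ∀ e f k l, e ≠ f → ∀ z ∈ T e k, z ∈ T f l → ∃ q ∈ S.X, Dist.dist z q ≤ ρ ∧ q ∈ S.K e ∧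
      q ∈ S.K f ∧ (∀ w, q ≠ S.pos w) ∧ ∀ b c, S.v e b ≠ S.v f c := by
    intro e f k l h z hz hz'
    obtain ⟨q, hq, hd, ⟨i, hi, hi', rfl⟩, ⟨j, hj, hj', hij⟩⟩ := t4 e f k l h z hz hz'
    have ke := hintK e i hi hi' hq
    have kf := hintK f j hj hj' (hij ▸ hq)
    rw [hij] at kf
    refine ⟨_, hq, hd, ke, kf, hint e i hi hi', ?_⟩
    intro b c hbc
    exact hint e i hi hi' _ (S.adj e f b c h hbc ⟨ke, kf⟩)
  refine ⟨T, ⟨?_, ?_, t3, ?_, ?_, ?_⟩⟩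
  · intro e k
    have := t1 e k
    rwa [h0, h1] at this
  · intro e k w z hz hd
    obtain ⟨b, hb, hz⟩ := t2 e k _ (S.pos_X w) (fun j hj hj' => hint e j hj hj' w) z hz hd
    rw [hend] at hb
    exact ⟨b, S.inj hb, hz⟩
  · intro e f k l h z hz hz'
    obtain ⟨q, -, -, ke, kf, -, hs⟩ := key e f k l h z hz hz'
    exact ⟨h, hs, ⟨q, ke, kf⟩⟩
  · rintro e f k l h z ⟨hz, hz'⟩ w ⟨hw, hw'⟩
    obtain ⟨q, hq, hd, ke, kf, -, hs⟩ := key e f k l h z hz hz'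
    obtain ⟨q', hq', hd', ke', kf', -, hs'⟩ := key e f k l h w hw hw'
    obtain rfl := S.once e f h hs ⟨ke, kf⟩ ⟨ke', kf'⟩
    exact t5 e f k l h q hq ⟨⟨hz, hz'⟩, hd⟩ ⟨⟨hw, hw'⟩, hd'⟩
  · intro e f g i j k hef' heg hfg z he hf hg
    obtain ⟨q, hq, hd, ke, kf, hp, hs⟩ := key e f i j hef' z he hf
    obtain ⟨q', hq', hd', ke', kg, -, -⟩ := key e g i k heg z he hg
    have : q = q' := by
      by_contra hqq
      have h1 := hsep q hq q' hq' hqq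
      have h2 := _root_.dist_triangle_left q q' z
      linarith
    subst this
    obtain ⟨w, hw⟩ := S.triple e f g hef' heg hfg q ke kf kg
    exact hp w hw

end CrK

namespace CrK
open Metric Filter Topology

/-- `t` lies strictly between `g` and `s` -/
def Btw (g t s : ℝ) : Prop := (g < t ∧ t < s) ∨ (s < t ∧ t < g)

/-- local pieces in polar coordinates `(θ, h)`; nodes of level `i` sit at `(g, i+1)` -/
def piece (g : ℝ) (i : Fin 3) : Option ℝ → Set (ℝ × ℝ)
  | some ϑ => {q | (i : ℝ) + 1 ≤ q.2 ∧ q.2 ≤ 4 ∧ q.1 = g + min 1 (q.2 - (i + 1)) * (ϑ - g)}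
  | none => {q | q.1 = g ∧ (i : ℝ) + 1 ≤ q.2 ∧ q.2 ≤ i + 2 ∧ q.2 ≤ 3}

def pnode (i : Fin 3) : Option ℝ → Fin 3 → Prop
  | some _, j => j = i
  | none, j => (j : ℕ) = i ∨ (j : ℕ) = i + 1

def LX (g : ℝ) (i : Fin 3) (ϑ : ℝ) (j : Fin 3) (η : ℝ) : Prop :=
  (j < i ∧ Btw g η ϑ) ∨ (i < j ∧ Btw g ϑ η)

lemma LX.symm {g ϑ η : ℝ} {i j : Fin 3} (h : LX g i ϑ j η) : LX g j η i ϑ := by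
  rcases h with h | h
  · exact Or.inr h
  · exact Or.inl h

lemma LX.ne {g ϑ η : ℝ} {i j : Fin 3} (h : LX g i ϑ j η) : i ≠ j := by
  rcases h with h | h
  · exact h.1.ne'
  · exact h.1.ne

lemma fin3_le {i j : Fin 3} (h : j < i) : (j : ℝ) + 1 ≤ i := by
  have : (j : ℕ) + 1 ≤ i := h
  exact_mod_cast this

lemma fin3_cast_inj {i j : Fin 3} (h : (i : ℝ) = j) : i = j := by
  have : (i : ℕ) = j := by exact_mod_cast h
  exact Fin.ext this

lemma strand_same {g ϑ η : ℝ} {i : Fin 3} (hne : ϑ ≠ η) {q : ℝ × ℝ}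
    (h1 : q ∈ piece g i (some ϑ)) (h2 : q ∈ piece g i (some η)) : q = (g, (i : ℝ) + 1) := by
  obtain ⟨a1, a2, a3⟩ := h1
  obtain ⟨b1, b2, b3⟩ := h2
  have h : min 1 (q.2 - (i + 1)) * (ϑ - η) = 0 := by linarith
  have hm : min 1 (q.2 - ((i : ℝ) + 1)) = 0 := by
    rcases mul_eq_zero.1 h with h | h
    · exact h
    · exact absurd (sub_eq_zero.1 h) hne
  have h0 : q.2 = i + 1 := by
    rcases min_choice 1 (q.2 - ((i : ℝ) + 1)) with h' | h' <;> rw [h'] at hm <;> linarith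
  refine Prod.ext ?_ h0
  rw [a3, hm]; simp

lemma strand_low {g ϑ η : ℝ} {i j : Fin 3} (hij : j < i) (hne : ϑ ≠ η) (hη : η ≠ g) {q : ℝ × ℝ}
    (h1 : q ∈ piece g i (some ϑ)) (h2 : q ∈ piece g j (some η)) :
    Btw g η ϑ ∧ q = (η, i + 1 + (η - g) / (ϑ - g)) := by
  obtain ⟨a1, a2, a3⟩ := h1
  obtain ⟨b1, b2, b3⟩ := h2
  have hij' := fin3_le hij
  rw [min_eq_left (by linarith)] at b3
  have hq : q.1 = η := by linarith
  rw [hq] at a3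
  have hm1 : min 1 (q.2 - ((i : ℝ) + 1)) ≤ 1 := min_le_left _ _
  have hm0 : 0 ≤ min 1 (q.2 - ((i : ℝ) + 1)) := le_min zero_le_one (by linarith)
  have hlt : q.2 - ((i : ℝ) + 1) < 1 := by
    by_contra h
    rw [min_eq_left (by linarith)] at a3
    exact hne (by linarith)
  rw [min_eq_right hlt.le] at a3 hm0
  have hpos : 0 < q.2 - ((i : ℝ) + 1) := by
    rcases hm0.lt_or_eq with h | h
    · exact h
    · rw [← h] at a3; exact absurd (by linarith) hη
  have hg : ϑ - g ≠ 0 := by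
    intro h; rw [h] at a3; exact hη (by linarith)
  refine ⟨?_, Prod.ext hq ?_⟩
  · rcases lt_or_gt_of_ne hg with h | h
    · right; constructor <;> nlinarith
    · left; constructor <;> nlinarith
  · have : (η - g) / (ϑ - g) = q.2 - (i + 1) := by
      rw [div_eq_iff hg]; linarith
    simp only []
    linarith

lemma strand_g {g ϑ : ℝ} {i : Fin 3} (hϑ : ϑ ≠ g) {h : ℝ}
    (h1 : (g, h) ∈ piece g i (some ϑ)) : h = i + 1 := by
  obtain ⟨a1, a2, a3⟩ := h1
  simp only at a1 a2 a3
  have hh : min 1 (h - (i + 1)) * (ϑ - g) = 0 := by linarith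
  have hm : min 1 (h - ((i : ℝ) + 1)) = 0 := by
    rcases mul_eq_zero.1 hh with h | h
    · exact h
    · exact absurd (sub_eq_zero.1 h) hϑ
  rcases min_choice 1 (h - ((i : ℝ) + 1)) with h' | h' <;> rw [h'] at hm <;> linarith

/-- two pieces meet in a common node or in a local crossing -/
lemma piece_inter {g : ℝ} {i j : Fin 3} {o o' : Option ℝ} (ho : ∀ ϑ, o = some ϑ → ϑ ≠ g)
    (ho' : ∀ ϑ, o' = some ϑ → ϑ ≠ g) (hne : o = o' → o = none ∧ i ≠ j) {q : ℝ × ℝ}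
    (h1 : q ∈ piece g i o) (h2 : q ∈ piece g j o') :
    (∃ n : Fin 3, pnode i o n ∧ pnode j o' n ∧ q = (g, (n : ℝ) + 1)) ∨
    ∃ ϑ η, o = some ϑ ∧ o' = some η ∧ LX g i ϑ j η := by
  rcases o with _ | ϑ <;> rcases o' with _ | η
  · obtain ⟨a1, a2, a3, a4⟩ := h1
    obtain ⟨b1, b2, b3, b4⟩ := h2
    have hij := (hne rfl).2
    left
    rcases lt_or_gt_of_ne hij with h | h
    · have h' := fin3_le h
      have he : (j : ℝ) = i + 1 := by linarith
      have : (j : ℕ) = i + 1 := by exact_mod_cast he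
      exact ⟨j, Or.inr this, Or.inl rfl, Prod.ext a1 (by simp only []; linarith)⟩
    · have h' := fin3_le h
      have he : (i : ℝ) = j + 1 := by linarith
      have : (i : ℕ) = j + 1 := by exact_mod_cast he
      exact ⟨i, Or.inl rfl, Or.inr this, Prod.ext a1 (by simp only []; linarith)⟩
  · obtain ⟨a1, a2, a3, a4⟩ := h1
    left
    obtain ⟨x, y⟩ := q
    simp only at a1 a2 a3 a4; subst a1
    have hy := strand_g (ho' η rfl) h2
    refine ⟨j, ?_, rfl, by rw [hy]⟩
    have l1 : (i : ℕ) ≤ j := by have : (i : ℝ) ≤ j := by linarith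
                                exact_mod_cast this
    have l2 : (j : ℕ) ≤ i + 1 := by have : (j : ℝ) ≤ i + 1 := by linarith
                                    exact_mod_cast this
    show (j : ℕ) = i ∨ (j : ℕ) = i + 1
    omega
  · obtain ⟨a1, a2, a3, a4⟩ := h2
    left
    obtain ⟨x, y⟩ := q
    simp only at a1 a2 a3 a4; subst a1
    have hy := strand_g (ho ϑ rfl) h1
    refine ⟨i, rfl, ?_, by rw [hy]⟩
    have l1 : (j : ℕ) ≤ i := by have : (j : ℝ) ≤ i := by linarith
                                exact_mod_cast this
    have l2 : (i : ℕ) ≤ j + 1 := by have : (i : ℝ) ≤ j + 1 := by linarith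
                                    exact_mod_cast this
    show (i : ℕ) = j ∨ (i : ℕ) = j + 1
    omega
  · have hne' : ϑ ≠ η := by
      rintro rfl; exact absurd (hne rfl).1 (by simp)
    rcases lt_trichotomy i j with h | h | h
    · right; exact ⟨ϑ, η, rfl, rfl, Or.inr ⟨h, (strand_low h hne'.symm (ho ϑ rfl) h2 h1).1⟩⟩
    · subst h; left; exact ⟨i, rfl, rfl, strand_same hne' h1 h2⟩
    · right; exact ⟨ϑ, η, rfl, rfl, Or.inl ⟨h, (strand_low h hne' (ho' η rfl) h1 h2).1⟩⟩

lemma strand_sub {g ϑ η : ℝ} {i j : Fin 3} (hij : i ≠ j) (hne : ϑ ≠ η) (hϑ : ϑ ≠ g) (hη : η ≠ g) :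
    (piece g i (some ϑ) ∩ piece g j (some η)).Subsingleton := by
  rintro q ⟨h1, h2⟩ r ⟨h3, h4⟩
  rcases lt_or_gt_of_ne hij with h | h
  · rw [(strand_low h hne.symm hϑ h2 h1).2, (strand_low h hne.symm hϑ h4 h3).2]
  · rw [(strand_low h hne hη h1 h2).2, (strand_low h hne hη h3 h4).2]

lemma strand_triple {g ϑ η ζ : ℝ} {i j k : Fin 3} (h12 : ϑ ≠ η) (h13 : ϑ ≠ ζ) (h23 : η ≠ ζ)
    (hϑ : ϑ ≠ g) (hη : η ≠ g) (hζ : ζ ≠ g) {q : ℝ × ℝ} (h1 : q ∈ piece g i (some ϑ))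
    (h2 : q ∈ piece g j (some η)) (h3 : q ∈ piece g k (some ζ)) :
    ∃ n : Fin 3, q = (g, (n : ℝ) + 1) := by
  by_cases hij : i = j
  · subst hij; exact ⟨i, strand_same h12 h1 h2⟩
  by_cases hik : i = k
  · subst hik; exact ⟨i, strand_same h13 h1 h3⟩
  by_cases hjk : j = k
  · subst hjk; exact ⟨j, strand_same h23 h2 h3⟩
  exfalso
  by_cases c1 : i < j
  · have e1 := (strand_low c1 h12.symm hϑ h2 h1).2
    by_cases c2 : i < k
    · by_cases c3 : j < k
      · have e2 := (strand_low c3 h23.symm hη h3 h2).2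
        have e3 := (strand_low c2 h13.symm hϑ h3 h1).2
        rw [e2] at e3; exact h12 (congrArg Prod.fst e3).symm
      · have c3 : k < j := lt_of_le_of_ne (not_lt.1 c3) (Ne.symm hjk)
        have e2 := (strand_low c3 h23 hζ h2 h3).2
        rw [e1] at e2; exact h13 (congrArg Prod.fst e2)
    · have c2 : k < i := lt_of_le_of_ne (not_lt.1 c2) (Ne.symm hik)
      have e2 := (strand_low (c2.trans c1) h23 hζ h2 h3).2
      rw [e1] at e2; exact h13 (congrArg Prod.fst e2)
  · have c1 : j < i := lt_of_le_of_ne (not_lt.1 c1) (Ne.symm hij)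
    have e1 := (strand_low c1 h12 hη h1 h2).2
    by_cases c2 : k < i
    · have e2 := (strand_low c2 h13 hζ h1 h3).2
      rw [e1] at e2; exact h23 (congrArg Prod.fst e2)
    · have c2 : i < k := lt_of_le_of_ne (not_lt.1 c2) hik
      have e2 := (strand_low c2 h13.symm hϑ h3 h1).2
      rw [e1] at e2; exact h12 (congrArg Prod.fst e2).symm

lemma piece_range {g : ℝ} {i : Fin 3} {o : Option ℝ} (hg : g ∈ Set.Ioo (-Real.pi) Real.pi)
    (ho : ∀ ϑ, o = some ϑ → ϑ ∈ Set.Ioo (-Real.pi) Real.pi) {q : ℝ × ℝ} (h : q ∈ piece g i o) :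
    q.1 ∈ Set.Ioo (-Real.pi) Real.pi ∧ 1 ≤ q.2 ∧ q.2 ≤ 4 := by
  have hi : (0 : ℝ) ≤ (i : ℝ) := by positivity
  rcases o with _ | ϑ
  · obtain ⟨a1, a2, a3, a4⟩ := h
    exact ⟨a1 ▸ hg, by linarith, by linarith⟩
  · obtain ⟨a1, a2, a3⟩ := h
    refine ⟨?_, by linarith, by linarith⟩
    have hm1 : min 1 (q.2 - ((i : ℝ) + 1)) ≤ 1 := min_le_left _ _
    have hm0 : 0 ≤ min 1 (q.2 - ((i : ℝ) + 1)) := le_min zero_le_one (by linarith)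
    have hc := (convex_Ioo (-Real.pi) Real.pi) hg (ho ϑ rfl)
      (a := 1 - min 1 (q.2 - ((i : ℝ) + 1))) (b := min 1 (q.2 - ((i : ℝ) + 1)))
      (by linarith) hm0 (by ring)
    rw [a3]
    convert hc using 1
    simp only [smul_eq_mul]; ring

/-- polar chart -/
noncomputable def chart (o : ℂ) (ρ : ℝ) (κ : ℂ) (q : ℝ × ℝ) : ℂ :=
  o + ρ * ((q.2 / 4 : ℝ) : ℂ) * (κ⁻¹ * Complex.exp (q.1 * Complex.I))

lemma chart_dist {o κ : ℂ} {ρ : ℝ} (hρ : 0 < ρ) (hκ : ‖κ‖ = 1) {q : ℝ × ℝ} (hq : 0 ≤ q.2) :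
    Dist.dist (chart o ρ κ q) o = ρ * (q.2 / 4) := by
  rw [chart, _root_.dist_eq_norm, add_sub_cancel_left, norm_mul, norm_mul, norm_mul, norm_inv, hκ,
    Complex.norm_exp_ofReal_mul_I, Complex.norm_real, Complex.norm_real, Real.norm_of_nonneg hρ.le,
    Real.norm_of_nonneg (by positivity)]
  ring

lemma chart_inj {o κ : ℂ} {ρ : ℝ} (hρ : 0 < ρ) (hκ : ‖κ‖ = 1) {q r : ℝ × ℝ}
    (hq : q.1 ∈ Set.Ioo (-Real.pi) Real.pi ∧ 1 ≤ q.2 ∧ q.2 ≤ 4)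
    (hr : r.1 ∈ Set.Ioo (-Real.pi) Real.pi ∧ 1 ≤ r.2 ∧ r.2 ≤ 4)
    (h : chart o ρ κ q = chart o ρ κ r) : q = r := by
  have h2 : q.2 = r.2 := by
    have : Dist.dist (chart o ρ κ q) o = Dist.dist (chart o ρ κ r) o := by rw [h]
    rw [chart_dist hρ hκ (by linarith), chart_dist hρ hκ (by linarith)] at this
    have := mul_left_cancel₀ hρ.ne' this
    linarith
  have hκ0 : κ ≠ 0 := by rintro rfl; simp at hκ
  rw [chart, chart, h2] at h
  have h3 := add_left_cancel h
  have hr0 : ((ρ : ℂ) * ((r.2 / 4 : ℝ) : ℂ)) ≠ 0 := by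
    refine mul_ne_zero (by exact_mod_cast hρ.ne') ?_
    have : r.2 / 4 ≠ 0 := by linarith
    exact_mod_cast this
  have h4 := mul_left_cancel₀ (inv_ne_zero hκ0) (mul_left_cancel₀ hr0 h3)
  have h5 := congrArg Complex.arg h4
  rw [Complex.arg_exp_mul_I, Complex.arg_exp_mul_I, toIocMod_eq_self _ |>.2, toIocMod_eq_self _ |>.2] at h5
  · exact Prod.ext h5 h2
  · exact ⟨hr.1.1, by linarith [hr.1.2]⟩
  · exact ⟨hq.1.1, by linarith [hq.1.2]⟩

lemma chart_cont (o κ : ℂ) (ρ : ℝ) : Continuous (chart o ρ κ) := by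
  unfold chart; fun_prop

lemma piece_joined (o κ : ℂ) (ρ g ϑ : ℝ) (i : Fin 3) :
    JoinedIn (chart o ρ κ '' piece g i (some ϑ)) (chart o ρ κ (g, (i : ℝ) + 1))
      (chart o ρ κ (ϑ, 4)) := by
  have hi : (i : ℝ) + 1 ≤ 3 := by
    have : (i : ℕ) + 1 ≤ 3 := i.2
    exact_mod_cast this
  have hc : Continuous fun h : ℝ => (g + min 1 (h - (i + 1)) * (ϑ - g), h) := by fun_prop
  have h1 : JoinedIn (Set.Icc ((i : ℝ) + 1) 4) ((i : ℝ) + 1) 4 :=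
    ((convex_Icc _ _).isPathConnected ⟨4, by constructor <;> linarith⟩).joinedIn _
      (by constructor <;> linarith) _ (by constructor <;> linarith)
  have h2 := h1.map ((chart_cont o κ ρ).comp hc)
  have e1 : g + min 1 (((i : ℝ) + 1) - (i + 1)) * (ϑ - g) = g := by simp
  have e2 : g + min 1 ((4 : ℝ) - (i + 1)) * (ϑ - g) = ϑ := by
    rw [min_eq_left (by linarith)]; ring
  simp only [Function.comp_apply, e1, e2] at h2
  refine h2.mono ?_
  rintro _ ⟨h, hh, rfl⟩
  exact ⟨_, ⟨hh.1, hh.2, rfl⟩, rfl⟩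

lemma vert_joined (o κ : ℂ) (ρ g : ℝ) (i : Fin 3) (hi : (i : ℕ) ≤ 1) :
    JoinedIn (chart o ρ κ '' piece g i none) (chart o ρ κ (g, (i : ℝ) + 1))
      (chart o ρ κ (g, (i : ℝ) + 2)) := by
  have hi : (i : ℝ) ≤ 1 := by exact_mod_cast hi
  have hc : Continuous fun h : ℝ => (g, h) := by fun_prop
  have h1 : JoinedIn (Set.Icc ((i : ℝ) + 1) ((i : ℝ) + 2)) ((i : ℝ) + 1) ((i : ℝ) + 2) :=
    ((convex_Icc _ _).isPathConnected ⟨(i : ℝ) + 1, by constructor <;> linarith⟩).joinedIn _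
      (by constructor <;> linarith) _ (by constructor <;> linarith)
  refine (h1.map ((chart_cont o κ ρ).comp hc)).mono ?_
  rintro _ ⟨h, hh, rfl⟩
  exact ⟨_, ⟨rfl, hh.1, hh.2, by linarith [hh.2]⟩, rfl⟩

end CrK

namespace CrK
open Metric Filter Topology

/-- all data for the surgery -/
structure Surg {W E : Type*} (S : Sys W E) where
  ρ : ℝ
  hρ : 0 < ρ
  u : E → Bool → ℂ
  δ : ℝ
  T : E → SignType → Set ℂ
  td : TubeData S ρ u δ T
  sep : ∀ w w', w ≠ w' → 2 * ρ < Dist.dist (S.pos w) (S.pos w')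
  κ : W → ℂ
  hκ : ∀ w, ‖κ w‖ = 1
  g : W → ℝ
  hg : ∀ w, g w ∈ Set.Ioo (-Real.pi) Real.pi
  ang : E → Bool → SignType → ℝ
  hang : ∀ e b k, S.pos (S.v e b) + ρ * u e b * wr δ (if b then -k else k) =
    chart (S.pos (S.v e b)) ρ (κ (S.v e b)) (ang e b k, 4)
  hangI : ∀ e b k, ang e b k ∈ Set.Ioo (-Real.pi) Real.pi
  hangne : ∀ e b k, ang e b k ≠ g (S.v e b)
  hanginj : ∀ e b k f c l, S.v e b = S.v f c → ang e b k = ang f c l → e = f ∧ b = c ∧ k = l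
  lev : E → SignType → Bool → Fin 3

namespace Surg
variable {W E : Type*} {S : Sys W E} (Q : Surg S)

abbrev R (W E : Type*) := (E × SignType) ⊕ (W × Bool)

def Has : R W E → W → Fin 3 → Option ℝ → Prop
  | .inl s, w, i, o => ∃ b, S.v s.1 b = w ∧ i = Q.lev s.1 s.2 b ∧ o = some (Q.ang s.1 b s.2)
  | .inr s, w, i, o => w = s.1 ∧ i = (if s.2 then 1 else 0) ∧ o = none

def TT : R W E → Set ℂ
  | .inl s => Q.T s.1 s.2
  | .inr _ => ∅

noncomputable def ch (w : W) (q : ℝ × ℝ) : ℂ := chart (S.pos w) Q.ρ (Q.κ w) q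

def KK (r : R W E) : Set ℂ :=
  Q.TT r ∪ {z | ∃ w i o, Q.Has r w i o ∧ z ∈ Q.ch w '' piece (Q.g w) i o}

def vv : R W E → Bool → W × Fin 3
  | .inl s, b => (S.v s.1 b, Q.lev s.1 s.2 b)
  | .inr s, b => (s.1, if s.2 then (if b then 2 else 1) else (if b then 1 else 0))

noncomputable def npos (x : W × Fin 3) : ℂ := Q.ch x.1 (Q.g x.1, (x.2 : ℝ) + 1)

/-- local crossing of two strands at a common vertex -/
def LXs (e : E) (k : SignType) (b : Bool) (f : E) (l : SignType) (c : Bool) : Prop :=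
  S.v e b = S.v f c ∧ LX (Q.g (S.v e b)) (Q.lev e k b) (Q.ang e b k) (Q.lev f l c) (Q.ang f c l)

lemma v_inj (e : E) {b c : Bool} (h : S.v e b = S.v e c) : b = c := by
  have := S.ne e
  cases b <;> cases c <;> first | rfl | exact absurd h this | exact absurd h.symm this

lemma has_unique {r : R W E} {w i o i' o'} (h : Q.Has r w i o) (h' : Q.Has r w i' o') :
    i = i' ∧ o = o' := by
  rcases r with s | s
  · obtain ⟨b, hb, rfl, rfl⟩ := h
    obtain ⟨c, hc, rfl, rfl⟩ := h'
    obtain rfl := v_inj s.1 (hb.trans hc.symm)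
    exact ⟨rfl, rfl⟩
  · obtain ⟨-, rfl, rfl⟩ := h
    obtain ⟨-, rfl, rfl⟩ := h'
    exact ⟨rfl, rfl⟩

lemma has_ne {r r' : R W E} (hr : r ≠ r') {w i o i' o'} (h : Q.Has r w i o) (h' : Q.Has r' w i' o') :
    o = o' → o = none ∧ i ≠ i' := by
  intro ho; subst ho
  rcases r with s | s <;> rcases r' with s' | s'
  · obtain ⟨b, hb, rfl, rfl⟩ := h
    obtain ⟨c, hc, rfl, hh⟩ := h'
    exfalso; apply hr
    obtain ⟨h1, -, h2⟩ := Q.hanginj _ _ _ _ _ _ (hb.trans hc.symm) (Option.some.inj hh)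
    exact congrArg _ (Prod.ext h1 h2)
  · obtain ⟨b, hb, rfl, rfl⟩ := h
    exact absurd h'.2.2 (by simp)
  · obtain ⟨b, hb, rfl, rfl⟩ := h'
    exact absurd h.2.2 (by simp)
  · obtain ⟨rfl, rfl, rfl⟩ := h
    obtain ⟨h1, rfl, -⟩ := h'
    refine ⟨rfl, fun hh => hr (congrArg _ (Prod.ext h1 ?_))⟩
    revert hh
    cases s.2 <;> cases s'.2 <;> simp

lemma has_I {r : R W E} {w i o} (h : Q.Has r w i o) :
    ∀ ϑ, o = some ϑ → ϑ ∈ Set.Ioo (-Real.pi) Real.pi := by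
  rintro ϑ rfl
  rcases r with s | s
  · obtain ⟨b, hb, rfl, hh⟩ := h
    rw [Option.some.inj hh]; exact Q.hangI _ _ _
  · exact absurd h.2.2 (by simp)

lemma has_g {r : R W E} {w i o} (h : Q.Has r w i o) :
    ∀ ϑ, o = some ϑ → ϑ ≠ Q.g w := by
  rintro ϑ rfl
  rcases r with s | s
  · obtain ⟨b, hb, rfl, hh⟩ := h
    rw [Option.some.inj hh, ← hb]; exact Q.hangne _ _ _
  · exact absurd h.2.2 (by simp)

lemma has_range {r : R W E} {w i o} (h : Q.Has r w i o) {q : ℝ × ℝ} (hq : q ∈ piece (Q.g w) i o) :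
    q.1 ∈ Set.Ioo (-Real.pi) Real.pi ∧ 1 ≤ q.2 ∧ q.2 ≤ 4 :=
  piece_range (Q.hg w) (Q.has_I h) hq

lemma node_iff {r : R W E} {w : W} {n : Fin 3} :
    (∃ b, (w, n) = Q.vv r b) ↔ ∃ i o, Q.Has r w i o ∧ pnode i o n := by
  rcases r with s | s
  · constructor
    · rintro ⟨b, hb⟩
      have h1 := congrArg Prod.fst hb
      have h2 := congrArg Prod.snd hb
      exact ⟨_, _, ⟨b, h1.symm, rfl, rfl⟩, h2⟩
    · rintro ⟨i, o, ⟨b, rfl, rfl, rfl⟩, h⟩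
      exact ⟨b, Prod.ext rfl h⟩
  · constructor
    · rintro ⟨b, hb⟩
      have h1 := congrArg Prod.fst hb
      have h2 := congrArg Prod.snd hb
      refine ⟨_, _, ⟨h1, rfl, rfl⟩, ?_⟩
      simp only [vv] at h2
      subst h2
      cases s.2 <;> cases b <;> simp [pnode]
    · rintro ⟨i, o, ⟨rfl, rfl, rfl⟩, h⟩
      have h' : (n : ℕ) = ((if s.2 then 1 else 0 : Fin 3) : ℕ) ∨
        (n : ℕ) = ((if s.2 then 1 else 0 : Fin 3) : ℕ) + 1 := h
      rcases h' with h' | h'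
      · refine ⟨false, Prod.ext rfl (Fin.ext ?_)⟩
        simp only [vv]; rw [h']; cases s.2 <;> rfl
      · refine ⟨true, Prod.ext rfl (Fin.ext ?_)⟩
        simp only [vv]; rw [h']; cases s.2 <;> rfl

lemma ch_dist (w : W) {q : ℝ × ℝ} (h : 0 ≤ q.2) : Dist.dist (Q.ch w q) (S.pos w) = Q.ρ * (q.2 / 4) :=
  chart_dist Q.hρ (Q.hκ w) h

lemma ch_dist_le (w : W) {q : ℝ × ℝ} (h : 1 ≤ q.2 ∧ q.2 ≤ 4) : Dist.dist (Q.ch w q) (S.pos w) ≤ Q.ρ := by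
  rw [Q.ch_dist w (by linarith)]
  have := Q.hρ
  nlinarith

lemma ch_inj {w w' : W} {q r : ℝ × ℝ}
    (hq : q.1 ∈ Set.Ioo (-Real.pi) Real.pi ∧ 1 ≤ q.2 ∧ q.2 ≤ 4)
    (hr : r.1 ∈ Set.Ioo (-Real.pi) Real.pi ∧ 1 ≤ r.2 ∧ r.2 ≤ 4)
    (h : Q.ch w q = Q.ch w' r) : w = w' ∧ q = r := by
  have hw : w = w' := by
    by_contra hw
    have h1 := Q.sep w w' hw
    have h2 := Q.ch_dist_le w hq.2
    have h3 := Q.ch_dist_le w' hr.2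
    rw [← h] at h3
    have h4 := _root_.dist_triangle_left (S.pos w) (S.pos w') (Q.ch w q)
    linarith
  subst hw
  exact ⟨rfl, chart_inj Q.hρ (Q.hκ w) hq hr h⟩

lemma node_range (x : W × Fin 3) : ((Q.g x.1, (x.2 : ℝ) + 1) : ℝ × ℝ).1 ∈ Set.Ioo (-Real.pi) Real.pi ∧
    1 ≤ ((Q.g x.1, (x.2 : ℝ) + 1) : ℝ × ℝ).2 ∧ ((Q.g x.1, (x.2 : ℝ) + 1) : ℝ × ℝ).2 ≤ 4 := by
  have h0 : (0 : ℝ) ≤ (x.2 : ℝ) := by positivity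
  have h3 : ((x.2 : ℕ) : ℝ) ≤ 2 := by
    have : (x.2 : ℕ) ≤ 2 := by omega
    exact_mod_cast this
  exact ⟨Q.hg _, by simp only []; linarith, by simp only []; linarith⟩

lemma npos_inj : Function.Injective Q.npos := by
  intro x y h
  obtain ⟨h1, h2⟩ := Q.ch_inj (Q.node_range x) (Q.node_range y) h
  have h3 := congrArg Prod.snd h2
  simp only [] at h3
  exact Prod.ext h1 (fin3_cast_inj (by linarith))

/-- points of a tube inside a vertex disc are ports -/
lemma TT_ball {r : R W E} {w : W} {q : ℝ × ℝ}
    (hq : q.1 ∈ Set.Ioo (-Real.pi) Real.pi ∧ 1 ≤ q.2 ∧ q.2 ≤ 4) (h : Q.ch w q ∈ Q.TT r) :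
    ∃ i ϑ, Q.Has r w i (some ϑ) ∧ q = (ϑ, 4) := by
  rcases r with s | s
  · obtain ⟨b, rfl, hz⟩ := Q.td.ball s.1 s.2 w _ h (Q.ch_dist_le w hq.2)
    rw [Q.hang] at hz
    refine ⟨_, _, ⟨b, rfl, rfl, rfl⟩, ?_⟩
    exact chart_inj Q.hρ (Q.hκ _) hq ⟨Q.hangI _ _ _, by norm_num, by norm_num⟩ hz
  · exact absurd h (Set.notMem_empty _)

lemma piece_top {g ϑ : ℝ} {i : Fin 3} {o : Option ℝ} (h : (ϑ, (4 : ℝ)) ∈ piece g i o) : o = some ϑ := by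
  rcases o with _ | η
  · obtain ⟨-, -, -, h⟩ := h; norm_num at h
  · obtain ⟨h1, h2, h3⟩ := h
    have hi : (i : ℝ) ≤ 2 := by
      have : (i : ℕ) ≤ 2 := by omega
      exact_mod_cast this
    simp only at h3
    rw [min_eq_left (by linarith)] at h3
    rw [h3]; congr 1; ring

/-- a tube and a local piece of different edges are disjoint -/
lemma TT_piece {r r' : R W E} (hr : r ≠ r') {w i o} (h : Q.Has r' w i o) {q : ℝ × ℝ}
    (hq : q ∈ piece (Q.g w) i o) : Q.ch w q ∉ Q.TT r := by
  intro hT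
  obtain ⟨j, ϑ, hh, rfl⟩ := Q.TT_ball (Q.has_range h hq) hT
  have := piece_top hq
  subst this
  exact absurd (Q.has_ne hr hh h rfl).1 (by simp)

lemma npos_TT (x : W × Fin 3) (r : R W E) : Q.npos x ∉ Q.TT r := by
  intro hT
  obtain ⟨j, ϑ, hh, h⟩ := Q.TT_ball (Q.node_range x) hT
  have h3 := congrArg Prod.snd h
  simp only at h3
  have h3' : ((x.2 : ℕ) : ℝ) ≤ 2 := by
    have : (x.2 : ℕ) ≤ 2 := by omega
    exact_mod_cast this
  linarith

lemma npos_KK {x : W × Fin 3} {r : R W E} (h : Q.npos x ∈ Q.KK r) : ∃ b, x = Q.vv r b := by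
  rcases h with h | ⟨w, i, o, hh, q, hq, hz⟩
  · exact absurd h (Q.npos_TT x r)
  · obtain ⟨h1, h2⟩ := Q.ch_inj (Q.has_range hh hq) (Q.node_range x) hz
    obtain ⟨w', n⟩ := x
    simp only at h1 h2
    subst h1
    refine Q.node_iff.2 ⟨i, o, hh, ?_⟩
    rw [h2] at hq
    rcases o with _ | ϑ
    · obtain ⟨-, h1, h2, h3⟩ := hq
      simp only at h1 h2 h3
      have l1 : (i : ℕ) ≤ n := by
        have : (i : ℝ) ≤ n := by linarith
        exact_mod_cast this
      have l2 : (n : ℕ) ≤ i + 1 := by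
        have : (n : ℝ) ≤ i + 1 := by linarith
        exact_mod_cast this
      show (n : ℕ) = i ∨ (n : ℕ) = i + 1
      omega
    · have := strand_g (Q.has_g hh ϑ rfl) hq
      exact fin3_cast_inj (by linarith)

lemma KK_joined (r : R W E) : JoinedIn (Q.KK r) (Q.npos (Q.vv r false)) (Q.npos (Q.vv r true)) := by
  rcases r with s | s
  · have h : ∀ b, JoinedIn (Q.KK (.inl s)) (Q.npos (Q.vv (.inl s) b))
        (S.pos (S.v s.1 b) + Q.ρ * Q.u s.1 b * wr Q.δ (if b then -s.2 else s.2)) := by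
      intro b
      rw [Q.hang]
      refine (piece_joined (S.pos (S.v s.1 b)) (Q.κ (S.v s.1 b)) Q.ρ (Q.g (S.v s.1 b))
        (Q.ang s.1 b s.2) (Q.lev s.1 s.2 b)).mono ?_
      intro z hz
      exact Or.inr ⟨_, _, _, ⟨b, rfl, rfl, rfl⟩, hz⟩
    have h' := (Q.td.joined s.1 s.2).mono (fun z hz => (Or.inl hz : z ∈ Q.KK (.inl s)))
    exact ((h false).trans h').trans (h true).symm
  · have h := vert_joined (S.pos s.1) (Q.κ s.1) Q.ρ (Q.g s.1) (if s.2 then 1 else 0)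
      (by cases s.2 <;> simp)
    have e1 : Q.npos (Q.vv (Sum.inr s) false) = chart (S.pos s.1) Q.ρ (Q.κ s.1)
        (Q.g s.1, (((if s.2 then 1 else 0 : Fin 3) : ℕ) : ℝ) + 1) := by
      simp only [npos, vv, ch]
      cases s.2 <;> simp
    have e2 : Q.npos (Q.vv (Sum.inr s) true) = chart (S.pos s.1) Q.ρ (Q.κ s.1)
        (Q.g s.1, (((if s.2 then 1 else 0 : Fin 3) : ℕ) : ℝ) + 2) := by
      simp only [npos, vv, ch]
      cases s.2 <;> norm_num
    rw [e1, e2]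
    exact h.mono (fun z hz => Or.inr ⟨s.1, _, _, ⟨rfl, rfl, rfl⟩, hz⟩)

/-- description of common points -/
lemma KK_inter {r r' : R W E} (hr : r ≠ r') {z : ℂ} (h : z ∈ Q.KK r) (h' : z ∈ Q.KK r') :
    (z ∈ Q.TT r ∧ z ∈ Q.TT r') ∨
    ∃ w q i o i' o', z = Q.ch w q ∧ Q.Has r w i o ∧ Q.Has r' w i' o' ∧ q ∈ piece (Q.g w) i o ∧
      q ∈ piece (Q.g w) i' o' := by
  rcases h with h | ⟨w, i, o, hh, q, hq, rfl⟩
  · rcases h' with h' | ⟨w, i, o, hh, q, hq, rfl⟩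
    · exact Or.inl ⟨h, h'⟩
    · exact absurd h (Q.TT_piece hr hh hq)
  · rcases h' with h' | ⟨w', i', o', hh', q', hq', hz⟩
    · exact absurd h' (Q.TT_piece hr.symm hh hq)
    · obtain ⟨rfl, rfl⟩ := Q.ch_inj (Q.has_range hh' hq') (Q.has_range hh hq) hz
      exact Or.inr ⟨_, _, _, _, _, _, rfl, hh, hh', hq, hq'⟩

/-- a common point of tubes -/
lemma TT_inter {r r' : R W E} (hr : r ≠ r') {z : ℂ} (h : z ∈ Q.TT r) (h' : z ∈ Q.TT r') :
    ∃ s s', r = .inl s ∧ r' = .inl s' ∧ s.1 ≠ s'.1 ∧ S.Cross s.1 s'.1 := by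
  rcases r with s | s
  · rcases r' with s' | s'
    · have hne : s.1 ≠ s'.1 := by
        intro he
        obtain ⟨e, k⟩ := s
        obtain ⟨e', k'⟩ := s'
        simp only at he
        subst he
        have hk : k ≠ k' := by rintro rfl; exact hr rfl
        exact Set.disjoint_left.1 (Q.td.disj _ _ _ hk) h h'
      exact ⟨s, s', rfl, rfl, hne, Q.td.cross _ _ _ _ hne z h h'⟩
    · exact absurd h' (Set.notMem_empty _)
  · exact absurd h (Set.notMem_empty _)

/-- local crossing relation between new edges -/
def LR (r r' : R W E) (w : W) : Prop :=
  ∃ s b s' c, r = .inl s ∧ r' = .inl s' ∧ S.v s.1 b = w ∧ Q.LXs s.1 s.2 b s'.1 s'.2 c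

end Surg
end CrK

namespace CrK
open Metric Filter Topology
namespace Surg
variable {W E : Type*} {S : Sys W E} (Q : Surg S)

lemma share_unique {e f : E} (h : e ≠ f) {b b' c c' : Bool} (h1 : S.v e b = S.v f b')
    (h2 : S.v e c = S.v f c') : b = c ∧ b' = c' := by
  have hK : ∀ e b, S.pos (S.v e b) ∈ S.K e := by
    intro e b
    cases b
    · exact (S.joined e).source_mem
    · exact (S.joined e).target_mem
  have h3 := S.adj e f b b' h h1 ⟨hK e c, by rw [h2]; exact hK f c'⟩
  have h4 := S.inj h3
  refine ⟨(v_inj e h4).symm, ?_⟩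
  exact v_inj f (h1.symm.trans (h4.symm.trans h2))

def Share (r r' : R W E) (x : W × Fin 3) : Prop := (∃ b, x = Q.vv r b) ∧ ∃ c, x = Q.vv r' c

def Clean (r r' : R W E) : Prop := ∀ e k l, r = .inl (e, k) → r' = .inl (e, l) → k ≠ l →
  ∃ b, Q.lev e k b ≠ Q.lev e l b ∧ ¬ Q.LXs e k b e l b

variable {Q}

lemma local_dich {r r' : R W E} (hr : r ≠ r') {w i o i' o'} {q : ℝ × ℝ} (h : Q.Has r w i o)
    (h' : Q.Has r' w i' o') (hq : q ∈ piece (Q.g w) i o) (hq' : q ∈ piece (Q.g w) i' o') :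
    (∃ n, Q.Share r r' (w, n) ∧ Q.ch w q = Q.npos (w, n)) ∨ (Q.LR r r' w ∧ i ≠ i' ∧
      ∃ ϑ η, o = some ϑ ∧ o' = some η) := by
  rcases piece_inter (Q.has_g h) (Q.has_g h') (Q.has_ne hr h h') hq hq' with
    ⟨n, h1, h2, rfl⟩ | ⟨ϑ, η, rfl, rfl, hl⟩
  · exact Or.inl ⟨n, ⟨Q.node_iff.2 ⟨i, o, h, h1⟩, Q.node_iff.2 ⟨i', o', h', h2⟩⟩, rfl⟩
  · refine Or.inr ⟨?_, hl.ne, _, _, rfl, rfl⟩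
    rcases r with s | s
    · rcases r' with s' | s'
      · obtain ⟨b, hb, rfl, hh⟩ := h
        obtain ⟨c, hc, rfl, hh'⟩ := h'
        refine ⟨s, b, s', c, rfl, rfl, hb, hb.trans hc.symm, ?_⟩
        rw [← Option.some.inj hh, ← Option.some.inj hh', hb]
        exact hl
      · exact absurd h'.2.2 (by simp)
    · exact absurd h.2.2 (by simp)

lemma share_eq {r r' : R W E} (hr : r ≠ r') (hc : Q.Clean r r') {x x' : W × Fin 3}
    (h : Q.Share r r' x) (h' : Q.Share r r' x') : x = x' := by
  obtain ⟨⟨b, rfl⟩, ⟨b', hb⟩⟩ := h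
  obtain ⟨⟨c, rfl⟩, ⟨c', hc'⟩⟩ := h'
  rcases r with ⟨e, k⟩ | ⟨w, j⟩ <;> rcases r' with ⟨e', k'⟩ | ⟨w', j'⟩
  · simp only [vv, Prod.mk.injEq] at hb hc'
    by_cases he : e = e'
    · subst he
      have hk : k ≠ k' := by rintro rfl; exact hr rfl
      obtain rfl := v_inj e hb.1
      obtain rfl := v_inj e hc'.1
      obtain ⟨a, ha, -⟩ := hc e k k' rfl rfl hk
      have hbc : b = c := by
        by_contra hbc
        have : a = b ∨ a = c := by revert hbc; cases a <;> cases b <;> cases c <;> simp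
        rcases this with rfl | rfl
        · exact ha hb.2
        · exact ha hc'.2
      rw [hbc]
    · rw [(share_unique he hb.1 hc'.1).1]
  · simp only [vv, Prod.mk.injEq] at hb hc'
    rw [v_inj e (hb.1.trans hc'.1.symm)]
  · simp only [vv, Prod.mk.injEq] at hb hc'
    have := v_inj e' (hb.1.symm.trans hc'.1)
    subst this
    simp only [vv]
    rw [hb.2, hc'.2]
  · simp only [vv, Prod.mk.injEq] at hb hc'
    obtain ⟨rfl, hb⟩ := hb
    have hj : j ≠ j' := by rintro rfl; exact hr rfl
    have hc' := hc'.2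
    simp only [vv, Prod.mk.injEq, true_and]
    revert hb hc' hj
    cases j <;> cases j' <;> cases b <;> cases b' <;> cases c <;> cases c' <;> simp

lemma share_LR {r r' : R W E} (hr : r ≠ r') (hc : Q.Clean r r') {x : W × Fin 3} {w : W}
    (h : Q.Share r r' x) (h' : Q.LR r r' w) : False := by
  obtain ⟨⟨b, rfl⟩, ⟨b', hb⟩⟩ := h
  obtain ⟨⟨e, k⟩, c, ⟨e', k'⟩, c', rfl, rfl, rfl, hv, hl⟩ := h'
  simp only [vv, Prod.mk.injEq] at hb hv hl
  by_cases he : e = e'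
  · subst he
    have hk : k ≠ k' := by rintro rfl; exact hr rfl
    obtain rfl := v_inj e hb.1
    obtain rfl := v_inj e hv
    obtain ⟨a, ha, ha'⟩ := hc e k k' rfl rfl hk
    by_cases hbc : b = c
    · subst hbc; exact hl.ne hb.2
    · have : a = b ∨ a = c := by revert hbc; cases a <;> cases b <;> cases c <;> simp
      rcases this with rfl | rfl
      · exact ha hb.2
      · exact ha' ⟨rfl, hl⟩
  · obtain ⟨rfl, rfl⟩ := share_unique he hb.1 hv
    exact hl.ne hb.2

lemma LR_eq {r r' : R W E} (hr : r ≠ r') (hc : Q.Clean r r') {w w' : W}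
    (h : Q.LR r r' w) (h' : Q.LR r r' w') : w = w' := by
  obtain ⟨⟨e, k⟩, b, ⟨e', k'⟩, b', rfl, rfl, rfl, hv, hl⟩ := h
  obtain ⟨⟨e₁, k₁⟩, c, ⟨e₁', k₁'⟩, c', h1, h2, rfl, hv', hl'⟩ := h'
  simp only [Sum.inl.injEq, Prod.mk.injEq] at h1 h2
  obtain ⟨rfl, rfl⟩ := h1
  obtain ⟨rfl, rfl⟩ := h2
  simp only at hv hl hv' hl' ⊢
  by_cases he : e = e'
  · subst he
    have hk : k ≠ k' := by rintro rfl; exact hr rfl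
    obtain rfl := v_inj e hv
    obtain rfl := v_inj e hv'
    obtain ⟨a, ha, ha'⟩ := hc e k k' rfl rfl hk
    by_contra hbc
    have hbc : b ≠ c := fun h => hbc (by rw [h])
    have : a = b ∨ a = c := by revert hbc; cases a <;> cases b <;> cases c <;> simp
    rcases this with rfl | rfl
    · exact ha' ⟨rfl, hl⟩
    · exact ha' ⟨rfl, hl'⟩
  · rw [(share_unique he hv hv').1]

lemma TT_share {r r' : R W E} (hr : r ≠ r') {z : ℂ} (h : z ∈ Q.TT r) (h' : z ∈ Q.TT r')
    {x : W × Fin 3} (hs : Q.Share r r' x) : False := by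
  obtain ⟨s, s', rfl, rfl, hne, hcr⟩ := Q.TT_inter hr h h'
  obtain ⟨⟨b, rfl⟩, ⟨b', hb⟩⟩ := hs
  simp only [vv, Prod.mk.injEq] at hb
  exact hcr.2.1 _ _ hb.1

lemma TT_LR {r r' : R W E} (hr : r ≠ r') {z : ℂ} (h : z ∈ Q.TT r) (h' : z ∈ Q.TT r')
    {w : W} (hs : Q.LR r r' w) : False := by
  obtain ⟨s, s', rfl, rfl, hne, hcr⟩ := Q.TT_inter hr h h'
  obtain ⟨s1, b, s1', b', h1, h2, -, hv, -⟩ := hs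
  simp only [Sum.inl.injEq] at h1 h2
  subst h1; subst h2
  exact hcr.2.1 _ _ hv

variable (Q)

/-- the system produced by the surgery -/
noncomputable def newSys {F : Type*} (rep : F → R W E) (hrep : Function.Injective rep)
    (hcl : ∀ f f', Q.Clean (rep f) (rep f')) : Sys (W × Fin 3) F where
  pos := Q.npos
  inj := Q.npos_inj
  v f := Q.vv (rep f)
  ne f := by
    rcases rep f with s | s
    · intro h; exact S.ne s.1 (congrArg Prod.fst h)
    · intro h
      have := congrArg Prod.snd h
      simp only [vv] at this
      revert this
      cases s.2 <;> simp
  K f := Q.KK (rep f)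
  joined f := Q.KK_joined (rep f)
  avoid f x h := Q.npos_KK h
  adj f f' b c hff h := by
    have hr : rep f ≠ rep f' := fun h => hff (hrep h)
    have hs : Q.Share (rep f) (rep f') (Q.vv (rep f) b) := ⟨⟨b, rfl⟩, ⟨c, h⟩⟩
    rintro z ⟨hz, hz'⟩
    rcases Q.KK_inter hr hz hz' with ⟨h1, h2⟩ | ⟨w, q, i, o, i', o', rfl, h1, h2, h3, h4⟩
    · exact absurd hs (TT_share hr h1 h2)
    · rcases local_dich hr h1 h2 h3 h4 with ⟨n, hn, hz⟩ | ⟨hl, -⟩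
      · rw [hz, share_eq hr (hcl f f') hn hs]; rfl
      · exact absurd hl (share_LR hr (hcl f f') hs)
  once f f' hff h := by
    have hr : rep f ≠ rep f' := fun h => hff (hrep h)
    have hns : ∀ x, ¬ Q.Share (rep f) (rep f') x := by
      rintro x ⟨⟨b, rfl⟩, ⟨c, hc⟩⟩
      exact h b c hc
    rintro z ⟨hz, hz'⟩ y ⟨hy, hy'⟩
    rcases Q.KK_inter hr hz hz' with ⟨h1, h2⟩ | ⟨w, q, i, o, i', o', rfl, h1, h2, h3, h4⟩
    · rcases Q.KK_inter hr hy hy' with ⟨h1', h2'⟩ | ⟨w, q, i, o, i', o', rfl, h1', h2', h3, h4⟩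
      · obtain ⟨s, s', e1, e2, hne, -⟩ := Q.TT_inter hr h1 h2
        rw [e1] at h1 h1'
        rw [e2] at h2 h2'
        exact Q.td.once _ _ s.2 s'.2 hne ⟨h1, h2⟩ ⟨h1', h2'⟩
      · rcases local_dich hr h1' h2' h3 h4 with ⟨n, hn, hz⟩ | ⟨hl, -⟩
        · exact absurd hn (hns _)
        · exact absurd hl (TT_LR hr h1 h2)
    · rcases local_dich hr h1 h2 h3 h4 with ⟨n, hn, hz⟩ | ⟨hl, hii, ϑ, η, rfl, rfl⟩
      · exact absurd hn (hns _)
      rcases Q.KK_inter hr hy hy' with ⟨h1', h2'⟩ | ⟨w', q', j, p, j', p', rfl, h1', h2', h3', h4'⟩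
      · exact absurd hl (TT_LR hr h1' h2')
      · rcases local_dich hr h1' h2' h3' h4' with ⟨n, hn, hz⟩ | ⟨hl', -⟩
        · exact absurd hn (hns _)
        · obtain rfl := LR_eq hr (hcl f f') hl hl'
          obtain ⟨rfl, rfl⟩ := Q.has_unique h1 h1'
          obtain ⟨rfl, rfl⟩ := Q.has_unique h2 h2'
          have hne : ϑ ≠ η := by
            intro h
            exact absurd (Q.has_ne hr h1 h2 (by rw [h])).1 (by simp)
          rw [strand_sub hii hne (Q.has_g h1 _ rfl) (Q.has_g h2 _ rfl) ⟨h3, h4⟩ ⟨h3', h4'⟩]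
  triple f f' f'' h12 h13 h23 z hz hz' hz'' := by
    have hr12 : rep f ≠ rep f' := fun h => h12 (hrep h)
    have hr13 : rep f ≠ rep f'' := fun h => h13 (hrep h)
    have hr23 : rep f' ≠ rep f'' := fun h => h23 (hrep h)
    rcases Q.KK_inter hr12 hz hz' with ⟨h1, h2⟩ | ⟨w, q, i, o, i', o', rfl, h1, h2, h3, h4⟩
    · rcases Q.KK_inter hr13 hz hz'' with ⟨-, h3⟩ | ⟨w, q, i, o, i', o', rfl, h1', h2', h3', h4'⟩
      · obtain ⟨s, s', e1, e2, hne, -⟩ := Q.TT_inter hr12 h1 h2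
        obtain ⟨s₁, s'', e1', e3, hne', -⟩ := Q.TT_inter hr13 h1 h3
        obtain ⟨s₂, s₃, e2', e3', hne'', -⟩ := Q.TT_inter hr23 h2 h3
        rw [e1] at h1 e1'
        rw [e2] at h2 e2'
        rw [e3] at h3 e3'
        simp only [Sum.inl.injEq] at e1' e2' e3'
        subst e1' e2' e3'
        exact absurd h3 (Q.td.triple _ _ _ _ _ _ hne hne' hne'' z h1 h2)
      · exact absurd h2 (Q.TT_piece hr12.symm h1' h3')
    · rcases Q.KK_inter hr13 hz hz'' with ⟨h1', -⟩ | ⟨w', q', j, p, j', p', he, h1', h2', h3', h4'⟩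
      · exact absurd h1' (Q.TT_piece hr12 h2 h4)
      · obtain ⟨rfl, rfl⟩ := Q.ch_inj (Q.has_range h1 h3) (Q.has_range h1' h3') he
        rcases local_dich hr12 h1 h2 h3 h4 with ⟨n, hn, hz⟩ | ⟨hl, hii, ϑ, η, rfl, rfl⟩
        · exact ⟨_, hz⟩
        rcases local_dich hr13 h1' h2' h3' h4' with ⟨n, hn, hz⟩ | ⟨hl', hii', ϑ', ζ, rfl, rfl⟩
        · exact ⟨_, hz⟩
        obtain ⟨rfl, hϑ⟩ := Q.has_unique h1 h1'
        obtain rfl := Option.some.inj hϑ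
        have hne : ∀ {r r' : R W E} {i i' ϑ η}, r ≠ r' → Q.Has r w i (some ϑ) →
            Q.Has r' w i' (some η) → ϑ ≠ η := by
          intro r r' i i' ϑ η hr h1 h2 h
          exact absurd (Q.has_ne hr h1 h2 (by rw [h])).1 (by simp)
        obtain ⟨n, hn⟩ := strand_triple (hne hr12 h1 h2) (hne hr13 h1 h2') (hne hr23 h2 h2')
          (Q.has_g h1 _ rfl) (Q.has_g h2 _ rfl) (Q.has_g h2' _ rfl) h3 h4 h4'
        exact ⟨(w, n), by rw [hn]; rfl⟩

lemma newSys_cross {F : Type*} (rep : F → R W E) (hrep : Function.Injective rep)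
    (hcl : ∀ f f', Q.Clean (rep f) (rep f')) {f f' : F} (h : (Q.newSys rep hrep hcl).Cross f f') :
    ∃ s s', rep f = .inl s ∧ rep f' = .inl s' ∧
      (S.Cross s.1 s'.1 ∨ ∃ b c, Q.LXs s.1 s.2 b s'.1 s'.2 c) := by
  obtain ⟨hff, hns, z, hz, hz'⟩ := h
  have hr : rep f ≠ rep f' := fun h => hff (hrep h)
  rcases Q.KK_inter hr hz hz' with ⟨h1, h2⟩ | ⟨w, q, i, o, i', o', rfl, h1, h2, h3, h4⟩
  · obtain ⟨s, s', e1, e2, hne, hc⟩ := Q.TT_inter hr h1 h2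
    exact ⟨s, s', e1, e2, Or.inl hc⟩
  · rcases local_dich hr h1 h2 h3 h4 with ⟨n, ⟨⟨b, hb⟩, ⟨c, hc⟩⟩, hz⟩ | ⟨⟨s, b, s', c, e1, e2, -, hl⟩, -⟩
    · exact absurd (hb.symm.trans hc) (hns b c)
    · exact ⟨s, s', e1, e2, Or.inr ⟨b, c, hl⟩⟩

end Surg
end CrK

namespace CrK
open Metric Filter Topology

noncomputable def clamp (x : ℝ) : ℝ := max 0 (min 1 x)

noncomputable def plpath (p : ℕ → ℂ) (N : ℕ) (s : ℝ) : ℂ :=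
  p 0 + ∑ i ∈ Finset.range N, (clamp (s - i) : ℂ) * (p (i + 1) - p i)

lemma plpath_cont (p : ℕ → ℂ) (N : ℕ) : Continuous (plpath p N) := by
  unfold plpath clamp; fun_prop

lemma plpath_eq (p : ℕ → ℂ) (N j : ℕ) (hj : j < N) (s : ℝ) (h0 : (j : ℝ) ≤ s) (h1 : s ≤ j + 1) :
    plpath p N s = p j + ((s - j : ℝ) : ℂ) * (p (j + 1) - p j) := by
  have key : ∀ N, j < N → plpath p N s = p j + ((s - j : ℝ) : ℂ) * (p (j + 1) - p j) := by
    intro N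
    induction N with
    | zero => intro h; omega
    | succ N ih =>
      intro hN
      rcases Nat.lt_succ_iff_lt_or_eq.1 hN with h | h
      · have := ih h
        have hc : clamp (s - N) = 0 := by
          have : (j : ℝ) + 1 ≤ N := by exact_mod_cast h
          unfold clamp
          rw [max_eq_left]
          exact (min_le_right _ _).trans (by linarith)
        unfold plpath at this ⊢
        rw [Finset.sum_range_succ, hc, ← add_assoc, this]; simp
      · subst h
        unfold plpath
        rw [Finset.sum_range_succ]
        have hc : clamp (s - j) = s - j := by
          unfold clamp
          rw [min_eq_right (by linarith), max_eq_right (by linarith)]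
        rw [hc, Finset.sum_congr rfl (g := fun i => p (i + 1) - p i), Finset.sum_range_sub]
        · ring
        · intro i hi
          have hi : i + 1 ≤ j := Finset.mem_range.1 hi
          have : (i : ℝ) + 1 ≤ j := by exact_mod_cast hi
          have hc : clamp (s - i) = 1 := by
            unfold clamp
            rw [min_eq_left (by linarith), max_eq_right (by linarith)]
          rw [hc]; simp
  exact key N hj

lemma plpath_seg (p : ℕ → ℂ) (N j : ℕ) (hj : j < N) (s : ℝ) (h0 : (j : ℝ) ≤ s) (h1 : s ≤ j + 1) :
    plpath p N s ∈ segment ℝ (p j) (p (j + 1)) := by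
  rw [plpath_eq p N j hj s h0 h1, segment_eq_image']
  exact ⟨s - j, ⟨by linarith, by linarith⟩, by simp⟩

lemma arc_of_chain {N : ℕ} {p : ℕ → ℂ} (hN : 0 < N) (hne : ∀ j < N, p j ≠ p (j + 1))
    (hsimp : ∀ i j, i < j → j < N → ∀ z, z ∈ segment ℝ (p i) (p (i + 1)) →
        z ∈ segment ℝ (p j) (p (j + 1)) → j = i + 1 ∧ z = p j) :
    ∃ γ : ℝ → ℂ, Continuous γ ∧ γ 0 = p 0 ∧ γ 1 = p N ∧ Set.InjOn γ (Set.Icc 0 1) ∧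
      ∀ t ∈ Set.Icc (0 : ℝ) 1, ∃ j < N, γ t ∈ segment ℝ (p j) (p (j + 1)) := by
  have hN' : (0 : ℝ) < N := by exact_mod_cast hN
  have up : ∀ s : ℝ, 0 < s → s ≤ N → ∃ j < N, (j : ℝ) < s ∧ s ≤ j + 1 := by
    intro s h0 h1
    have hc := Nat.ceil_pos.2 h0
    have hc1 : ⌈s⌉₊ ≤ N := Nat.ceil_le.2 h1
    refine ⟨⌈s⌉₊ - 1, by omega, ?_, ?_⟩
    · exact Nat.lt_ceil.1 (by omega)
    · have := Nat.le_ceil s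
      have h2 : ((⌈s⌉₊ - 1 : ℕ) : ℝ) + 1 = ⌈s⌉₊ := by
        rw [Nat.cast_sub hc]; simp
      rw [h2]; exact this
  have main : ∀ s s' : ℝ, 0 ≤ s → s < s' → s' ≤ N → plpath p N s ≠ plpath p N s' := by
    intro s s' h0 hss h1 heq
    obtain ⟨j, hj, hj0, hj1⟩ := up s' (by linarith) h1
    set i := ⌊s⌋₊ with hi
    have hi0 : (i : ℝ) ≤ s := Nat.floor_le h0
    have hi1 : s < i + 1 := Nat.lt_floor_add_one s
    have hij : i ≤ j := by
      have : (i : ℝ) < j + 1 := by linarith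
      have : i < j + 1 := by exact_mod_cast this
      omega
    have hiN : i < N := by omega
    have e1 := plpath_eq p N i hiN s hi0 hi1.le
    have e2 := plpath_eq p N j hj s' hj0.le hj1
    rcases hij.lt_or_eq with h | h
    · have h3 := hsimp i j h hj _ (plpath_seg p N i hiN s hi0 hi1.le)
        (by rw [heq]; exact plpath_seg p N j hj s' hj0.le hj1)
      rw [e1, h3.1] at h3
      have h4 : ((s - i - 1 : ℝ) : ℂ) * (p (i + 1) - p i) = 0 := by
        have := h3.2
        push_cast at this ⊢
        linear_combination this
      rcases mul_eq_zero.1 h4 with h | h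
      · have : s - i - 1 = 0 := by exact_mod_cast h
        linarith
      · exact hne i hiN (sub_eq_zero.1 h).symm
    · rw [← h] at e2
      have h4 : ((s' - s : ℝ) : ℂ) * (p (i + 1) - p i) = 0 := by
        rw [e1, e2] at heq
        push_cast at heq ⊢
        linear_combination -heq
      rcases mul_eq_zero.1 h4 with h | h
      · have : s' - s = 0 := by exact_mod_cast h
        linarith
      · exact hne i hiN (sub_eq_zero.1 h).symm
  refine ⟨fun t => plpath p N (t * N), (plpath_cont p N).comp (by fun_prop), ?_, ?_, ?_, ?_⟩
  · have := plpath_eq p N 0 hN 0 (by simp) (by simp)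
    simpa using this
  · obtain ⟨M, rfl⟩ : ∃ M, N = M + 1 := ⟨N - 1, by omega⟩
    have := plpath_eq p (M + 1) M (by omega) ((M + 1 : ℕ) : ℝ) (by simp) (by simp)
    simp only [one_mul]
    rw [this]; push_cast; ring
  · intro t ht t' ht' h
    by_contra hne'
    rcases lt_or_gt_of_ne hne' with h' | h'
    · exact main (t * N) (t' * N) (mul_nonneg ht.1 hN'.le) (by nlinarith) (by nlinarith [ht'.2]) h
    · exact main (t' * N) (t * N) (mul_nonneg ht'.1 hN'.le) (by nlinarith) (by nlinarith [ht.2]) h.symm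
  · intro t ht
    rcases ht.1.lt_or_eq with h0 | h0
    · obtain ⟨j, hj, h1, h2⟩ := up (t * N) (by positivity) (by nlinarith [ht.2])
      exact ⟨j, hj, plpath_seg p N j hj _ h1.le h2⟩
    · refine ⟨0, hN, plpath_seg p N 0 hN _ ?_ ?_⟩ <;> simp [← h0]

theorem arcs {W E : Type*} [Finite W] [Finite E] (S : Sys W E) :
    ∃ γ : E → ℝ → ℂ, (∀ e, Continuous (γ e)) ∧ (∀ e, γ e 0 = S.pos (S.v e false)) ∧
      (∀ e, γ e 1 = S.pos (S.v e true)) ∧ (∀ e, Set.InjOn (γ e) (Set.Icc 0 1)) ∧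
      (∀ e f, e ≠ f → γ e '' Set.Icc 0 1 ∩ γ f '' Set.Icc 0 1 ⊆ S.K e ∩ S.K f) ∧
      (∀ e w, S.pos w ∈ γ e '' Set.Icc 0 1 → S.pos w ∈ S.K e) := by
  obtain ⟨N, p, h0, h1, hne, hsimp, hop, hK, hef⟩ := polyline S.X S.X_finite S.K
    (fun e => S.pos (S.v e false)) (fun e => S.pos (S.v e true)) (fun e => S.pos_X _)
    (fun e => S.pos_X _) S.joined (fun e f h => S.inter_X e f h)
  have hN : ∀ e, 0 < N e := by
    intro e
    rcases Nat.eq_zero_or_pos (N e) with h | h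
    · have := h1 e; rw [h, h0 e] at this
      exact absurd (S.inj this) (S.ne e)
    · exact h
  have h := fun e => arc_of_chain (hN e) (hne e) (hsimp e)
  choose γ g1 g2 g3 g4 g5 using h
  refine ⟨γ, g1, fun e => (g2 e).trans (h0 e), fun e => (g3 e).trans (h1 e), g4, ?_, ?_⟩
  · rintro e f hff z ⟨⟨t, ht, rfl⟩, ⟨t', ht', he⟩⟩
    obtain ⟨i, hi, h1⟩ := g5 e t ht
    obtain ⟨j, hj, h2⟩ := g5 f t' ht'
    rw [he] at h2
    have hx := hef e f hff i hi j hj _ h1 h2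
    exact ⟨hK e i hi _ h1 hx, hK f j hj _ h2 hx⟩
  · rintro e w ⟨t, ht, he⟩
    obtain ⟨i, hi, h1⟩ := g5 e t ht
    rw [he] at h1
    exact hK e i hi _ h1 (S.pos_X w)

end CrK

namespace CrK
open Metric Filter Topology

section crn
variable {V : Type*} {G : SimpleGraph V} (D : Drawing G)

lemma isCrossing_symm {e f : Sym2 V} {p : ℝ × ℝ} (h : D.IsCrossing e f p) : D.IsCrossing f e p :=
  ⟨h.2.1, h.1, h.2.2.1.symm, h.2.2.2.2.1, h.2.2.2.1, h.2.2.2.2.2.2, h.2.2.2.2.2.1⟩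

/-- the crossing graph on the edges -/
def xgr : SimpleGraph (Sym2 V) where
  Adj e f := ∃ p, D.IsCrossing e f p
  symm := ⟨fun _ _ ⟨p, hp⟩ => ⟨p, isCrossing_symm D hp⟩⟩
  loopless := ⟨fun _ ⟨_, hp⟩ => hp.2.2.1 rfl⟩

def xpairs : Set (Sym2 V × Sym2 V) := {q | ∃ p, D.IsCrossing q.1 q.2 p}

lemma two_crNum [Finite V] (hD : D.IsGood) : 2 * D.crNum = Nat.card (xpairs D) := by
  classical
  have : Fintype V := Fintype.ofFinite V
  have h1 : D.crNum = Nat.card (xgr D).edgeSet := by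
    unfold Drawing.crNum Drawing.crBetween
    refine Nat.card_congr (Equiv.ofBijective (fun q => ⟨q.1.2, ?_⟩) ⟨?_, ?_⟩)
    · obtain ⟨e, f, h, -, -, hc⟩ := q.2
      rw [h]; exact ⟨_, hc⟩
    · rintro ⟨⟨p, s⟩, ⟨e, f, h, _, _, hc⟩⟩ ⟨⟨p', s'⟩, ⟨e', f', h', _, _, hc'⟩⟩ hpq
      have hpq : s = s' := congrArg Subtype.val hpq
      simp only at h h' hc hc'
      subst hpq
      have hc2 : D.IsCrossing e f p' := by
        rw [h] at h'
        rcases Sym2.eq_iff.1 h' with ⟨rfl, rfl⟩ | ⟨rfl, rfl⟩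
        · exact hc'
        · exact isCrossing_symm D hc'
      have := hD.cross_once e f hc hc2
      subst this; rfl
    · rintro ⟨s, hs⟩
      induction s using Sym2.ind with
      | _ e f =>
        obtain ⟨p, hp⟩ := hs
        exact ⟨⟨(p, s(e, f)), ⟨e, f, rfl, hp.1, hp.2.1, hp⟩⟩, rfl⟩
  have h2 : Nat.card (xpairs D) = Nat.card (xgr D).Dart := by
    refine Nat.card_congr ⟨fun q => ⟨q.1, q.2⟩, fun d => ⟨d.toProd, d.adj⟩, fun q => rfl, fun d => rfl⟩
  rw [h2, h1, Nat.card_eq_fintype_card]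
  have := (xgr D).dart_card_eq_twice_card_edges
  rw [Nat.card_eq_fintype_card, ← SimpleGraph.edgeFinset_card, ← this]

end crn

section realize
variable {W A B : Type*}

/-- the edge of the bipartite graph -/
def bed (q : A × B) : Sym2 (A ⊕ B) := s(Sum.inl q.1, Sum.inr q.2)

lemma bed_inj : Function.Injective (bed : A × B → Sym2 (A ⊕ B)) := by
  rintro ⟨a, b⟩ ⟨a', b'⟩ h
  simpa [bed] using h

lemma bed_edge {e : Sym2 (A ⊕ B)} (h : e ∈ (completeBipartiteGraph A B).edgeSet) : ∃ q, e = bed q := by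
  induction e using Sym2.ind with
  | _ x y =>
    rcases x with a | b <;> rcases y with a' | b' <;> simp at h
    · exact ⟨(a, b'), rfl⟩
    · exact ⟨(a', b), Sym2.eq_swap⟩

lemma bed_mem (q : A × B) : bed q ∈ (completeBipartiteGraph A B).edgeSet := by
  simp [bed]

theorem realize [Finite W] [Finite A] [Finite B] (S : Sys W (A × B)) (nd : A ⊕ B → W) (hnd : Function.Injective nd)
    (hv : ∀ a b, (S.v (a, b) false = nd (.inl a) ∧ S.v (a, b) true = nd (.inr b)) ∨
      (S.v (a, b) false = nd (.inr b) ∧ S.v (a, b) true = nd (.inl a))) :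
    ∃ D : Drawing (completeBipartiteGraph A B), D.IsGood ∧
      2 * D.crNum ≤ Nat.card {q : (A × B) × (A × B) // S.Cross q.1 q.2} := by
  classical
  obtain ⟨γ, g1, g2, g3, g4, g5, g6⟩ := arcs S
  -- normalise the direction
  obtain ⟨c, c1, c2, c3, c4, c5, c6⟩ : ∃ c : A × B → ℝ → ℂ, (∀ e, Continuous (c e)) ∧
      (∀ e, c e 0 = S.pos (nd (.inl e.1))) ∧ (∀ e, c e 1 = S.pos (nd (.inr e.2))) ∧
      (∀ e, Set.InjOn (c e) (Set.Icc 0 1)) ∧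
      (∀ e f, e ≠ f → c e '' Set.Icc 0 1 ∩ c f '' Set.Icc 0 1 ⊆ S.K e ∩ S.K f) ∧
      (∀ e w, S.pos w ∈ c e '' Set.Icc 0 1 → S.pos w ∈ S.K e) := by
    have hflip : ∀ e, (fun t => γ e (1 - t)) '' Set.Icc 0 1 = γ e '' Set.Icc 0 1 := by
      intro e
      have : (fun t => γ e (1 - t)) = γ e ∘ (fun t => 1 - t) := rfl
      rw [this, Set.image_comp]
      simp
    have : ∀ e : A × B, ∃ c : ℝ → ℂ, Continuous c ∧ c 0 = S.pos (nd (.inl e.1)) ∧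
        c 1 = S.pos (nd (.inr e.2)) ∧ Set.InjOn c (Set.Icc 0 1) ∧
        c '' Set.Icc 0 1 = γ e '' Set.Icc 0 1 := by
      rintro ⟨a, b⟩
      rcases hv a b with ⟨h1, h2⟩ | ⟨h1, h2⟩
      · exact ⟨γ (a, b), g1 _, by rw [g2, h1], by rw [g3, h2], g4 _, rfl⟩
      · refine ⟨fun t => γ (a, b) (1 - t), (g1 _).comp (by fun_prop), ?_, ?_, ?_, hflip _⟩
        · simp [g3, h2]
        · simp [g2, h1]
        · intro t ht t' ht' h
          have := g4 (a, b) (x₁ := 1 - t) (x₂ := 1 - t') ⟨by linarith [ht.2], by linarith [ht.1]⟩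
            ⟨by linarith [ht'.2], by linarith [ht'.1]⟩ h
          linarith
    choose c c1 c2 c3 c4 c5 using this
    refine ⟨c, c1, c2, c3, c4, ?_, ?_⟩
    · intro e f h; rw [c5, c5]; exact g5 e f h
    · intro e w; rw [c5]; exact g6 e w
  have vmem : ∀ a b w, (∃ d, w = S.v (a, b) d) ↔ w = nd (.inl a) ∨ w = nd (.inr b) := by
    intro a b w
    rcases hv a b with ⟨h1, h2⟩ | ⟨h1, h2⟩
    · constructor
      · rintro ⟨d, rfl⟩; cases d
        · exact Or.inl h1
        · exact Or.inr h2
      · rintro (rfl | rfl)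
        · exact ⟨false, h1.symm⟩
        · exact ⟨true, h2.symm⟩
    · constructor
      · rintro ⟨d, rfl⟩; cases d
        · exact Or.inr h1
        · exact Or.inl h2
      · rintro (rfl | rfl)
        · exact ⟨true, h2.symm⟩
        · exact ⟨false, h1.symm⟩
  let φ : ℂ → ℝ × ℝ := Complex.equivRealProd
  have hφ : Function.Injective φ := Complex.equivRealProd.injective
  have hφc : Continuous φ := Complex.equivRealProdCLM.continuous
  let ar : A ⊕ B → A ⊕ B → ℝ → ℝ × ℝ := fun x y t =>
    match x, y with
    | .inl a, .inr b => φ (c (a, b) t)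
    | .inr b, .inl a => φ (c (a, b) (1 - t))
    | _, _ => 0
  have himg : ∀ a b, ar (.inr b) (.inl a) '' Set.Icc 0 1 = ar (.inl a) (.inr b) '' Set.Icc 0 1 := by
    intro a b
    have : ar (.inr b) (.inl a) = ar (.inl a) (.inr b) ∘ (fun t => 1 - t) := rfl
    rw [this, Set.image_comp]
    simp
  have havoid : ∀ a b x, x ≠ .inl a → x ≠ .inr b → φ (S.pos (nd x)) ∉ ar (.inl a) (.inr b) '' Set.Icc 0 1 := by
    rintro a b x h1 h2 ⟨t, ht, he⟩
    have := S.avoid _ _ (c6 (a, b) (nd x) ⟨t, ht, hφ he⟩)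
    rcases (vmem a b _).1 this with h | h
    · exact h1 (hnd h)
    · exact h2 (hnd h)
  let D : Drawing (completeBipartiteGraph A B) :=
    { pos := fun x => φ (S.pos (nd x))
      pos_inj := fun x y h => hnd (S.inj (hφ h))
      arc := ar
      arc_cont := by
        intro x y h
        rcases x with a | b <;> rcases y with a' | b' <;> simp at h
        · exact (hφc.comp (c1 _)).continuousOn
        · exact (hφc.comp ((c1 _).comp (by fun_prop))).continuousOn
      arc_zero := by
        intro x y h
        rcases x with a | b <;> rcases y with a' | b' <;> simp at h
        · simp [ar, c2]
        · simp [ar, c3]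
      arc_one := by
        intro x y h
        rcases x with a | b <;> rcases y with a' | b' <;> simp at h
        · simp [ar, c3]
        · simp [ar, c2]
      arc_symm := by
        intro x y h t
        rcases x with a | b <;> rcases y with a' | b' <;> simp at h
        · rfl
        · simp [ar]
      arc_avoid := by
        intro x y h z hx hy
        rcases x with a | b <;> rcases y with a' | b' <;> simp at h
        · exact havoid a b' z hx hy
        · rw [himg]; exact havoid a' b z hy hx }
  have hep : ∀ q p, p ∈ D.edgePoints (bed q) → ∃ t ∈ Set.Icc (0 : ℝ) 1, φ (c q t) = p := by
    rintro ⟨a, b⟩ p ⟨x, y, h, hadj, hp⟩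
    rcases Sym2.eq_iff.1 h with ⟨rfl, rfl⟩ | ⟨rfl, rfl⟩
    · exact hp
    · have hp' : p ∈ ar (.inl a) (.inr b) '' Set.Icc 0 1 := by
        rw [← himg]; exact hp
      exact hp'
  have hK : ∀ q r p, D.IsCrossing (bed q) (bed r) p → q ≠ r ∧ ∃ z, φ z = p ∧ z ∈ S.K q ∧ z ∈ S.K r := by
    intro q r p h
    have hqr : q ≠ r := fun h' => h.2.2.1 (by rw [h'])
    obtain ⟨t, ht, e1⟩ := hep q p h.2.2.2.1
    obtain ⟨t', ht', e2⟩ := hep r p h.2.2.2.2.1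
    have e3 := hφ (e1.trans e2.symm)
    have := c5 q r hqr ⟨⟨t, ht, rfl⟩, ⟨t', ht', e3.symm⟩⟩
    exact ⟨hqr, _, e1, this⟩
  have hnp : ∀ q r p, D.IsCrossing (bed q) (bed r) p → ∀ z, φ z = p → ∀ d, z ≠ S.pos (S.v q d) := by
    rintro ⟨a, b⟩ r p h z hz d rfl
    apply h.2.2.2.2.2.1
    rcases (vmem a b _).1 ⟨d, rfl⟩ with h' | h'
    · exact ⟨.inl a, by simp [bed], by rw [← hz, h']⟩
    · exact ⟨.inr b, by simp [bed], by rw [← hz, h']⟩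
  have hcr : ∀ q r p, D.IsCrossing (bed q) (bed r) p → S.Cross q r := by
    intro q r p h
    obtain ⟨hqr, z, hz, h1, h2⟩ := hK q r p h
    refine ⟨hqr, fun b c hbc => ?_, ⟨z, h1, h2⟩⟩
    exact hnp q r p h z hz b (S.adj q r b c hqr hbc ⟨h1, h2⟩)
  have good : D.IsGood := by
    refine ⟨?_, ?_, ?_, ?_⟩
    · intro x y h
      rcases x with a | b <;> rcases y with a' | b' <;> simp at h
      · exact fun t ht t' ht' h => c4 _ ht ht' (hφ h)
      · intro t ht t' ht' h
        have := c4 (a', b) (x₁ := 1 - t) (x₂ := 1 - t') ⟨by linarith [ht.2], by linarith [ht.1]⟩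
            ⟨by linarith [ht'.2], by linarith [ht'.1]⟩ (hφ h)
        linarith
    · rintro e f ⟨x, hxe, hxf⟩ p hp
      obtain ⟨q, rfl⟩ := bed_edge hp.1
      obtain ⟨r, rfl⟩ := bed_edge hp.2.1
      have hq : ∀ q : A × B, x ∈ bed q → ∃ d, nd x = S.v q d := by
        rintro ⟨a, b⟩ hx
        refine (vmem a b _).2 ?_
        simp only [bed, Sym2.mem_iff] at hx
        rcases hx with rfl | rfl
        · exact Or.inl rfl
        · exact Or.inr rfl
      obtain ⟨d, hd⟩ := hq q hxe
      obtain ⟨d', hd'⟩ := hq r hxf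
      exact (hcr q r p hp).2.1 d d' (hd.symm.trans hd')
    · intro e f p hp p' hp'
      obtain ⟨q, rfl⟩ := bed_edge hp.1
      obtain ⟨r, rfl⟩ := bed_edge hp.2.1
      obtain ⟨hqr, z, rfl, h1, h2⟩ := hK q r p hp
      obtain ⟨-, z', rfl, h1', h2'⟩ := hK q r p' hp'
      rw [S.once q r hqr (hcr q r _ hp).2.1 ⟨h1, h2⟩ ⟨h1', h2'⟩]
    · rintro p e f g hef heg hfg ⟨h1, h2, h3⟩
      obtain ⟨q, rfl⟩ := bed_edge h1.1
      obtain ⟨r, rfl⟩ := bed_edge h1.2.1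
      obtain ⟨s, rfl⟩ := bed_edge h2.2.1
      obtain ⟨hqr, z, hz, k1, k2⟩ := hK q r p h1
      obtain ⟨hqs, z', hz', k3, k4⟩ := hK q s p h3
      have := hφ (hz.trans hz'.symm)
      subst this
      have hrs : r ≠ s := fun h => hfg (by rw [h])
      obtain ⟨w, rfl⟩ := S.triple q r s hqr hqs hrs z k1 k2 k4
      obtain ⟨d, rfl⟩ := S.avoid q w k1
      exact hnp q r p h1 _ hz d rfl
  refine ⟨D, good, ?_⟩
  rw [two_crNum D good]
  have : ∀ x : xpairs D, ∃ q : {q : (A × B) × (A × B) // S.Cross q.1 q.2},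
      x.1 = (bed q.1.1, bed q.1.2) := by
    rintro ⟨⟨e, f⟩, p, hp⟩
    obtain ⟨q, rfl⟩ := bed_edge hp.1
    obtain ⟨r, rfl⟩ := bed_edge hp.2.1
    exact ⟨⟨(q, r), hcr q r p hp⟩, rfl⟩
  choose ψ hψ using this
  refine Nat.card_le_card_of_injective ψ ?_
  intro x y h
  apply Subtype.ext
  rw [hψ x, hψ y, h]

end realize
end CrK

namespace CrK
open Metric Filter Topology

section ofD
variable {V W E : Type*} {G : SimpleGraph V} (D : Drawing G)

lemma arc_img_symm {a b : V} (h : G.Adj a b) : D.arc b a '' Set.Icc 0 1 = D.arc a b '' Set.Icc 0 1 := by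
  have : D.arc b a = D.arc a b ∘ (fun t => 1 - t) := by
    funext t; exact D.arc_symm h t
  rw [this, Set.image_comp]
  simp

lemma edgePoints_eq {a b : V} (h : G.Adj a b) : D.edgePoints s(a, b) = D.arc a b '' Set.Icc 0 1 := by
  ext p
  constructor
  · rintro ⟨x, y, hxy, -, hp⟩
    rcases Sym2.eq_iff.1 hxy with ⟨rfl, rfl⟩ | ⟨rfl, rfl⟩
    · exact hp
    · rwa [arc_img_symm D h] at hp
  · intro hp; exact ⟨a, b, rfl, h, hp⟩

noncomputable def toC (p : ℝ × ℝ) : ℂ := Complex.equivRealProd.symm p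

lemma toC_inj : Function.Injective toC := Complex.equivRealProd.symm.injective

lemma toC_cont : Continuous toC := Complex.equivRealProdCLM.symm.continuous

variable {D}

/-- edge data for turning a drawing into a system -/
structure EdgeData (G : SimpleGraph V) (nd : W → V) (v : E → Bool → W) : Prop where
  nd_inj : Function.Injective nd
  adj : ∀ e, G.Adj (nd (v e false)) (nd (v e true))
  inj : ∀ e f, s(v e false, v e true) = s(v f false, v f true) → e = f

def EdgeData.ed (nd : W → V) (v : E → Bool → W) (e : E) : Sym2 V := s(nd (v e false), nd (v e true))

variable {nd : W → V} {v : E → Bool → W}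

lemma EdgeData.ed_inj (h : EdgeData G nd v) : Function.Injective (EdgeData.ed nd v) := by
  intro e f hef
  apply h.inj
  rcases Sym2.eq_iff.1 hef with ⟨h1, h2⟩ | ⟨h1, h2⟩
  · rw [h.nd_inj h1, h.nd_inj h2]
  · rw [h.nd_inj h1, h.nd_inj h2]; exact Sym2.eq_swap

lemma EdgeData.ne (h : EdgeData G nd v) (e : E) : v e false ≠ v e true :=
  fun h' => (h.adj e).ne (by rw [h'])

/-- two distinct edges share at most one vertex -/
lemma EdgeData.share (h : EdgeData G nd v) {e f : E} (hef : e ≠ f) {b c b' c' : Bool}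
    (h1 : v e b = v f c) (h2 : v e b' = v f c') : b = b' := by
  by_contra hb
  have hne := h.ne e
  have hc : c ≠ c' := by
    rintro rfl
    have := h1.trans h2.symm
    cases b <;> cases b' <;> simp_all
  apply hef
  apply h.inj
  cases b <;> cases b' <;> cases c <;> cases c' <;>
    first
      | exact absurd rfl hb
      | exact absurd rfl hc
      | exact Sym2.eq_iff.2 (Or.inl ⟨h1, h2⟩)
      | exact Sym2.eq_iff.2 (Or.inl ⟨h2, h1⟩)
      | exact Sym2.eq_iff.2 (Or.inr ⟨h1, h2⟩)
      | exact Sym2.eq_iff.2 (Or.inr ⟨h2, h1⟩)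

lemma EdgeData.mem_edge (h : EdgeData G nd v) (e : E) : EdgeData.ed nd v e ∈ G.edgeSet := h.adj e

lemma EdgeData.mem_ed {e : E} {x : V} (hx : x ∈ EdgeData.ed nd v e) : ∃ b, x = nd (v e b) := by
  rcases Sym2.mem_iff.1 hx with rfl | rfl
  · exact ⟨false, rfl⟩
  · exact ⟨true, rfl⟩

lemma EdgeData.ed_mem (e : E) (b : Bool) : nd (v e b) ∈ EdgeData.ed nd v e := by
  cases b
  · exact Sym2.mem_mk_left _ _
  · exact Sym2.mem_mk_right _ _

variable (D)

lemma EdgeData.avoid (h : EdgeData G nd v) {e : E} {x : V}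
    (hx : D.pos x ∈ D.edgePoints (EdgeData.ed nd v e)) : ∃ b, x = nd (v e b) := by
  rw [EdgeData.ed, edgePoints_eq D (h.adj e)] at hx
  by_contra hb
  push Not at hb
  exact D.arc_avoid (h.adj e) x (hb false) (hb true) hx

/-- a common point of two edges is a common end or a crossing -/
lemma EdgeData.dich (h : EdgeData G nd v) {e f : E} (hef : e ≠ f) {p : ℝ × ℝ}
    (h1 : p ∈ D.edgePoints (EdgeData.ed nd v e)) (h2 : p ∈ D.edgePoints (EdgeData.ed nd v f)) :
    (∃ b c, v e b = v f c ∧ p = D.pos (nd (v e b))) ∨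
      D.IsCrossing (EdgeData.ed nd v e) (EdgeData.ed nd v f) p := by
  by_cases hx : ∃ x, p = D.pos x
  · left
    obtain ⟨x, rfl⟩ := hx
    obtain ⟨b, rfl⟩ := h.avoid D h1
    obtain ⟨c, hc⟩ := h.avoid D h2
    exact ⟨b, c, h.nd_inj hc, rfl⟩
  · right
    refine ⟨h.mem_edge e, h.mem_edge f, fun h' => hef (h.ed_inj h'), h1, h2, ?_, ?_⟩
    · rintro ⟨a, -, ha⟩; exact hx ⟨a, ha⟩
    · rintro ⟨a, -, ha⟩; exact hx ⟨a, ha⟩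

noncomputable def ofDrawing (hD : D.IsGood) (h : EdgeData G nd v) : Sys W E where
  pos w := toC (D.pos (nd w))
  inj := fun _ _ hab => h.nd_inj (D.pos_inj (toC_inj hab))
  v := v
  ne := h.ne
  K e := toC '' D.edgePoints (EdgeData.ed nd v e)
  joined e := by
    rw [EdgeData.ed, edgePoints_eq D (h.adj e), ← D.arc_zero (h.adj e), ← D.arc_one (h.adj e)]
    have h1 : JoinedIn (Set.Icc (0 : ℝ) 1) 0 1 :=
      ((convex_Icc _ _).isPathConnected ⟨0, by simp⟩).joinedIn _ (by simp) _ (by simp)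
    exact (h1.map_continuousOn (D.arc_cont (h.adj e))).map toC_cont
  avoid e w hw := by
    obtain ⟨p, hp, hpw⟩ := hw
    rw [toC_inj hpw] at hp
    obtain ⟨b, hb⟩ := h.avoid D hp
    exact ⟨b, h.nd_inj hb⟩
  adj e f b c hef hbc := by
    rintro _ ⟨⟨p, hp, rfl⟩, ⟨p', hp', hpp⟩⟩
    rw [toC_inj hpp] at hp'
    rcases h.dich D hef hp hp' with ⟨b', c', h1, rfl⟩ | h1
    · rw [h.share hef hbc h1]; rfl
    · exfalso
      refine hD.adj_no_cross _ _ ⟨nd (v e b), EdgeData.ed_mem e b, ?_⟩ p h1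
      rw [hbc]; exact EdgeData.ed_mem f c
  once e f hef hs := by
    rintro _ ⟨⟨p, hp, rfl⟩, ⟨p', hp', hpp⟩⟩ _ ⟨⟨q, hq, rfl⟩, ⟨q', hq', hqq⟩⟩
    rw [toC_inj hpp] at hp'
    rw [toC_inj hqq] at hq'
    rcases h.dich D hef hp hp' with ⟨b', c', h1, rfl⟩ | h1
    · exact absurd h1 (hs _ _)
    rcases h.dich D hef hq hq' with ⟨b', c', h2, rfl⟩ | h2
    · exact absurd h2 (hs _ _)
    rw [hD.cross_once _ _ h1 h2]
  triple e f g hef heg hfg z hz hz' hz'' := by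
    obtain ⟨p, hp, rfl⟩ := hz
    obtain ⟨p', hp', h'⟩ := hz'
    obtain ⟨p'', hp'', h''⟩ := hz''
    rw [toC_inj h'] at hp'
    rw [toC_inj h''] at hp''
    rcases h.dich D hef hp hp' with ⟨b', c', -, rfl⟩ | h1
    · exact ⟨_, rfl⟩
    rcases h.dich D hfg hp' hp'' with ⟨b', c', -, rfl⟩ | h2
    · exact ⟨_, rfl⟩
    rcases h.dich D heg hp hp'' with ⟨b', c', -, rfl⟩ | h3
    · exact ⟨_, rfl⟩
    exact absurd ⟨h1, h2, h3⟩ (hD.no_triple p _ _ _ (fun h' => hef (h.ed_inj h'))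
      (fun h' => heg (h.ed_inj h')) (fun h' => hfg (h.ed_inj h')))

lemma ofDrawing_cross_iff (hD : D.IsGood) (h : EdgeData G nd v) (e f : E) :
    (ofDrawing D hD h).Cross e f ↔ (EdgeData.ed nd v e, EdgeData.ed nd v f) ∈ xpairs D := by
  constructor
  · rintro ⟨hef, hs, _, ⟨p, hp, rfl⟩, ⟨p', hp', hpp⟩⟩
    rw [toC_inj hpp] at hp'
    rcases h.dich D hef hp hp' with ⟨b', c', h1, rfl⟩ | h1
    · exact absurd h1 (hs _ _)
    · exact ⟨p, h1⟩
  · rintro ⟨p, hp⟩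
    refine ⟨fun h' => hp.2.2.1 (by rw [h']), fun b c hbc => ?_, toC p, ⟨p, hp.2.2.2.1, rfl⟩, ⟨p, hp.2.2.2.2.1, rfl⟩⟩
    refine hD.adj_no_cross _ _ ⟨nd (v e b), EdgeData.ed_mem e b, ?_⟩ p hp
    change v e b = v f c at hbc
    rw [hbc]; exact EdgeData.ed_mem f c

lemma ofDrawing_card [Finite V] (hD : D.IsGood) (h : EdgeData G nd v) :
    Nat.card {q : E × E // (ofDrawing D hD h).Cross q.1 q.2} ≤ 2 * D.crNum := by
  rw [two_crNum D hD]
  refine Nat.card_le_card_of_injective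
    (fun q => ⟨(EdgeData.ed nd v q.1.1, EdgeData.ed nd v q.1.2), (ofDrawing_cross_iff D hD h _ _).1 q.2⟩) ?_
  rintro ⟨⟨a, b⟩, hq⟩ ⟨⟨a', b'⟩, hq'⟩ hh
  simp only [Subtype.mk.injEq, Prod.mk.injEq] at hh
  exact Subtype.ext (Prod.ext (h.ed_inj hh.1) (h.ed_inj hh.2))

end ofD

section comap
variable {V V' : Type*} {G : SimpleGraph V} {G' : SimpleGraph V'} (D : Drawing G) (h : V' → V)
  (hi : Function.Injective h) (ha : ∀ a b, G'.Adj a b → G.Adj (h a) (h b))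

/-- restriction of a drawing -/
def comapD : Drawing G' where
  pos a := D.pos (h a)
  pos_inj := fun _ _ hab => hi (D.pos_inj hab)
  arc a b := D.arc (h a) (h b)
  arc_cont _ _ hab := D.arc_cont (ha _ _ hab)
  arc_zero _ _ hab := D.arc_zero (ha _ _ hab)
  arc_one _ _ hab := D.arc_one (ha _ _ hab)
  arc_symm _ _ hab := D.arc_symm (ha _ _ hab)
  arc_avoid _ _ hab c hc hc' := D.arc_avoid (ha _ _ hab) (h c) (fun e => hc (hi e)) (fun e => hc' (hi e))

lemma comapD_cross {e f : Sym2 V'} {p : ℝ × ℝ} (hc : (comapD D h hi ha).IsCrossing e f p) :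
    D.IsCrossing (e.map h) (f.map h) p := by
  have hE : ∀ e : Sym2 V', e ∈ G'.edgeSet → e.map h ∈ G.edgeSet := by
    intro e; induction e using Sym2.ind with | _ a b => exact ha a b
  have hP : ∀ e : Sym2 V', p ∈ (comapD D h hi ha).edgePoints e → p ∈ D.edgePoints (e.map h) := by
    rintro e ⟨a, b, rfl, hab, hp⟩
    exact ⟨h a, h b, rfl, ha _ _ hab, hp⟩
  have hN : ∀ e : Sym2 V', p ∉ (comapD D h hi ha).ends e → p ∉ D.ends (e.map h) := by
    rintro e hp ⟨x, hx, rfl⟩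
    obtain ⟨y, hy, rfl⟩ := Sym2.mem_map.1 hx
    exact hp ⟨y, hy, rfl⟩
  exact ⟨hE _ hc.1, hE _ hc.2.1, fun h' => hc.2.2.1 (Sym2.map.injective hi h'), hP _ hc.2.2.2.1,
    hP _ hc.2.2.2.2.1, hN _ hc.2.2.2.2.2.1, hN _ hc.2.2.2.2.2.2⟩

lemma comapD_good (hD : D.IsGood) : (comapD D h hi ha).IsGood where
  arc_inj _ _ hab := hD.arc_inj (ha _ _ hab)
  adj_no_cross := by
    rintro e f ⟨a, h1, h2⟩ p hp
    exact hD.adj_no_cross _ _ ⟨h a, Sym2.mem_map.2 ⟨a, h1, rfl⟩, Sym2.mem_map.2 ⟨a, h2, rfl⟩⟩ p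
      (comapD_cross D h hi ha hp)
  cross_once := by
    intro e f p hp q hq
    exact hD.cross_once _ _ (comapD_cross D h hi ha hp) (comapD_cross D h hi ha hq)
  no_triple := by
    rintro p e f g h1 h2 h3 ⟨c1, c2, c3⟩
    have hm := Sym2.map.injective hi
    exact hD.no_triple p _ _ _ (fun h' => h1 (hm h')) (fun h' => h2 (hm h')) (fun h' => h3 (hm h'))
      ⟨comapD_cross D h hi ha c1, comapD_cross D h hi ha c2, comapD_cross D h hi ha c3⟩

end comap

lemma crossingNumber_le {V : Type*} {G : SimpleGraph V} (D : Drawing G) (hD : D.IsGood) :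
    crossingNumber G ≤ D.crNum := Nat.sInf_le ⟨D, hD, rfl⟩

end CrK

namespace CrK

lemma exists_generic (V : Type*) [Finite V] : ∃ t : V → ℝ, Function.Injective t ∧
    ∀ a b c d e f : V, c ≠ a → c ≠ b → c ≠ d → e ≠ a → e ≠ b → e ≠ d → f ≠ a → f ≠ b → f ≠ d →
      (t c + t d - t a - t b) * (t e * t f - t a * t b)
        - (t e + t f - t a - t b) * (t c * t d - t a * t b) ≠ 0 := by
  classical
  have := Fintype.ofFinite V
  let X : V → MvPolynomial V ℝ := MvPolynomial.X
  let p : V × V → MvPolynomial V ℝ := fun q => if q.1 ≠ q.2 then X q.1 - X q.2 else 1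
  let P : (Fin 6 → V) → MvPolynomial V ℝ := fun q =>
    (X (q 2) + X (q 3) - X (q 0) - X (q 1)) * (X (q 4) * X (q 5) - X (q 0) * X (q 1))
        - (X (q 4) + X (q 5) - X (q 0) - X (q 1)) * (X (q 2) * X (q 3) - X (q 0) * X (q 1))
  let P' : (Fin 6 → V) → MvPolynomial V ℝ := fun q =>
    if q 2 ≠ q 0 ∧ q 2 ≠ q 1 ∧ q 2 ≠ q 3 ∧ q 4 ≠ q 0 ∧ q 4 ≠ q 1 ∧ q 4 ≠ q 3 ∧
       q 5 ≠ q 0 ∧ q 5 ≠ q 1 ∧ q 5 ≠ q 3 then P q else 1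
  have hp : ∀ q, p q ≠ 0 := by
    intro q h0
    simp only [p] at h0
    split_ifs at h0 with h
    · have := congrArg (MvPolynomial.eval (fun v => if v = q.1 then (1 : ℝ) else 0)) h0
      simp [X, h.symm] at this
    · exact one_ne_zero h0
  have hP : ∀ q, P' q ≠ 0 := by
    intro q h0
    simp only [P'] at h0
    split_ifs at h0 with h
    · obtain ⟨h1, h2, h3, h4, h5, h6, h7, h8, h9⟩ := h
      have := congrArg (MvPolynomial.eval
        (fun v => if v = q 2 ∨ v = q 4 ∨ v = q 5 then (1 : ℝ) else 0)) h0
      simp [P, X, h1.symm, h2.symm, h3.symm, h4.symm, h5.symm, h6.symm, h7.symm, h8.symm, h9.symm] at this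
    · exact one_ne_zero h0
  have hne : (∏ q, p q) * (∏ q, P' q) ≠ 0 :=
    mul_ne_zero (Finset.prod_ne_zero_iff.2 fun q _ => hp q) (Finset.prod_ne_zero_iff.2 fun q _ => hP q)
  obtain ⟨t, ht⟩ : ∃ t : V → ℝ, MvPolynomial.eval t ((∏ q, p q) * (∏ q, P' q)) ≠ 0 := by
    by_contra hcon
    push Not at hcon
    exact hne (MvPolynomial.funext fun t => by rw [hcon t, map_zero])
  rw [map_mul, map_prod, map_prod] at ht
  have h1 := Finset.prod_ne_zero_iff.1 (left_ne_zero_of_mul ht)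
  have h2 := Finset.prod_ne_zero_iff.1 (right_ne_zero_of_mul ht)
  refine ⟨t, fun a b hab => ?_, ?_⟩
  · by_contra h
    have := h1 (a, b) (Finset.mem_univ _)
    simp only [p, ne_eq, h, not_false_eq_true, if_true] at this
    simp [X, hab] at this
  · intro a b c d e f g1 g2 g3 g4 g5 g6 g7 g8 g9
    have := h2 ![a, b, c, d, e, f] (Finset.mem_univ _)
    have hc : P' ![a, b, c, d, e, f] = P ![a, b, c, d, e, f] := if_pos ⟨g1, g2, g3, g4, g5, g6, g7, g8, g9⟩
    rw [hc] at this
    simpa [P, X] using this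

section gd
variable {V : Type*} (G : SimpleGraph V) (t : V → ℝ)

def pp (a : V) : ℝ × ℝ := (t a, t a ^ 2)

def pl (a b : V) (s : ℝ) : ℝ × ℝ := ((1 - s) * t a + s * t b, (1 - s) * t a ^ 2 + s * t b ^ 2)

lemma pl_line (a b : V) (s : ℝ) : (pl t a b s).2 = (t a + t b) * (pl t a b s).1 - t a * t b := by
  simp only [pl]; ring

/-- straight line drawing on the parabola -/
def parD (ht : Function.Injective t) : Drawing G where
  pos := pp t
  pos_inj := fun a b h => ht (congrArg Prod.fst h)
  arc := pl t
  arc_cont := by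
    intro a b _
    apply Continuous.continuousOn
    unfold pl; fun_prop
  arc_zero := by intro a b _; simp [pl, pp]
  arc_one := by intro a b _; simp [pl, pp]
  arc_symm := by
    intro a b _ s
    simp only [pl, Prod.mk.injEq]
    constructor <;> ring
  arc_avoid := by
    rintro a b _ c hca hcb ⟨s, _, h⟩
    have := pl_line t a b s
    rw [h] at this
    simp only [pp] at this
    have h2 : (t c - t a) * (t c - t b) = 0 := by linarith [this, sq (t c)]
    rcases mul_eq_zero.1 h2 with h | h
    · exact hca (ht (sub_eq_zero.1 h))
    · exact hcb (ht (sub_eq_zero.1 h))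

lemma parD_line (ht : Function.Injective t) {a b : V} {p : ℝ × ℝ}
    (h : p ∈ (parD G t ht).edgePoints s(a, b)) : p.2 = (t a + t b) * p.1 - t a * t b := by
  obtain ⟨x, y, hxy, _, s, _, rfl⟩ := h
  have := pl_line t x y s
  rcases Sym2.eq_iff.1 hxy with ⟨rfl, rfl⟩ | ⟨rfl, rfl⟩
  · exact this
  · change (pl t b a s).2 = _ * (pl t b a s).1 - _
    rw [this]; ring

lemma parD_adj (ht : Function.Injective t) (e f : Sym2 V) (h : ∃ a, a ∈ e ∧ a ∈ f) (p) :
    ¬ (parD G t ht).IsCrossing e f p := by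
  obtain ⟨a, ⟨b, rfl⟩, ⟨c, rfl⟩⟩ := h
  rintro ⟨-, -, hne, h1, h2, h3, -⟩
  have l1 := parD_line G t ht h1
  have l2 := parD_line G t ht h2
  have hbc : b ≠ c := by rintro rfl; exact hne rfl
  have : (t b - t c) * (p.1 - t a) = 0 := by linear_combination l2 - l1
  rcases mul_eq_zero.1 this with h | h
  · exact hbc (ht (sub_eq_zero.1 h))
  · refine h3 ⟨a, Sym2.mem_mk_left _ _, ?_⟩
    have hx : p.1 = t a := sub_eq_zero.1 h
    refine Prod.ext hx ?_
    change p.2 = t a ^ 2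
    rw [l1, hx]; ring

lemma parD_disj (ht : Function.Injective t) {a b c d : V} {p}
    (h : (parD G t ht).IsCrossing s(a, b) s(c, d) p) : a ≠ c ∧ a ≠ d ∧ b ≠ c ∧ b ≠ d := by
  refine ⟨?_, ?_, ?_, ?_⟩ <;> rintro rfl <;> refine parD_adj G t ht _ _ ⟨?_, ?_, ?_⟩ _ h
  exacts [a, by simp, by simp, a, by simp, by simp, b, by simp, by simp, b, by simp, by simp]

theorem exists_good [Finite V] : ∃ D : Drawing G, D.IsGood := by
  obtain ⟨t, ht, hg⟩ := exists_generic V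
  refine ⟨parD G t ht, ?_, parD_adj G t ht, ?_, ?_⟩
  · intro a b hab s _ s' _ h
    have h1 : (1 - s) * t a + s * t b = (1 - s') * t a + s' * t b := congrArg Prod.fst h
    have h2 : (s - s') * (t b - t a) = 0 := by linear_combination h1
    rcases mul_eq_zero.1 h2 with h | h
    · exact sub_eq_zero.1 h
    · exact absurd (ht (sub_eq_zero.1 h)).symm hab.ne
  · intro e f p hp q hq
    induction e using Sym2.ind with | _ a b => ?_
    induction f using Sym2.ind with | _ c d => ?_
    obtain ⟨n1, n2, n3, n4⟩ := parD_disj G t ht hp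
    have l1 := parD_line G t ht hp.2.2.2.1
    have l2 := parD_line G t ht hp.2.2.2.2.1
    have l3 := parD_line G t ht hq.2.2.2.1
    have l4 := parD_line G t ht hq.2.2.2.2.1
    by_cases hs : t a + t b = t c + t d
    · have : (t a - t c) * (t a - t d) = 0 := by
        have h5 : t a * t b = t c * t d := by rw [hs] at l1; linarith
        linear_combination t a * hs - h5
      rcases mul_eq_zero.1 this with h | h
      · exact absurd (ht (sub_eq_zero.1 h)) n1
      · exact absurd (ht (sub_eq_zero.1 h)) n2
    · have hx : p.1 = q.1 := by
        have : (t a + t b - (t c + t d)) * (p.1 - q.1) = 0 := by linear_combination l2 - l1 + l3 - l4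
        rcases mul_eq_zero.1 this with h | h
        · exact absurd (sub_eq_zero.1 h) hs
        · exact sub_eq_zero.1 h
      exact Prod.ext hx (by rw [l1, l3, hx])
  · rintro p e f g - - - ⟨hp, hq, hr⟩
    induction e using Sym2.ind with | _ a b => ?_
    induction f using Sym2.ind with | _ c d => ?_
    induction g using Sym2.ind with | _ e f => ?_
    have hcd : c ≠ d := (hp.2.1 : G.Adj c d).ne
    obtain ⟨n1, n2, n3, n4⟩ := parD_disj G t ht hp
    obtain ⟨m1, m2, m3, m4⟩ := parD_disj G t ht hq
    obtain ⟨k1, k2, k3, k4⟩ := parD_disj G t ht hr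
    have l1 := parD_line G t ht hp.2.2.2.1
    have l2 := parD_line G t ht hp.2.2.2.2.1
    have l3 := parD_line G t ht hq.2.2.2.2.1
    refine hg a b c d e f n1.symm n3.symm hcd k1.symm k3.symm m3.symm k2.symm k4.symm m4.symm ?_
    linear_combination (t c + t d - t a - t b) * (l3 - l1) - (t e + t f - t a - t b) * (l2 - l1)

/-- an optimal good drawing -/
theorem exists_opt [Finite V] : ∃ D : Drawing G, D.IsGood ∧ D.crNum = crossingNumber G := by
  obtain ⟨D, hD⟩ := exists_good G
  exact Nat.sInf_mem (s := {n | ∃ D : Drawing G, D.IsGood ∧ D.crNum = n}) ⟨_, D, hD, rfl⟩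

end gd

end CrK

namespace CrK
open Metric Filter Topology

lemma split_real {ι : Type*} [Finite ι] (η : ι → ℝ) (hη : Function.Injective η) (B : Finset ι) (k : ℕ)
    (hk : 0 < k) (hB : B.card = 2 * k) : ∃ c, (∀ i, η i ≠ c) ∧ (B.filter (fun i => c < η i)).card = k ∧
      (∃ i, η i < c) := by
  classical
  let s := B.image η
  have hs : s.card = 2 * k := by rw [← hB]; exact Finset.card_image_of_injective _ hη
  let f := s.orderEmbOfFin hs
  have hlt : f ⟨k - 1, by omega⟩ < f ⟨k, by omega⟩ := f.lt_iff_lt.2 (by rw [Fin.mk_lt_mk]; omega)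
  obtain ⟨c, hc, hcn⟩ := (Set.Ioo_infinite hlt).exists_notMem_finite (Set.finite_range η)
  refine ⟨c, fun i h => hcn ⟨i, h⟩, ?_, ?_⟩
  · have h1 : (B.filter (fun i => c < η i)).image η = (Finset.Ici (⟨k, by omega⟩ : Fin (2 * k))).image f := by
      ext r
      simp only [Finset.mem_image, Finset.mem_filter, Finset.mem_Ici]
      constructor
      · rintro ⟨i, ⟨hi, hci⟩, rfl⟩
        have : η i ∈ Set.range f := by
          rw [Finset.range_orderEmbOfFin]; exact Finset.mem_coe.2 (Finset.mem_image_of_mem _ hi)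
        obtain ⟨j, hj⟩ := this
        refine ⟨j, ?_, hj⟩
        by_contra hjk
        have hjk' : j ≤ ⟨k - 1, by omega⟩ := by
          rw [Fin.le_def] at hjk ⊢; simp only at hjk ⊢; omega
        have := f.le_iff_le.2 hjk'
        rw [hj] at this
        linarith [hc.1]
      · rintro ⟨j, hj, rfl⟩
        have : f j ∈ s := Finset.orderEmbOfFin_mem s hs j
        obtain ⟨i, hi, hij⟩ := Finset.mem_image.1 this
        refine ⟨i, ⟨hi, ?_⟩, hij⟩
        rw [hij]; exact hc.2.trans_le (f.le_iff_le.2 hj)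
    rw [← Finset.card_image_of_injective _ hη, h1, Finset.card_image_of_injective _ f.injective,
      Fin.card_Ici]
    simp only; omega
  · have : f ⟨k - 1, by omega⟩ ∈ s := Finset.orderEmbOfFin_mem s hs _
    obtain ⟨i, hi, hij⟩ := Finset.mem_image.1 this
    exact ⟨i, by rw [hij]; exact hc.1⟩

theorem halve {ι : Type*} [Finite ι] (z : ι → ℂ) (hz : ∀ i, ‖z i‖ = 1) (hzi : Function.Injective z)
    (B : Finset ι) (k : ℕ) (hB : B.card = 2 * k) (b0 : ι) (hb0 : b0 ∈ B) :
    ∃ (κ : ℂ) (θ : ι → ℝ) (g : ℝ), ‖κ‖ = 1 ∧ (∀ i, κ * z i = Complex.exp (θ i * Complex.I)) ∧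
      (∀ i, θ i ∈ Set.Ioo (-Real.pi) Real.pi) ∧ g ∈ Set.Ioo (-Real.pi) Real.pi ∧ (∀ i, θ i ≠ g) ∧
      (B.filter (fun i => θ i < g)).card = k ∧ (B.filter (fun i => g < θ i)).card = k ∧
      θ b0 < g ∧ ∀ i, ¬ (θ b0 < θ i ∧ θ i < g) := by
  classical
  have hk : 0 < k := by
    have := Finset.card_pos.2 ⟨b0, hb0⟩
    omega
  have hz0 : ∀ i, z i ≠ 0 := fun i h => by have := hz i; simp [h] at this
  let η : ι → ℝ := fun i => Complex.arg (-z i / z b0)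
  have hexp : ∀ i, Complex.exp (η i * Complex.I) = -z i / z b0 := by
    intro i
    have := Complex.norm_mul_exp_arg_mul_I (-z i / z b0)
    rw [norm_div, norm_neg, hz, hz] at this
    simpa using this
  have hηi : Function.Injective η := by
    intro i j h
    have h1 := hexp i
    rw [h, hexp j] at h1
    have h2 := (div_left_inj' (hz0 b0)).1 h1
    exact (hzi (neg_injective h2)).symm
  have hη0 : η b0 = Real.pi := by
    simp only [η]
    rw [neg_div, div_self (hz0 b0), Complex.arg_neg_one]
  have hηI : ∀ i, -Real.pi < η i ∧ η i ≤ Real.pi := fun i => ⟨Complex.neg_pi_lt_arg _, Complex.arg_le_pi _⟩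
  obtain ⟨c, hcn, hcB, i0, hi0⟩ := split_real η hηi B k hk hB
  have hc1 : -Real.pi < c := (hηI i0).1.trans hi0
  have hc2 : c < Real.pi := by
    obtain ⟨i, hi⟩ := Finset.card_pos.1 (hcB.symm ▸ hk)
    exact (Finset.mem_filter.1 hi).2.trans_le (hηI i).2
  let θ : ι → ℝ := fun i => if η i < c then η i + Real.pi - c else η i - c - Real.pi
  have hθ1 : ∀ i, η i < c → θ i = η i + Real.pi - c := fun i h => if_pos h
  have hθ2 : ∀ i, ¬ η i < c → θ i = η i - c - Real.pi := fun i h => if_neg h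
  have hθ0 : θ b0 = -c := by rw [hθ2 b0 (by rw [hη0]; exact not_lt.2 hc2.le), hη0]; ring
  have hside : ∀ i, (η i < c ∧ -c < θ i) ∨ (c < η i ∧ θ i ≤ -c) := by
    intro i
    by_cases h : η i < c
    · left; refine ⟨h, ?_⟩; rw [hθ1 i h]; linarith [hηI i]
    · right; refine ⟨lt_of_le_of_ne (not_lt.1 h) (hcn i).symm, ?_⟩; rw [hθ2 i h]; linarith [hηI i]
  have hev : ∀ᶠ g in 𝓝[>] (-c), (∀ i, -c < θ i → g < θ i) ∧ g < Real.pi ∧ -c < g := by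
    refine ((eventually_all.2 fun i => ?_).and (Eventually.and ?_ self_mem_nhdsWithin))
    · by_cases h : -c < θ i
      · filter_upwards [nhdsWithin_le_nhds (Iio_mem_nhds h)] with g hg _ using hg
      · exact Eventually.of_forall fun g h' => absurd h' h
    · exact nhdsWithin_le_nhds (Iio_mem_nhds (by linarith))
  obtain ⟨g, hg1, hg2, hg3⟩ := hev.exists
  have hs2 : ∀ i, (η i < c ∧ g < θ i) ∨ (c < η i ∧ θ i ≤ -c ∧ θ i < g) := by
    intro i
    rcases hside i with h | h
    · exact Or.inl ⟨h.1, hg1 i h.2⟩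
    · exact Or.inr ⟨h.1, h.2, h.2.trans_lt hg3⟩
  have hlt : ∀ i, θ i < g ↔ c < η i := by
    intro i
    rcases hs2 i with h | h
    · exact ⟨fun h' => absurd h' h.2.not_gt, fun h' => absurd h' h.1.not_gt⟩
    · exact ⟨fun _ => h.1, fun _ => h.2.2⟩
  have hne : ∀ i, θ i ≠ g := by
    intro i
    rcases hs2 i with h | h
    · exact h.2.ne'
    · exact h.2.2.ne
  have hf1 : (B.filter (fun i => θ i < g)).card = k := by
    rw [← hcB]; congr 1; ext i; simp only [hlt]
  refine ⟨Complex.exp (-c * Complex.I) / z b0, θ, g, ?_, ?_, ?_, ⟨by linarith, hg2⟩, hne, hf1, ?_,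
    by rw [hθ0]; exact hg3, ?_⟩
  · rw [norm_div, hz]
    have := Complex.norm_exp_ofReal_mul_I (-c)
    push_cast at this
    rw [this, div_one]
  · intro i
    have h1 : Complex.exp (-c * Complex.I) / z b0 * z i =
        Complex.exp (-c * Complex.I) * -Complex.exp (η i * Complex.I) := by
      rw [hexp i]; field_simp
    rw [h1]
    by_cases h : η i < c
    · rw [hθ1 i h]
      have : ((η i + Real.pi - c : ℝ) : ℂ) * Complex.I = -c * Complex.I + η i * Complex.I + Real.pi * Complex.I := by
        push_cast; ring
      rw [this, Complex.exp_add, Complex.exp_add, Complex.exp_pi_mul_I]; ring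
    · rw [hθ2 i h]
      have : ((η i - c - Real.pi : ℝ) : ℂ) * Complex.I = -c * Complex.I + η i * Complex.I - Real.pi * Complex.I := by
        push_cast; ring
      rw [this, Complex.exp_sub, Complex.exp_add, Complex.exp_pi_mul_I]; ring
  · intro i
    by_cases h : η i < c
    · rw [hθ1 i h]; constructor <;> linarith [hηI i]
    · have : c < η i := lt_of_le_of_ne (not_lt.1 h) (hcn i).symm
      rw [hθ2 i h]; constructor <;> linarith [hηI i]
  · have := Finset.card_filter_add_card_filter_not (s := B) (fun i => θ i < g)
    have h2 : B.filter (fun i => ¬ θ i < g) = B.filter (fun i => g < θ i) := by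
      ext i; simp only [Finset.mem_filter, and_congr_right_iff]
      intro _
      exact ⟨fun h => lt_of_le_of_ne (not_lt.1 h) (hne i).symm, fun h => h.not_gt⟩
    rw [h2] at this; omega
  · rintro i ⟨h1, h2⟩
    rw [hθ0] at h1
    rcases hs2 i with h | h
    · exact absurd h.2 h2.not_gt
    · exact absurd h.2.1 h1.not_ge

/-- sign of a strand at an end -/
def sg (b : Bool) (k : SignType) : SignType := if b then -k else k

lemma sg_inj {b : Bool} {k l : SignType} (h : sg b k = sg b l) : k = l := by
  cases b
  · simpa [sg] using h
  · simpa [sg] using h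

lemma sgn_abs (k : SignType) : |(k : ℝ)| ≤ 1 := by rcases k <;> simp

theorem surg_exists {W E : Type*} [Finite W] [Finite E] (S : Sys W E) :
    ∃ u : E → Bool → ℂ, (∀ e b, ‖u e b‖ = 1) ∧
      (∀ e b f c, (e, b) ≠ (f, c) → S.v e b = S.v f c → u e b ≠ u f c) ∧
    ∀ (κ : W → ℂ) (θ : E → Bool → ℝ) (g : W → ℝ), (∀ w, ‖κ w‖ = 1) →
      (∀ e b, κ (S.v e b) * u e b = Complex.exp (θ e b * Complex.I)) →
      (∀ e b, θ e b ∈ Set.Ioo (-Real.pi) Real.pi) → (∀ w, g w ∈ Set.Ioo (-Real.pi) Real.pi) →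
      (∀ e b, θ e b ≠ g (S.v e b)) →
      ∃ δ : ℝ, 0 < δ ∧ (∀ e b, 2 * δ < |θ e b - g (S.v e b)|) ∧
        (∀ e b f c, (e, b) ≠ (f, c) → S.v e b = S.v f c → 2 * δ < |θ e b - θ f c|) ∧
        ∀ lev : E → SignType → Bool → Fin 3, ∃ Q : Surg S, Q.lev = lev ∧ Q.g = g ∧
          ∀ e b k, Q.ang e b k = θ e b + δ * ((sg b k : SignType) : ℝ) := by
  obtain ⟨ρ, hρ, u, hu, hud, hsep, hev⟩ := tubeSys S
  refine ⟨u, hu, hud, fun κ θ g hκ hκθ hθ hg hne => ?_⟩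
  have small : ∀ r : ℝ, 0 < r → ∀ᶠ δ in 𝓝[>] (0 : ℝ), 2 * δ < r := by
    intro r hr
    filter_upwards [nhdsWithin_le_nhds (Iio_mem_nhds (half_pos hr))] with δ hδ
    have : δ < r / 2 := hδ
    linarith
  have hθd : ∀ e b f c, (e, b) ≠ (f, c) → S.v e b = S.v f c → θ e b ≠ θ f c := by
    intro e b f c h1 h2 h3
    have e1 := hκθ e b
    rw [h3, ← hκθ f c, h2] at e1
    have hk0 : κ (S.v f c) ≠ 0 := fun h => by have := hκ (S.v f c); simp [h] at this
    exact hud e b f c h1 h2 (mul_left_cancel₀ hk0 e1)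
  have e1 : ∀ᶠ δ in 𝓝[>] (0 : ℝ), ∀ e b, 2 * δ < |θ e b - g (S.v e b)| :=
    eventually_all.2 fun e => eventually_all.2 fun b => small _ (abs_pos.2 (sub_ne_zero.2 (hne e b)))
  have e2 : ∀ᶠ δ in 𝓝[>] (0 : ℝ), ∀ e b f c, (e, b) ≠ (f, c) → S.v e b = S.v f c →
      2 * δ < |θ e b - θ f c| := by
    refine eventually_all.2 fun e => eventually_all.2 fun b => eventually_all.2 fun f =>
      eventually_all.2 fun c => ?_
    by_cases h : (e, b) ≠ (f, c) ∧ S.v e b = S.v f c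
    · filter_upwards [small _ (abs_pos.2 (sub_ne_zero.2 (hθd e b f c h.1 h.2)))] with δ hδ _ _ using hδ
    · exact Eventually.of_forall fun δ h1 h2 => absurd ⟨h1, h2⟩ h
  have e3 : ∀ᶠ δ in 𝓝[>] (0 : ℝ), ∀ e b, 2 * δ < Real.pi - θ e b ∧ 2 * δ < θ e b + Real.pi :=
    eventually_all.2 fun e => eventually_all.2 fun b =>
      (small _ (by linarith [(hθ e b).2])).and (small _ (by linarith [(hθ e b).1]))
  obtain ⟨δ, ⟨T, hT⟩, h1, h2, h3, h0⟩ :=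
    (hev.and (e1.and (e2.and (e3.and self_mem_nhdsWithin)))).exists
  have h0 : 0 < δ := h0
  have hs : ∀ k : SignType, -δ ≤ δ * (k : ℝ) ∧ δ * (k : ℝ) ≤ δ := by
    intro k
    have := abs_le.1 (sgn_abs k)
    constructor <;> nlinarith
  refine ⟨δ, h0, h1, h2, fun lev => ⟨⟨ρ, hρ, u, δ, T, hT, hsep, κ, hκ, g, hg,
    fun e b k => θ e b + δ * ((sg b k : SignType) : ℝ), ?_, ?_, ?_, ?_, lev⟩, rfl, rfl, fun _ _ _ => rfl⟩⟩
  · intro e b k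
    have hk0 : κ (S.v e b) ≠ 0 := fun h => by have := hκ (S.v e b); simp [h] at this
    have : ((θ e b + δ * ((sg b k : SignType) : ℝ) : ℝ) : ℂ) * Complex.I =
        θ e b * Complex.I + ((δ * ((sg b k : SignType) : ℝ) : ℝ) : ℂ) * Complex.I := by
      push_cast; ring
    simp only [chart]
    rw [this, Complex.exp_add, ← hκθ e b]
    change _ + _ * wr δ (sg b k) = _ + _ * (_ * (_ * wr δ (sg b k)))
    norm_num
    field_simp
  · intro e b k
    have := hs (sg b k); have := h3 e b
    constructor <;> linarith
  · intro e b k h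
    have hh := h1 e b
    have := hs (sg b k)
    have hx : θ e b - g (S.v e b) = -(δ * ((sg b k : SignType) : ℝ)) := by linarith
    rw [hx] at hh
    rw [abs_neg] at hh
    have := abs_le.2 this
    linarith
  · intro e b k f c l hv h
    by_cases hef : (e, b) = (f, c)
    · obtain ⟨rfl, rfl⟩ := Prod.mk.inj hef
      refine ⟨rfl, rfl, sg_inj (b := b) (sign_inj (mul_left_cancel₀ h0.ne' (add_left_cancel h)))⟩
    · exfalso
      have hh := h2 e b f c hef hv
      have a1 := hs (sg b k)
      have a2 := hs (sg c l)
      have : |θ e b - θ f c| ≤ 2 * δ := abs_le.2 ⟨by linarith, by linarith⟩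
      linarith

end CrK

namespace CrK

/-- transfer of a bound to the standard bipartite graph -/
lemma bip_le {A B W : Type*} [Fintype A] [Fintype B] [Finite W] {a b : ℕ} (hA : Fintype.card A = a)
    (hB : Fintype.card B = b) (S : Sys W (A × B)) (nd : A ⊕ B → W) (hnd : Function.Injective nd)
    (hv : ∀ a b, (S.v (a, b) false = nd (.inl a) ∧ S.v (a, b) true = nd (.inr b)) ∨
      (S.v (a, b) false = nd (.inr b) ∧ S.v (a, b) true = nd (.inl a))) :
    2 * crossingNumber (bipK a b) ≤ Nat.card {q : (A × B) × (A × B) // S.Cross q.1 q.2} := by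
  obtain ⟨D, hD, hc⟩ := realize S nd hnd hv
  refine le_trans ?_ hc
  let h : Fin a ⊕ Fin b → A ⊕ B := Sum.map (Fintype.equivFinOfCardEq hA).symm (Fintype.equivFinOfCardEq hB).symm
  have hi : Function.Injective h := Function.Injective.sumMap (Equiv.injective _) (Equiv.injective _)
  have ha : ∀ p q, (bipK a b).Adj p q → (completeBipartiteGraph A B).Adj (h p) (h q) := by
    rintro (p | p) (q | q) hpq <;> simp_all [h]
  have h1 := crossingNumber_le _ (comapD_good D h hi ha hD)
  have h2 : 2 * (comapD D h hi ha).crNum ≤ 2 * D.crNum := by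
    rw [two_crNum _ (comapD_good D h hi ha hD), two_crNum D hD]
    have hfin : Finite (xpairs D) := inferInstance
    refine Nat.card_le_card_of_injective
      (fun q => (⟨(q.1.1.map h, q.1.2.map h), q.2.imp fun p hp => comapD_cross D h hi ha hp⟩ : xpairs D)) ?_
    rintro ⟨⟨x, y⟩, hq⟩ ⟨⟨x', y'⟩, hq'⟩ hh
    have hh := Prod.mk.inj (congrArg Subtype.val hh)
    exact Subtype.ext (Prod.ext (Sym2.map.injective hi hh.1) (Sym2.map.injective hi hh.2))
  omega

section
variable {W E : Type*} {S : Sys W E} (Q : Surg S)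

/-- strand `s` passes above strand `s'` at a common vertex -/
def Surg.Lo (s s' : E × SignType) : Prop := ∃ b c, S.v s.1 b = S.v s'.1 c ∧
  Q.lev s'.1 s'.2 c < Q.lev s.1 s.2 b ∧
  Btw (Q.g (S.v s.1 b)) (Q.ang s'.1 c s'.2) (Q.ang s.1 b s.2)

lemma Surg.lo_of_LXs {e k b f l c} (h : Q.LXs e k b f l c) : Q.Lo (e, k) (f, l) ∨ Q.Lo (f, l) (e, k) := by
  obtain ⟨h1, ⟨h2, h3⟩ | ⟨h2, h3⟩⟩ := h
  · exact Or.inl ⟨b, c, h1, h2, h3⟩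
  · exact Or.inr ⟨c, b, h1.symm, h2, h1 ▸ h3⟩

open Classical in
/-- local pairs -/
noncomputable def Surg.loF (U : Finset (E × SignType)) : Finset ((E × SignType) × (E × SignType)) :=
  (U ×ˢ U).filter fun q => Q.Lo q.1 q.2

open Classical in
/-- ordered pairs of crossing edges -/
noncomputable def crF [Fintype E] (S : Sys W E) : Finset (E × E) :=
  Finset.univ.filter fun q => S.Cross q.1 q.2

lemma crF_card [Fintype E] : (crF S).card = Nat.card {q : E × E // S.Cross q.1 q.2} := by
  classical
  rw [crF, Nat.card_eq_fintype_card, Fintype.card_subtype]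

open Classical in
noncomputable def mulU (U : Finset (E × SignType)) (e : E) : ℕ :=
  (Finset.univ.filter fun k => (e, k) ∈ U).card

theorem new_count [Fintype E] {F : Type*} (rep : F → Surg.R W E) (hrep : Function.Injective rep)
    (hcl : ∀ f f', Q.Clean (rep f) (rep f')) (U : Finset (E × SignType))
    (hU : ∀ f s, rep f = .inl s → s ∈ U) :
    Nat.card {q : F × F // (Q.newSys rep hrep hcl).Cross q.1 q.2} ≤
      ∑ q ∈ crF S, mulU U q.1 * mulU U q.2 + 2 * (Q.loF U).card := by
  classical
  let C : Finset ((E × SignType) × (E × SignType)) := (U ×ˢ U).filter fun q => S.Cross q.1.1 q.2.1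
  let Z : Finset ((E × SignType) × (E × SignType)) := C ∪ (Q.loF U ∪ (Q.loF U).image Prod.swap)
  have hex : ∀ q : {q : F × F // (Q.newSys rep hrep hcl).Cross q.1 q.2}, ∃ z : Z,
      rep q.1.1 = .inl z.1.1 ∧ rep q.1.2 = .inl z.1.2 := by
    rintro ⟨⟨f, f'⟩, hq⟩
    obtain ⟨s, s', h1, h2, h3⟩ := Q.newSys_cross rep hrep hcl hq
    refine ⟨⟨(s, s'), ?_⟩, h1, h2⟩
    have hs := hU f s h1
    have hs' := hU f' s' h2
    rcases h3 with h3 | ⟨b, c, h3⟩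
    · exact Finset.mem_union_left _ (Finset.mem_filter.2 ⟨Finset.mem_product.2 ⟨hs, hs'⟩, h3⟩)
    · refine Finset.mem_union_right _ ?_
      rcases Q.lo_of_LXs h3 with h | h
      · exact Finset.mem_union_left _ (Finset.mem_filter.2 ⟨Finset.mem_product.2 ⟨hs, hs'⟩, h⟩)
      · exact Finset.mem_union_right _ (Finset.mem_image.2 ⟨(s', s),
          Finset.mem_filter.2 ⟨Finset.mem_product.2 ⟨hs', hs⟩, h⟩, rfl⟩)
  choose z hz1 hz2 using hex
  have hcard : Nat.card {q : F × F // (Q.newSys rep hrep hcl).Cross q.1 q.2} ≤ Z.card := by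
    rw [← Nat.card_eq_finsetCard Z]
    refine Nat.card_le_card_of_injective z ?_
    intro q q' h
    apply Subtype.ext
    apply Prod.ext
    · apply hrep; rw [hz1 q, hz1 q', h]
    · apply hrep; rw [hz2 q, hz2 q', h]
  have hC : C.card ≤ ∑ q ∈ crF S, mulU U q.1 * mulU U q.2 := by
    rw [Finset.card_eq_sum_card_fiberwise (f := fun q => (q.1.1, q.2.1)) (t := crF S)]
    · refine Finset.sum_le_sum fun q _ => ?_
      rw [mulU, mulU, ← Finset.card_product]
      refine Finset.card_le_card_of_injOn (fun s => (s.1.2, s.2.2)) ?_ ?_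
      · rintro ⟨⟨e, k⟩, ⟨f, l⟩⟩ hs
        simp only [C, Finset.coe_filter, Finset.mem_filter, Finset.mem_product, Set.mem_ofPred_eq] at hs
        obtain ⟨⟨⟨h1, h2⟩, -⟩, rfl⟩ := hs
        simp [h1, h2]
      · rintro ⟨⟨e, k⟩, ⟨f, l⟩⟩ hs ⟨⟨e', k'⟩, ⟨f', l'⟩⟩ hs' hh
        simp only [C, Finset.coe_filter, Finset.mem_filter, Finset.mem_product, Set.mem_ofPred_eq] at hs hs'
        obtain ⟨-, rfl⟩ := hs
        obtain ⟨-, h⟩ := hs'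
        simp only [Prod.mk.injEq] at h hh
        simp [h, hh]
    · intro q hq
      have := (Finset.mem_filter.1 hq).2
      exact Finset.mem_filter.2 ⟨Finset.mem_univ _, this⟩
  have h1 : Z.card ≤ C.card + ((Q.loF U).card + ((Q.loF U).image Prod.swap).card) :=
    (Finset.card_union_le _ _).trans (Nat.add_le_add_left (Finset.card_union_le _ _) _)
  have h2 : ((Q.loF U).image Prod.swap).card ≤ (Q.loF U).card := Finset.card_image_le
  omega

end

end CrK

namespace CrK

lemma frame {W E T : Type*} [Finite E] [Fintype T] (S : Sys W E) (u : E → Bool → ℂ) (hu : ∀ e b, ‖u e b‖ = 1)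
    (hud : ∀ e b f c, (e, b) ≠ (f, c) → S.v e b = S.v f c → u e b ≠ u f c) (w : W)
    (f : T → E × Bool) (hf : Function.Injective f) (hw : ∀ t, S.v (f t).1 (f t).2 = w) (k : ℕ)
    (hT : Fintype.card T = 2 * k) (t0 : T) :
    ∃ (κ : ℂ) (θ : E → Bool → ℝ) (g : ℝ), ‖κ‖ = 1 ∧ g ∈ Set.Ioo (-Real.pi) Real.pi ∧
      (∀ e b, S.v e b = w → κ * u e b = Complex.exp (θ e b * Complex.I) ∧
        θ e b ∈ Set.Ioo (-Real.pi) Real.pi ∧ θ e b ≠ g) ∧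
      (Finset.univ.filter (fun t => θ (f t).1 (f t).2 < g)).card = k ∧
      (Finset.univ.filter (fun t => g < θ (f t).1 (f t).2)).card = k ∧
      θ (f t0).1 (f t0).2 < g ∧ ∀ t, ¬ (θ (f t0).1 (f t0).2 < θ (f t).1 (f t).2 ∧ θ (f t).1 (f t).2 < g) := by
  classical
  let ι := {q : E × Bool // S.v q.1 q.2 = w}
  let f' : T → ι := fun t => ⟨f t, hw t⟩
  have hf' : Function.Injective f' := fun a b h => hf (congrArg Subtype.val h)
  obtain ⟨κ, θ, g, h1, h2, h3, h4, h5, h6, h7, h8, h9⟩ := halve (fun q : ι => u q.1.1 q.1.2)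
    (fun q => hu _ _) (by
      intro q q' h
      by_contra hne
      exact hud q.1.1 q.1.2 q'.1.1 q'.1.2 (fun h' => hne (Subtype.ext h')) (q.2.trans q'.2.symm) h)
    (Finset.univ.image f') k (by rw [Finset.card_image_of_injective _ hf', ← hT]; rfl) (f' t0)
    (Finset.mem_image_of_mem _ (Finset.mem_univ _))
  let θ' : E → Bool → ℝ := fun e b => if h : S.v e b = w then θ ⟨(e, b), h⟩ else 0
  have hθ : ∀ e b (h : S.v e b = w), θ' e b = θ ⟨(e, b), h⟩ := fun e b h => dif_pos h
  have hθf : ∀ t, θ' (f t).1 (f t).2 = θ (f' t) := fun t => hθ _ _ (hw t)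
  refine ⟨κ, θ', g, h1, h4, ?_, ?_, ?_, ?_, ?_⟩
  · intro e b h
    rw [hθ e b h]
    exact ⟨h2 ⟨(e, b), h⟩, h3 _, h5 _⟩
  · rw [Finset.filter_image, Finset.card_image_of_injective _ hf'] at h6
    simpa only [hθf] using h6
  · rw [Finset.filter_image, Finset.card_image_of_injective _ hf'] at h7
    simpa only [hθf] using h7
  · rw [hθf]; exact h8
  · intro t; rw [hθf, hθf]; exact h9 _

/-- vertices of the source graph -/
inductive SV (m n : ℕ)
  | z (s : Bool)
  | a (i : Fin m)
  | b (j : Fin n)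

/-- edges of the source graph -/
inductive SE (m n : ℕ)
  | xy
  | za (s : Bool) (i : Fin m)
  | zb (s : Bool) (j : Fin n)
  | ab (i : Fin m) (j : Fin n)

variable {m n : ℕ}

def SV.code : SV m n → Bool ⊕ Fin m ⊕ Fin n
  | .z s => .inl s
  | .a i => .inr (.inl i)
  | .b j => .inr (.inr j)

lemma SV.code_inj : Function.Injective (SV.code (m := m) (n := n)) := by
  rintro (s | i | j) (s' | i' | j') h <;> simp_all [SV.code]

instance : Finite (SV m n) := Finite.of_injective _ SV.code_inj

def SE.code : SE m n → Unit ⊕ (Bool × Fin m) ⊕ (Bool × Fin n) ⊕ (Fin m × Fin n)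
  | .xy => .inl ()
  | .za s i => .inr (.inl (s, i))
  | .zb s j => .inr (.inr (.inl (s, j)))
  | .ab i j => .inr (.inr (.inr (i, j)))

lemma SE.code_inj : Function.Injective (SE.code (m := m) (n := n)) := by
  rintro (_ | ⟨s, i⟩ | ⟨s, j⟩ | ⟨i, j⟩) (_ | ⟨s', i'⟩ | ⟨s', j'⟩ | ⟨i', j'⟩) h <;> simp_all [SE.code]

noncomputable instance : Fintype (SE m n) := Fintype.ofInjective _ SE.code_inj

def sv : SE m n → Bool → SV m n
  | .xy, b => .z b
  | .za s i, b => if b then .a i else .z s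
  | .zb s j, b => if b then .b j else .z s
  | .ab i j, b => if b then .b j else .a i

/-- edges joining `z s` to the part `N` or to the other special vertex -/
def eB (s : Bool) : Option (Fin n) → SE m n
  | none => .xy
  | some j => .zb s j

def eb (s : Bool) : Option (Fin n) → Bool
  | none => s
  | some _ => false

lemma sv_eB (s : Bool) (β : Option (Fin n)) : sv (eB (m := m) s β) (eb s β) = .z s := by
  cases β <;> simp [eB, eb, sv]

lemma eB_inj (s : Bool) : Function.Injective (eB (m := m) (n := n) s) := by
  intro β β' h
  cases β <;> cases β' <;> simp_all [eB]

lemma sv_z {e : SE m n} {b s : Bool} (h : sv e b = .z s) :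
    (∃ i, e = .za s i ∧ b = false) ∨ ∃ β, e = eB s β ∧ b = eb s β := by
  rcases e with _ | ⟨s', i⟩ | ⟨s', j⟩ | ⟨i, j⟩
  · right; refine ⟨none, rfl, ?_⟩; simpa [sv, eb] using h
  · left; refine ⟨i, ?_⟩; cases b <;> simp_all [sv]
  · right; refine ⟨some j, ?_⟩; cases b <;> simp_all [sv, eb, eB]
  · cases b <;> simp [sv] at h

variable (θ : SE m n → Bool → ℝ)

def tB (s : Bool) (β : Option (Fin n)) : ℝ := θ (eB s β) (eb s β)

def tA (s : Bool) (i : Fin m) : ℝ := θ (.za s i) false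

structure Half (s : Bool) (g : ℝ) (k : ℕ) : Prop where
  lo : (Finset.univ.filter (fun β => tB θ s β < g)).card = k
  hi : (Finset.univ.filter (fun β => g < tB θ s β)).card = k
  lt : tB θ s none < g
  btw : ∀ β, ¬ (tB θ s none < tB θ s β ∧ tB θ s β < g)

/-- all angles at once -/
theorem frames (S : Sys (SV m n) (SE m n)) (hS : S.v = sv) (k : ℕ) (hk : n + 1 = 2 * k) (u : SE m n → Bool → ℂ)
    (hu : ∀ e b, ‖u e b‖ = 1)
    (hud : ∀ e b f c, (e, b) ≠ (f, c) → S.v e b = S.v f c → u e b ≠ u f c) :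
    ∃ (κ : SV m n → ℂ) (θ : SE m n → Bool → ℝ) (g : SV m n → ℝ), (∀ w, ‖κ w‖ = 1) ∧
      (∀ e b, κ (S.v e b) * u e b = Complex.exp (θ e b * Complex.I)) ∧
      (∀ e b, θ e b ∈ Set.Ioo (-Real.pi) Real.pi) ∧ (∀ w, g w ∈ Set.Ioo (-Real.pi) Real.pi) ∧
      (∀ e b, θ e b ≠ g (S.v e b)) ∧ ∀ s, Half θ s (g (.z s)) k := by
  have key : ∀ w : SV m n, ∃ (κ : ℂ) (θ : SE m n → Bool → ℝ) (g : ℝ), ‖κ‖ = 1 ∧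
      g ∈ Set.Ioo (-Real.pi) Real.pi ∧
      (∀ e b, S.v e b = w → κ * u e b = Complex.exp (θ e b * Complex.I) ∧
        θ e b ∈ Set.Ioo (-Real.pi) Real.pi ∧ θ e b ≠ g) ∧ ∀ s, w = .z s → Half θ s g k := by
    rintro (s | i | j)
    · obtain ⟨κ, θ, g, h1, h2, h3, h4, h5, h6, h7⟩ := frame S u hu hud (.z s)
        (fun β : Option (Fin n) => (eB s β, eb s β)) (fun β β' h => eB_inj s (congrArg Prod.fst h))
        (fun β => by rw [hS]; exact sv_eB s β) k (by simp [hk]) none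
      refine ⟨κ, θ, g, h1, h2, h3, ?_⟩
      rintro s' h
      obtain rfl : s = s' := by simpa using h
      exact ⟨h4, h5, h6, h7⟩
    · obtain ⟨κ, θ, g, h1, h2, h3, -⟩ := frame S u hu hud (.a i)
        (fun s : Bool => (.za s i, true)) (fun β β' h => by simpa using h)
        (fun β => by rw [hS]; rfl) 1 (by simp) true
      exact ⟨κ, θ, g, h1, h2, h3, fun s h => by simp at h⟩
    · obtain ⟨κ, θ, g, h1, h2, h3, -⟩ := frame S u hu hud (.b j)
        (fun s : Bool => (.zb s j, true)) (fun β β' h => by simpa using h)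
        (fun β => by rw [hS]; rfl) 1 (by simp) true
      exact ⟨κ, θ, g, h1, h2, h3, fun s h => by simp at h⟩
  choose κ θ g h1 h2 h3 h4 using key
  have ht : ∀ s β, tB (fun e b => θ (S.v e b) e b) s β = tB (θ (.z s)) s β := by
    intro s β
    simp only [tB, hS, sv_eB]
  refine ⟨κ, fun e b => θ (S.v e b) e b, g, h1, fun e b => (h3 _ e b rfl).1, fun e b => (h3 _ e b rfl).2.1,
    h2, fun e b => (h3 _ e b rfl).2.2, fun s => ?_⟩
  have := h4 (.z s) s rfl
  constructor <;> simp only [ht]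
  exacts [this.lo, this.hi, this.lt, this.btw]

end CrK

namespace CrK
open Classical

lemma btw_of {g t s p q δ : ℝ} (h1 : 2 * δ < |t - g|) (h2 : 2 * δ < |s - t|) (hp : |p| ≤ δ) (hq : |q| ≤ δ)
    (h : Btw g (t + p) (s + q)) : Btw g t s := by
  have hp := abs_le.1 hp
  have hq := abs_le.1 hq
  rcases h with ⟨h3, h4⟩ | ⟨h3, h4⟩
  · left
    constructor
    · rcases lt_abs.1 h1 with h | h <;> linarith
    · rcases lt_abs.1 h2 with h | h <;> linarith
  · right
    constructor
    · rcases lt_abs.1 h2 with h | h <;> linarith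
    · rcases lt_abs.1 h1 with h | h <;> linarith

lemma btw_asymm {g t s : ℝ} (h : Btw g t s) : ¬ Btw g s t := by
  rintro h'
  rcases h with h | h <;> rcases h' with h' | h' <;> linarith

lemma pair_count {T I : Type*} [Fintype T] [Fintype I] (g : ℝ) (t : T → ℝ) (a : I → ℝ) (k : ℕ)
    (hlo : (Finset.univ.filter (fun β => t β < g)).card = k)
    (hhi : (Finset.univ.filter (fun β => g < t β)).card = k) :
    (Finset.univ.filter (fun q : T × I => Btw g (a q.2) (t q.1))).card +
      (Finset.univ.filter (fun q : T × I => Btw g (t q.1) (a q.2))).card ≤ Fintype.card I * k := by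
  rw [← Finset.card_union_of_disjoint]
  · have h1 : ∀ q ∈ (Finset.univ.filter (fun q : T × I => Btw g (a q.2) (t q.1))) ∪
      (Finset.univ.filter (fun q : T × I => Btw g (t q.1) (a q.2))), q.2 ∈ (Finset.univ : Finset I) := by simp
    refine (Finset.card_le_mul_card_image_of_maps_to h1 k ?_).trans_eq ?_
    · intro i _
      by_cases hi : a i < g
      · rw [← hlo]
        refine Finset.card_le_card_of_injOn Prod.fst ?_ ?_
        · rintro ⟨β, i'⟩ hq
          simp only [Finset.mem_filter, Finset.mem_union, Finset.mem_univ, true_and, Finset.coe_filter,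
            Set.mem_ofPred_eq] at hq ⊢
          obtain ⟨hq, rfl⟩ := hq
          unfold Btw at hq
          rcases hq with (h | h) | (h | h) <;> linarith
        · rintro ⟨β, i'⟩ hq ⟨β', i''⟩ hq' hh
          simp only [Finset.coe_filter, Set.mem_ofPred_eq] at hq hq' hh
          rw [hh, hq.2, hq'.2]
      · rw [← hhi]
        refine Finset.card_le_card_of_injOn Prod.fst ?_ ?_
        · rintro ⟨β, i'⟩ hq
          simp only [Finset.mem_filter, Finset.mem_union, Finset.mem_univ, true_and, Finset.coe_filter,
            Set.mem_ofPred_eq] at hq ⊢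
          obtain ⟨hq, rfl⟩ := hq
          unfold Btw at hq
          rcases hq with (h | h) | (h | h) <;> linarith
        · rintro ⟨β, i'⟩ hq ⟨β', i''⟩ hq' hh
          simp only [Finset.coe_filter, Set.mem_ofPred_eq] at hq hq' hh
          rw [hh, hq.2, hq'.2]
    · rw [Finset.card_univ, mul_comm]
  · rw [Finset.disjoint_left]
    intro q h1 h2
    exact btw_asymm (Finset.mem_filter.1 h1).2 (Finset.mem_filter.1 h2).2

lemma self_count {T : Type*} [Fintype T] (g : ℝ) (t : T → ℝ) (k : ℕ)
    (hlo : (Finset.univ.filter (fun β => t β < g)).card = k)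
    (hhi : (Finset.univ.filter (fun β => g < t β)).card = k) :
    (Finset.univ.filter (fun q : T × T => Btw g (t q.2) (t q.1))).card + k ≤ k * k := by
  let P := Finset.univ.filter (fun q : T × T => Btw g (t q.2) (t q.1))
  let L := Finset.univ.filter (fun β => t β < g)
  let H := Finset.univ.filter (fun β => g < t β)
  have h1 : P ∪ P.image Prod.swap ⊆ L.offDiag ∪ H.offDiag := by
    rintro ⟨β, β'⟩ hq
    simp only [P, L, H, Finset.mem_union, Finset.mem_filter, Finset.mem_univ, true_and, Finset.mem_image,
      Prod.exists, Prod.swap_prod_mk, Prod.mk.injEq, Finset.mem_offDiag] at hq ⊢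
    have hne : ∀ β β', Btw g (t β) (t β') → β ≠ β' := by
      rintro β _ h rfl
      exact btw_asymm h h
    have h' : ∀ β β', Btw g (t β) (t β') → (t β' < g ∧ t β < g) ∨ (g < t β' ∧ g < t β) := by
      rintro β β' (h | h)
      · right; exact ⟨h.1.trans h.2, h.1⟩
      · left; exact ⟨h.1.trans h.2, h.2⟩
    rcases hq with h | ⟨a, b, h, rfl, rfl⟩
    · rcases h' _ _ h with h2 | h2
      · exact Or.inl ⟨h2.1, h2.2, (hne _ _ h).symm⟩
      · exact Or.inr ⟨h2.1, h2.2, (hne _ _ h).symm⟩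
    · rcases h' _ _ h with h2 | h2
      · exact Or.inl ⟨h2.2, h2.1, (hne _ _ h)⟩
      · exact Or.inr ⟨h2.2, h2.1, (hne _ _ h)⟩
  have h2 : Disjoint P (P.image Prod.swap) := by
    rw [Finset.disjoint_left]
    rintro ⟨β, β'⟩ h h'
    simp only [P, Finset.mem_filter, Finset.mem_univ, true_and, Finset.mem_image,
      Prod.exists, Prod.swap_prod_mk, Prod.mk.injEq] at h h'
    obtain ⟨a, b, h', rfl, rfl⟩ := h'
    exact btw_asymm h h'
  have h3 := (Finset.card_le_card h1).trans (Finset.card_union_le _ _)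
  rw [Finset.card_union_of_disjoint h2, Finset.card_image_of_injective _ Prod.swap_injective,
    Finset.offDiag_card, Finset.offDiag_card] at h3
  change L.card = k at hlo
  change H.card = k at hhi
  rw [hlo, hhi] at h3
  change P.card + k ≤ k * k
  have : k ≤ k * k := Nat.le_mul_self k
  omega

variable {m n : ℕ}

structure Cx (S : Sys (SV m n) (SE m n)) (θ : SE m n → Bool → ℝ) (g : SV m n → ℝ) (δ : ℝ) (k : ℕ) : Prop where
  hS : S.v = sv
  δ0 : 0 < δ
  dg : ∀ e b, 2 * δ < |θ e b - g (S.v e b)|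
  dd : ∀ e b f c, (e, b) ≠ (f, c) → S.v e b = S.v f c → 2 * δ < |θ e b - θ f c|
  half : ∀ s, Half θ s (g (.z s)) k

structure Fit {S : Sys (SV m n) (SE m n)} (Q : Surg S) (θ : SE m n → Bool → ℝ) (g : SV m n → ℝ) (δ : ℝ)
    (lev : SE m n → SignType → Bool → Fin 3) : Prop where
  hlev : Q.lev = lev
  hg : Q.g = g
  hang : ∀ e b k, Q.ang e b k = θ e b + δ * ((sg b k : SignType) : ℝ)

variable {S : Sys (SV m n) (SE m n)} {θ : SE m n → Bool → ℝ} {g : SV m n → ℝ} {δ : ℝ} {k : ℕ}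

lemma Cx.abs (C : Cx S θ g δ k) (s : SignType) : |δ * (s : ℝ)| ≤ δ := by
  rw [abs_mul, abs_of_pos C.δ0]
  have := sgn_abs s
  have := C.δ0
  nlinarith

/-- passing from strands to edges -/
lemma Cx.btw (C : Cx S θ g δ k) {e f : SE m n} {b c : Bool} (hv : sv e b = sv f c) (hne : e ≠ f)
    {p q : SignType} (h : Btw (g (sv e b)) (θ f c + δ * (p : ℝ)) (θ e b + δ * (q : ℝ))) :
    Btw (g (sv e b)) (θ f c) (θ e b) := by
  have h1 := C.dg f c
  rw [C.hS, ← hv] at h1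
  have h2 := C.dd e b f c (fun h => hne (congrArg Prod.fst h)) (by rw [C.hS]; exact hv)
  exact btw_of h1 h2 (C.abs _) (C.abs _) h

/-! ### first system -/

def lev1 : SE m n → SignType → Bool → Fin 3
  | .xy, _, false => 1
  | .zb false _, _, false => 1
  | _, _, _ => 0

noncomputable def U1 : Finset (SE m n × SignType) :=
  Finset.univ.filter fun s => s.2 = 0 ∧ ∀ j, s.1 ≠ .zb true j

lemma lev1_z {e : SE m n} {k b} (h : lev1 e k b ≠ 0) : sv e b = .z false := by
  rcases e with _ | ⟨s', i⟩ | ⟨s', j⟩ | ⟨i, j⟩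
  · cases b <;> simp_all [lev1, sv]
  · cases b <;> simp_all [lev1]
  · cases b <;> cases s' <;> simp_all [lev1, sv]
  · cases b <;> simp_all [lev1]

lemma lev1_eB (k β) : lev1 (eB (m := m) (n := n) false β) k (eb false β) = 1 := by
  cases β <;> simp [lev1, eB, eb]

lemma lev1_za (s i k) : lev1 (.za s i : SE m n) k false = 0 := rfl

lemma lo1 (C : Cx S θ g δ k) {Q : Surg S} (F : Fit Q θ g δ lev1) :
    (Q.loF U1).card ≤ (Finset.univ.filter (fun q : Option (Fin n) × Fin m =>
      Btw (g (.z false)) (tA θ false q.2) (tB θ false q.1))).card := by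
  refine le_trans (Finset.card_le_card (t := (Finset.univ.filter (fun q : Option (Fin n) × Fin m =>
      Btw (g (.z false)) (tA θ false q.2) (tB θ false q.1))).image
        (fun q => ((eB false q.1, 0), (.za false q.2, 0)))) ?_) Finset.card_image_le
  rintro ⟨⟨e, l⟩, ⟨f, l'⟩⟩ hq
  obtain ⟨hU, b, c, hv, hl, hB⟩ := Finset.mem_filter.1 hq
  obtain ⟨hU1, hU2⟩ := Finset.mem_product.1 hU
  simp only [U1, Finset.mem_filter, Finset.mem_univ, true_and] at hU1 hU2
  obtain ⟨rfl, -⟩ := hU1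
  obtain ⟨rfl, -⟩ := hU2
  simp only [F.hlev, F.hg, F.hang, C.hS] at hv hl hB
  have hz : sv e b = .z false := lev1_z (k := 0) (fun h => by rw [h] at hl; exact absurd hl (by simp))
  rcases sv_z hz with ⟨i, rfl, rfl⟩ | ⟨β, rfl, rfl⟩
  · simp [lev1_za] at hl
  rcases sv_z (hv.symm.trans hz) with ⟨i, rfl, rfl⟩ | ⟨β', rfl, rfl⟩
  · refine Finset.mem_image.2 ⟨(β, i), Finset.mem_filter.2 ⟨Finset.mem_univ _, ?_⟩, rfl⟩
    have := C.btw hv (by cases β <;> simp [eB]) hB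
    rw [hz] at this
    exact this
  · simp [lev1_eB] at hl

/-! ### second system -/

def lv (r k : SignType) : Fin 3 := if k = r then 2 else if k = 0 then 1 else 0

def lev3 (r : Option (Fin n) → SignType) : SE m n → SignType → Bool → Fin 3
  | .xy, k, false => if k = 0 then 0 else 1
  | .xy, k, true => lv (r none) k
  | .za _ _, _, false => 1
  | .zb true j, k, false => lv (r (some j)) k
  | _, _, _ => 0

def U3p : SE m n → SignType → Prop
  | .xy, _ => True
  | .zb true _, k => k ≠ 0
  | _, k => k = 0

noncomputable def U3 : Finset (SE m n × SignType) := Finset.univ.filter fun s => U3p s.1 s.2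

lemma lev3_z {r : Option (Fin n) → SignType} {e : SE m n} {k b} (h : lev3 r e k b ≠ 0) :
    ∃ s, sv e b = .z s := by
  rcases e with _ | ⟨s', i⟩ | ⟨s', j⟩ | ⟨i, j⟩
  · exact ⟨b, rfl⟩
  · cases b
    · exact ⟨s', rfl⟩
    · simp [lev3] at h
  · cases b
    · exact ⟨s', rfl⟩
    · cases s' <;> simp [lev3] at h
  · cases b <;> simp [lev3] at h

lemma lev3_eBt (r k β) : lev3 r (eB (m := m) (n := n) true β) k (eb true β) = lv (r β) k := by
  cases β <;> simp [lev3, eB, eb]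

lemma lev3_eBf (r k β) : lev3 r (eB (m := m) (n := n) false β) k (eb false β) =
    if β = none ∧ k ≠ 0 then 1 else 0 := by
  cases β
  · by_cases h : k = 0 <;> simp [lev3, eB, eb, h]
  · simp [lev3, eB, eb]

lemma lev3_za (r s i k) : lev3 r (.za s i : SE m n) k false = 1 := rfl

/-- `r` points towards the gap at the second special vertex -/
def Near (θ : SE m n → Bool → ℝ) (g : SV m n → ℝ) (r : Option (Fin n) → SignType) : Prop :=
  ∀ β, sg (eb true β) (r β) = if tB θ true β < g (.z true) then 1 else -1

lemma sg_ne : ∀ b r, sg b r ≠ 0 → r ≠ 0 := by decide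

lemma Near.ne {r : Option (Fin n) → SignType} (h : Near θ g r) (β) : r β ≠ 0 := by
  refine sg_ne (eb true β) (r β) ?_
  rw [h β]; split_ifs <;> decide

lemma lv_lt_pos : ∀ b r k l, sg b r = 1 → lv r l < lv r k → sg b l < sg b k := by decide

lemma lv_lt_neg : ∀ b r k l, sg b r = -1 → lv r l < lv r k → sg b k < sg b l := by decide

lemma lv_inj : ∀ r k l, r ≠ 0 → lv r k = lv r l → k = l := by decide

lemma lv_zero : ∀ r k, r ≠ 0 → lv r k = 0 → k = -r := by decide

lemma lv_one : ∀ r k, r ≠ 0 → lv r k = 1 → k = 0 := by decide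

lemma lv_two : ∀ r k, lv r k = 2 → k = r := by decide

lemma cast_lt : ∀ k l : SignType, k < l → (k : ℝ) < l := by
  intro k l h
  rcases k <;> rcases l <;> first | exact absurd h (by decide) | norm_num

lemma lv_nobtw (C : Cx S θ g δ k) {r : Option (Fin n) → SignType} (hr : Near θ g r) (β) {p q : SignType}
    (h : lv (r β) p < lv (r β) q) :
    ¬ Btw (g (.z true)) (tB θ true β + δ * (sg (eb true β) p : ℝ)) (tB θ true β + δ * (sg (eb true β) q : ℝ)) := by
  have hd := C.dg (eB true β) (eb true β)
  rw [C.hS, sv_eB] at hd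
  change 2 * δ < |tB θ true β - _| at hd
  have h1 := abs_le.1 (C.abs (sg (eb true β) p))
  have h2 := abs_le.1 (C.abs (sg (eb true β) q))
  have h0 := C.δ0
  have hrβ := hr β
  split_ifs at hrβ with hlt
  · have h3 := mul_lt_mul_of_pos_left (cast_lt _ _ (lv_lt_pos _ _ _ _ hrβ h)) h0
    rcases lt_abs.1 hd with hd | hd
    · linarith
    · rintro (⟨h4, h5⟩ | ⟨h4, h5⟩) <;> linarith
  · have h3 := mul_lt_mul_of_pos_left (cast_lt _ _ (lv_lt_neg _ _ _ _ hrβ h)) h0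
    rcases lt_abs.1 hd with hd | hd
    · rintro (⟨h4, h5⟩ | ⟨h4, h5⟩) <;> linarith
    · linarith

end CrK

namespace CrK
open Classical
variable {m n : ℕ}
variable {S : Sys (SV m n) (SE m n)} {θ : SE m n → Bool → ℝ} {g : SV m n → ℝ} {δ : ℝ} {k : ℕ}

lemma U3_za {s i k} (h : ((.za s i : SE m n), k) ∈ U3 (m := m) (n := n)) : k = 0 := by
  exact (Finset.mem_filter.1 h).2

lemma U3_some {j k} (h : (eB true (some j), k) ∈ U3 (m := m) (n := n)) : k ≠ 0 := by
  exact (Finset.mem_filter.1 h).2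

lemma U3_somef {j k} (h : (eB false (some j), k) ∈ U3 (m := m) (n := n)) : k = 0 := by
  exact (Finset.mem_filter.1 h).2

/-- no edge of type `B` lies between the special edge and the gap -/
lemma Cx.nobtw (C : Cx S θ g δ k) (s : Bool) (β) : ¬ Btw (g (.z s)) (tB θ s β) (tB θ s none) := by
  have h1 := (C.half s).lt
  rintro (h | h)
  · linarith
  · exact (C.half s).btw β h

lemma Cx.btwB (C : Cx S θ g δ k) {s : Bool} {β β'} (hne : β ≠ β') {p q : SignType}
    (h : Btw (g (.z s)) (tB θ s β' + δ * (p : ℝ)) (tB θ s β + δ * (q : ℝ))) :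
    Btw (g (.z s)) (tB θ s β') (tB θ s β) := by
  have := C.btw (e := eB s β) (b := eb s β) (f := eB s β') (c := eb s β') (p := p) (q := q)
    (by rw [sv_eB, sv_eB]) (fun h => hne (eB_inj s h)) (by rw [sv_eB]; exact h)
  rw [sv_eB] at this
  exact this

lemma eB_ne_za (s s' i) (β : Option (Fin n)) : eB s β ≠ (.za s' i : SE m n) := by
  cases β <;> simp [eB]

noncomputable abbrev PA (θ : SE m n → Bool → ℝ) (g : SV m n → ℝ) (s : Bool) : Finset (Option (Fin n) × Fin m) :=
  Finset.univ.filter (fun q => Btw (g (.z s)) (tA θ s q.2) (tB θ s q.1))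

noncomputable abbrev PB (θ : SE m n → Bool → ℝ) (g : SV m n → ℝ) (s : Bool) : Finset (Option (Fin n) × Fin m) :=
  Finset.univ.filter (fun q => Btw (g (.z s)) (tB θ s q.1) (tA θ s q.2))

noncomputable abbrev PC (θ : SE m n → Bool → ℝ) (g : SV m n → ℝ) (s : Bool) : Finset (Option (Fin n)) :=
  (Finset.univ.filter (fun β => tB θ s β < g (.z s))).erase none

noncomputable abbrev PD (θ : SE m n → Bool → ℝ) (g : SV m n → ℝ) (s : Bool) : Finset (Option (Fin n) × Option (Fin n)) :=
  Finset.univ.filter (fun q => Btw (g (.z s)) (tB θ s q.2) (tB θ s q.1))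

abbrev St (m n : ℕ) := SE m n × SignType

noncomputable def big (θ : SE m n → Bool → ℝ) (g : SV m n → ℝ) (r : Option (Fin n) → SignType) :
    Finset (St m n × St m n) :=
  (PB θ g false).image (fun q => ((.za false q.2, 0), (eB false q.1, 0))) ∪
  ({((.xy, -1), (.xy, 0))} ∪
  ((PB θ g true).image (fun q => ((.za true q.2, 0), (eB true q.1, -r q.1))) ∪
  ((PA θ g true).image (fun q => ((eB true q.1, r q.1), (.za true q.2, 0))) ∪
  ((PC θ g true).image (fun β => ((eB true β, r β), (.xy, 0))) ∪
  (PD θ g true).image (fun q => ((eB true q.1, r q.1), (eB true q.2, -r q.2)))))))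

lemma lo3_sub (C : Cx S θ g δ k) {r : Option (Fin n) → SignType} (hr : Near θ g r) {Q : Surg S}
    (F : Fit Q θ g δ (lev3 r)) : Q.loF U3 ⊆ big θ g r := by
  rintro ⟨⟨e, l⟩, ⟨f, l'⟩⟩ hq
  obtain ⟨hU, b, c, hv, hl, hB⟩ := Finset.mem_filter.1 hq
  obtain ⟨hU1, hU2⟩ := Finset.mem_product.1 hU
  simp only [F.hlev, F.hg, F.hang, C.hS] at hv hl hB hU1 hU2
  obtain ⟨s, hz⟩ : ∃ s, sv e b = .z s :=
    lev3_z (r := r) (k := l) (fun h => by rw [h] at hl; exact absurd hl (by simp))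
  have hz' : sv f c = .z s := hv.symm.trans hz
  clear hq hU
  simp only [big, Finset.mem_union, Finset.mem_image, Finset.mem_singleton]
  have hbt := fun h => C.btw hv h hB
  rw [hz] at hbt hB
  have h01 : ∀ j : Fin 3, j < 1 → j = 0 := by decide
  rcases s with _ | _
  · rcases sv_z hz with ⟨i, rfl, rfl⟩ | ⟨β, rfl, rfl⟩
    · obtain rfl := U3_za hU1
      rcases sv_z hz' with ⟨i', rfl, rfl⟩ | ⟨β', rfl, rfl⟩
      · simp [lev3_za] at hl
      · left
        refine ⟨(β', i), Finset.mem_filter.2 ⟨Finset.mem_univ _, hbt (eB_ne_za _ _ _ _).symm⟩, ?_⟩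
        have hl0 : l' = 0 := by
          rcases β' with _ | j
          · rw [lev3_za, lev3_eBf] at hl
            by_contra h
            simp [h] at hl
          · exact U3_somef hU2
        rw [hl0]
    · rw [lev3_eBf] at hl
      by_cases hβ : β = none ∧ l ≠ 0
      · obtain ⟨rfl, hl0⟩ := hβ
        simp only [true_and, ne_eq, hl0, not_false_eq_true, if_true] at hl
        rcases sv_z hz' with ⟨i', rfl, rfl⟩ | ⟨β', rfl, rfl⟩
        · simp [lev3_za] at hl
        rcases β' with _ | j
        · rw [lev3_eBf] at hl
          have hl'0 : l' = 0 := by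
            by_contra h
            simp [h] at hl
          subst hl'0
          right; left
          have hlt := (C.half false).lt
          have h0 := C.δ0
          change Btw (g (.z false)) (tB θ false none + _) (tB θ false none + _) at hB
          have hl1 : l = -1 := by
            rcases l with _ | _ | _
            · exact absurd rfl hl0
            · rfl
            · exfalso
              simp only [sg, eb] at hB
              norm_num [Btw] at hB
              rcases hB with h | h <;> linarith
          rw [hl1]; rfl
        · exact absurd (C.btwB (s := false) (β := none) (β' := some j) (by simp) hB) (C.nobtw _ _)
      · rw [if_neg hβ] at hl
        exact absurd hl (by simp)
  · rcases sv_z hz with ⟨i, rfl, rfl⟩ | ⟨β, rfl, rfl⟩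
    · obtain rfl := U3_za hU1
      rcases sv_z hz' with ⟨i', rfl, rfl⟩ | ⟨β', rfl, rfl⟩
      · simp [lev3_za] at hl
      · right; right; left
        rw [lev3_za, lev3_eBt] at hl
        obtain rfl := lv_zero _ _ (hr.ne β') (h01 _ hl)
        exact ⟨(β', i), Finset.mem_filter.2 ⟨Finset.mem_univ _, hbt (eB_ne_za _ _ _ _).symm⟩, rfl⟩
    · rw [lev3_eBt] at hl
      rcases sv_z hz' with ⟨i', rfl, rfl⟩ | ⟨β', rfl, rfl⟩
      · obtain rfl := U3_za hU2
        rw [lev3_za] at hl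
        have h2 : ∀ j : Fin 3, 1 < j → j = 2 := by decide
        obtain rfl := lv_two _ _ (h2 _ hl)
        right; right; right; left
        exact ⟨(β, i'), Finset.mem_filter.2 ⟨Finset.mem_univ _, hbt (eB_ne_za _ _ _ _)⟩, rfl⟩
      · rw [lev3_eBt] at hl
        have hne : β ≠ β' := by
          rintro rfl
          exact lv_nobtw C hr β hl hB
        have hb := C.btwB (s := true) (β := β) (β' := β') hne hB
        have hβ : β ≠ none := by
          rintro rfl
          exact C.nobtw _ _ hb
        obtain ⟨j, rfl⟩ := Option.ne_none_iff_exists'.1 hβ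
        have hl0 := U3_some hU1
        have h3 : ∀ j : Fin 3, j ≠ 0 → j ≠ 1 → j = 2 := by decide
        have hl2 : l = r (some j) := by
          apply lv_two
          apply h3
          · intro h; rw [h] at hl; exact absurd hl (by simp)
          · intro h; exact hl0 (lv_one _ _ (hr.ne _) h)
        subst hl2
        right; right; right; right
        by_cases h1 : l' = 0
        · subst h1
          rcases β' with _ | j'
          · left
            refine ⟨some j, Finset.mem_erase.2 ⟨hβ, Finset.mem_filter.2 ⟨Finset.mem_univ _, ?_⟩⟩, rfl⟩
            have hlt := (C.half true).lt
            rcases hb with h | h <;> linarith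
          · exact absurd rfl (U3_some hU2)
        · right
          have h4 : ∀ r l' : SignType, lv r l' < lv r r → l' ≠ 0 → r ≠ 0 → l' = -r := by decide
          obtain rfl := h4 _ _ (by
            refine lt_of_le_of_ne ?_ ?_
            · have : ∀ r l' : SignType, lv r l' ≤ lv r r := by decide
              exact this _ _
            · intro h
              have h5 := lv_inj _ _ _ (hr.ne β') h
              subst h5
              have : ∀ r r' : SignType, ¬ lv r r < lv r' r' := by decide
              exact this _ _ hl) h1 (hr.ne β')
          exact ⟨(some j, β'), Finset.mem_filter.2 ⟨Finset.mem_univ _, hb⟩, rfl⟩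

lemma local_total (C : Cx S θ g δ k) (hk : 0 < k) {r : Option (Fin n) → SignType} (hr : Near θ g r) {Q1 Q3 : Surg S}
    (F1 : Fit Q1 θ g δ lev1) (F3 : Fit Q3 θ g δ (lev3 r)) :
    (Q1.loF U1).card + (Q3.loF U3).card ≤ 2 * (m * k) + k * k := by
  have h1 : (Q1.loF U1).card ≤ (PA θ g false).card := lo1 C F1
  have h3 : (Q3.loF U3).card ≤ (PB θ g false).card + (1 + ((PB θ g true).card + ((PA θ g true).card +
      ((PC θ g true).card + (PD θ g true).card)))) := by
    refine (Finset.card_le_card (lo3_sub C hr F3)).trans ?_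
    refine (Finset.card_union_le _ _).trans (Nat.add_le_add Finset.card_image_le ?_)
    refine (Finset.card_union_le _ _).trans (Nat.add_le_add (Finset.card_singleton _).le ?_)
    refine (Finset.card_union_le _ _).trans (Nat.add_le_add Finset.card_image_le ?_)
    refine (Finset.card_union_le _ _).trans (Nat.add_le_add Finset.card_image_le ?_)
    exact (Finset.card_union_le _ _).trans (Nat.add_le_add Finset.card_image_le Finset.card_image_le)
  have p0 : (PA θ g false).card + (PB θ g false).card ≤ m * k := by
    have := pair_count (g (.z false)) (tB θ false) (tA θ false) k (by convert (C.half false).lo) (by convert (C.half false).hi)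
    rwa [Fintype.card_fin] at this
  have p1 : (PA θ g true).card + (PB θ g true).card ≤ m * k := by
    have := pair_count (g (.z true)) (tB θ true) (tA θ true) k (by convert (C.half true).lo) (by convert (C.half true).hi)
    rwa [Fintype.card_fin] at this
  have p2 : (PD θ g true).card + k ≤ k * k :=
    self_count (g (.z true)) (tB θ true) k (by convert (C.half true).lo) (by convert (C.half true).hi)
  have p3 : (PC θ g true).card = k - 1 := by
    have hm : none ∈ Finset.univ.filter (fun β => tB θ true β < g (.z true)) :=
      Finset.mem_filter.2 ⟨Finset.mem_univ _, (C.half true).lt⟩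
    rw [Finset.card_erase_of_mem hm]
    congr 1
    convert (C.half true).lo
  omega

end CrK

namespace CrK
open Classical
variable {m n : ℕ}
variable {S : Sys (SV m n) (SE m n)} {θ : SE m n → Bool → ℝ} {g : SV m n → ℝ} {δ : ℝ} {k : ℕ}

/-! ### multiplicities -/

def m1 : SE m n → ℕ
  | .zb true _ => 0
  | _ => 1

def m3 : SE m n → ℕ
  | .xy => 3
  | .zb true _ => 2
  | _ => 1

def m2 : SE m n → ℕ
  | .xy => 0
  | _ => 1

lemma mulU1_le (e : SE m n) : mulU U1 e ≤ m1 e := by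
  have h1 : mulU U1 e ≤ 1 := by
    refine Finset.card_le_one.2 fun a ha b hb => ?_
    have ha := (Finset.mem_filter.1 (Finset.mem_filter.1 ha).2).2.1
    have hb := (Finset.mem_filter.1 (Finset.mem_filter.1 hb).2).2.1
    exact ha.trans hb.symm
  rcases e with _ | ⟨s', i⟩ | ⟨s', j⟩ | ⟨i, j⟩
  · exact h1
  · exact h1
  · cases s'
    · exact h1
    · refine le_of_eq (Finset.card_eq_zero.2 (Finset.filter_eq_empty_iff.2 fun a _ ha => ?_))
      exact (Finset.mem_filter.1 ha).2.2 j rfl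
  · exact h1

lemma mulU3_le (e : SE m n) : mulU U3 e ≤ m3 e := by
  have h1 : (∀ k, U3p e k → k = 0) → mulU U3 e ≤ 1 := by
    intro h
    refine Finset.card_le_one.2 fun a ha b hb => ?_
    have ha := h _ (Finset.mem_filter.1 (Finset.mem_filter.1 ha).2).2
    have hb := h _ (Finset.mem_filter.1 (Finset.mem_filter.1 hb).2).2
    exact ha.trans hb.symm
  rcases e with _ | ⟨s', i⟩ | ⟨s', j⟩ | ⟨i, j⟩
  · refine (Finset.card_filter_le _ _).trans ?_
    change (Finset.univ : Finset SignType).card ≤ 3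
    decide
  · exact h1 fun k h => h
  · cases s'
    · exact h1 fun k h => h
    · have h2 : (Finset.univ.filter fun k => ((SE.zb true j : SE m n), k) ∈ U3) ⊆ ({1, -1} : Finset SignType) := by
        intro a ha
        have ha : a ≠ 0 := (Finset.mem_filter.1 (Finset.mem_filter.1 ha).2).2
        rcases a with _ | _ | _
        · exact absurd rfl ha
        · simp
        · simp
      exact (Finset.card_le_card h2).trans Finset.card_le_two
  · exact h1 fun k h => h

lemma m_bound (e f : SE m n) (h : ∀ b c, sv e b ≠ sv f c) :
    m1 e * m1 f + m3 e * m3 f + 2 * (m2 e * m2 f) ≤ 4 := by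
  have a1 := h false false
  have a2 := h true true
  have a3 := h false true
  have a4 := h true false
  rcases e with _ | ⟨_ | _, i⟩ | ⟨_ | _, j⟩ | ⟨i, j⟩ <;>
    rcases f with _ | ⟨_ | _, i'⟩ | ⟨_ | _, j'⟩ | ⟨i', j'⟩ <;>
    first
      | (simp [m1, m2, m3]; done)
      | (exfalso; simp [sv] at a1 a2 a3 a4)

lemma m_total (hS : S.v = sv) : ∑ q ∈ crF S, mulU U1 q.1 * mulU U1 q.2 + ∑ q ∈ crF S, mulU U3 q.1 * mulU U3 q.2
    + 2 * ∑ q ∈ crF S, m2 q.1 * m2 q.2 ≤ 4 * (crF S).card := by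
  rw [Finset.mul_sum, ← Finset.sum_add_distrib, ← Finset.sum_add_distrib, mul_comm, ← smul_eq_mul]
  refine Finset.sum_le_card_nsmul _ _ _ fun q hq => ?_
  have hc := (Finset.mem_filter.1 hq).2
  have := m_bound q.1 q.2 (by have := hc.2.1; rwa [hS] at this)
  have h1 := Nat.mul_le_mul (mulU1_le q.1) (mulU1_le q.2)
  have h3 := Nat.mul_le_mul (mulU3_le q.1) (mulU3_le q.2)
  omega

/-! ### first realization -/

def rep1 : Option (Fin m) × (Bool ⊕ Fin n) → Surg.R (SV m n) (SE m n)
  | (some i, .inl s) => .inl (.za s i, 0)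
  | (some i, .inr j) => .inl (.ab i j, 0)
  | (none, .inl false) => .inr (.z false, false)
  | (none, .inl true) => .inl (.xy, 0)
  | (none, .inr j) => .inl (.zb false j, 0)

def nd1 : Option (Fin m) ⊕ (Bool ⊕ Fin n) → SV m n × Fin 3
  | .inl none => (.z false, 1)
  | .inl (some i) => (.a i, 0)
  | .inr (.inl s) => (.z s, 0)
  | .inr (.inr j) => (.b j, 0)

lemma rep1_inj : Function.Injective (rep1 (m := m) (n := n)) := by
  rintro ⟨_ | i, (_ | _) | j⟩ ⟨_ | i', (_ | _) | j'⟩ h <;> simp_all [rep1]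

lemma nd1_inj : Function.Injective (nd1 (m := m) (n := n)) := by
  rintro ((_ | i) | ((_ | _) | j)) ((_ | i') | ((_ | _) | j')) h <;> simp_all [nd1]

lemma rep1_U : ∀ f s, rep1 (m := m) (n := n) f = .inl s → s ∈ U1 (m := m) (n := n) := by
  rintro ⟨_ | i, (_ | _) | j⟩ s h <;> simp only [rep1, Sum.inl.injEq, reduceCtorEq] at h <;> subst h <;>
    refine Finset.mem_filter.2 ⟨Finset.mem_univ _, rfl, fun j' h => ?_⟩ <;> simp at h

lemma cr1_le (C : Cx S θ g δ k) {Q : Surg S} (F : Fit Q θ g δ lev1) :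
    2 * crossingNumber (bipK (m + 1) (n + 2)) ≤
      ∑ q ∈ crF S, mulU U1 q.1 * mulU U1 q.2 + 2 * (Q.loF U1).card := by
  have hcl : ∀ f f', Q.Clean (rep1 f) (rep1 f') := by
    intro f f' e k l h h' hkl
    have h1 := (Finset.mem_filter.1 (rep1_U _ _ h)).2.1
    have h2 := (Finset.mem_filter.1 (rep1_U _ _ h')).2.1
    exact absurd (h1.trans h2.symm) hkl
  refine le_trans ?_ (new_count Q rep1 rep1_inj hcl U1 rep1_U)
  refine bip_le (by simp) (by simp; omega) (Q.newSys rep1 rep1_inj hcl) nd1 nd1_inj ?_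
  have hv : ∀ f b, (Q.newSys rep1 rep1_inj hcl).v f b = Q.vv (rep1 f) b := fun _ _ => rfl
  rintro (_ | i) ((_ | _) | j) <;> simp [hv, rep1, nd1, Surg.vv, F.hlev, C.hS, sv, lev1]

/-! ### second realization -/

def rep3 (r : Option (Fin n) → SignType) :
    Option (Option (Option (Fin m))) × (Bool ⊕ Fin n) → Surg.R (SV m n) (SE m n)
  | (none, .inl false) => .inr (.z false, false)
  | (none, .inl true) => .inl (.xy, 0)
  | (none, .inr j) => .inl (.zb false j, 0)
  | (some none, .inl false) => .inl (.xy, -r none)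
  | (some none, .inl true) => .inr (.z true, false)
  | (some none, .inr j) => .inl (.zb true j, -r (some j))
  | (some (some none), .inl false) => .inl (.xy, r none)
  | (some (some none), .inl true) => .inr (.z true, true)
  | (some (some none), .inr j) => .inl (.zb true j, r (some j))
  | (some (some (some i)), .inl s) => .inl (.za s i, 0)
  | (some (some (some i)), .inr j) => .inl (.ab i j, 0)

def nd3 : Option (Option (Option (Fin m))) ⊕ (Bool ⊕ Fin n) → SV m n × Fin 3
  | .inl none => (.z false, 0)
  | .inl (some none) => (.z true, 0)
  | .inl (some (some none)) => (.z true, 2)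
  | .inl (some (some (some i))) => (.a i, 0)
  | .inr (.inl _s) => (.z _s, 1)
  | .inr (.inr j) => (.b j, 0)

lemma neg_self_ne : ∀ r : SignType, r ≠ 0 → -r ≠ r := by decide

lemma neg_ne : ∀ r : SignType, r ≠ 0 → -r ≠ 0 := by decide

lemma rep3_inj {r : Option (Fin n) → SignType} (hr : ∀ β, r β ≠ 0) : Function.Injective (rep3 (m := m) r) := by
  have h1 := fun β => neg_self_ne _ (hr β)
  have h2 := fun β => (neg_self_ne _ (hr β)).symm
  have h3 := fun β => (hr β).symm
  have h5 := fun β => neg_ne _ (hr β)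
  have h4 := fun β => (neg_ne _ (hr β)).symm
  rintro ⟨_ | _ | _ | i, (_ | _) | j⟩ ⟨_ | _ | _ | i', (_ | _) | j'⟩ h <;>
    simp only [rep3, Sum.inl.injEq, Sum.inr.injEq, reduceCtorEq, Prod.mk.injEq, SE.zb.injEq, SE.za.injEq,
      SE.ab.injEq, SV.z.injEq, true_and, and_true, false_and, and_false, hr, h1, h2, h3, h4, h5, eq_self] at h <;>
    first
      | rfl
      | (obtain ⟨rfl, h⟩ := h; first | rfl | exact absurd h (h1 _) | exact absurd h (h2 _) | (subst h; rfl))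
      | (subst h; rfl)

lemma nd3_inj : Function.Injective (nd3 (m := m) (n := n)) := by
  rintro ((_ | _ | _ | i) | ((_ | _) | j)) ((_ | _ | _ | i') | ((_ | _) | j')) h <;> simp_all [nd3]

lemma rep3_U {r : Option (Fin n) → SignType} (hr : ∀ β, r β ≠ 0) :
    ∀ f s, rep3 (m := m) r f = .inl s → s ∈ U3 (m := m) (n := n) := by
  rintro ⟨_ | _ | _ | i, (_ | _) | j⟩ s h <;> simp only [rep3, Sum.inl.injEq, reduceCtorEq] at h <;> subst h <;>
    refine Finset.mem_filter.2 ⟨Finset.mem_univ _, ?_⟩ <;> simp [U3p, hr]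

lemma U3p_eB {e : SE m n} {p q : SignType} (hp : U3p e p) (hq : U3p e q) (h : p ≠ q) :
    ∃ β, e = eB true β := by
  rcases e with _ | ⟨s', i⟩ | ⟨s', j⟩ | ⟨i, j⟩
  · exact ⟨none, rfl⟩
  · exact absurd ((hp : p = 0).trans (hq : q = 0).symm) h
  · cases s'
    · exact absurd ((hp : p = 0).trans (hq : q = 0).symm) h
    · exact ⟨some j, rfl⟩
  · exact absurd ((hp : p = 0).trans (hq : q = 0).symm) h

lemma cr3_le (C : Cx S θ g δ k) {r : Option (Fin n) → SignType} (hr : Near θ g r) {Q : Surg S}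
    (F : Fit Q θ g δ (lev3 r)) :
    2 * crossingNumber (bipK (m + 3) (n + 2)) ≤
      ∑ q ∈ crF S, mulU U3 q.1 * mulU U3 q.2 + 2 * (Q.loF U3).card := by
  have hcl : ∀ f f', Q.Clean (rep3 r f) (rep3 r f') := by
    intro f f' e p q h h' hpq
    have h1 := (Finset.mem_filter.1 (rep3_U hr.ne _ _ h)).2
    have h2 := (Finset.mem_filter.1 (rep3_U hr.ne _ _ h')).2
    obtain ⟨β, rfl⟩ := U3p_eB h1 h2 hpq
    refine ⟨eb true β, ?_, ?_⟩
    · rw [F.hlev, lev3_eBt, lev3_eBt]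
      exact fun h => hpq (lv_inj _ _ _ (hr.ne β) h)
    · rintro ⟨-, h⟩
      rw [F.hlev, lev3_eBt, lev3_eBt, F.hg, F.hang, F.hang, C.hS, sv_eB] at h
      rcases h with ⟨h3, h4⟩ | ⟨h3, h4⟩
      · exact lv_nobtw C hr β h3 h4
      · exact lv_nobtw C hr β h3 h4
  refine le_trans ?_ (new_count Q (rep3 r) (rep3_inj hr.ne) hcl U3 (rep3_U hr.ne))
  refine bip_le (by simp) (by simp; omega) (Q.newSys (rep3 r) (rep3_inj hr.ne) hcl) nd3 nd3_inj ?_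
  have hv : ∀ f b, (Q.newSys (rep3 r) (rep3_inj hr.ne) hcl).v f b = Q.vv (rep3 r f) b := fun _ _ => rfl
  have l0 : ∀ β, lv (r β) 0 = 1 := by
    have : ∀ r : SignType, r ≠ 0 → lv r 0 = 1 := by decide
    exact fun β => this _ (hr.ne β)
  have l1 : ∀ β, lv (r β) (r β) = 2 := by
    have : ∀ r : SignType, lv r r = 2 := by decide
    exact fun β => this _
  have l2 : ∀ β, lv (r β) (-r β) = 0 := by
    have : ∀ r : SignType, r ≠ 0 → lv r (-r) = 0 := by decide
    exact fun β => this _ (hr.ne β)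
  rintro (_ | _ | _ | i) ((_ | _) | j) <;>
    simp [hv, rep3, nd3, Surg.vv, F.hlev, C.hS, sv, lev3, l0, l1, l2, hr.ne]

end CrK

namespace CrK
open Classical
variable {m n : ℕ}

abbrev QV (m n : ℕ) := Σ i : Fin 4, ![Fin 1, Fin 1, Fin m, Fin n] i
abbrev TV (m n : ℕ) := Σ i : Fin 3, ![Fin 2, Fin m, Fin n] i

/-- source vertices as vertices of the four-partite graph -/
def ndq : SV m n → QV m n
  | .z false => ⟨0, (0 : Fin 1)⟩
  | .z true => ⟨1, (0 : Fin 1)⟩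
  | .a i => ⟨2, (i : Fin m)⟩
  | .b j => ⟨3, (j : Fin n)⟩

def cls : SV m n → Fin 4
  | .z false => 0
  | .z true => 1
  | .a _ => 2
  | .b _ => 3

lemma ndq_fst (x : SV m n) : (ndq x).1 = cls x := by
  rcases x with (_ | _) | i | j <;> rfl

lemma ndq_inj : Function.Injective (ndq (m := m) (n := n)) := by
  intro x y h
  have h1 : cls x = cls y := by rw [← ndq_fst, ← ndq_fst, h]
  rcases x with (_ | _) | i | j <;> rcases y with (_ | _) | i' | j' <;>
    first
      | rfl
      | (exfalso; simp [cls] at h1; done)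
      | (have h2 := eq_of_heq (Sigma.mk.inj h).2; exact congrArg _ h2)

lemma ndq_surj : Function.Surjective (ndq (m := m) (n := n)) := by
  rintro ⟨i, x⟩
  fin_cases i
  · exact ⟨.z false, by change (⟨0, (0 : Fin 1)⟩ : QV m n) = ⟨0, x⟩; congr 1; exact (Subsingleton.elim (α := Fin 1) _ _)⟩
  · exact ⟨.z true, by change (⟨1, (0 : Fin 1)⟩ : QV m n) = ⟨1, x⟩; congr 1; exact (Subsingleton.elim (α := Fin 1) _ _)⟩
  · exact ⟨.a x, rfl⟩
  · exact ⟨.b x, rfl⟩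

instance : Finite (QV m n) := Finite.of_surjective _ ndq_surj

lemma edq : EdgeData (quadK 1 1 m n) ndq (sv (m := m) (n := n)) where
  nd_inj := ndq_inj
  adj e := by
    change (ndq _).1 ≠ (ndq _).1
    rw [ndq_fst, ndq_fst]
    rcases e with _ | ⟨_ | _, i⟩ | ⟨_ | _, j⟩ | ⟨i, j⟩ <;> simp [sv, cls]
  inj e f h := by
    rcases e with _ | ⟨_ | _, i⟩ | ⟨_ | _, j⟩ | ⟨i, j⟩ <;>
      rcases f with _ | ⟨_ | _, i'⟩ | ⟨_ | _, j'⟩ | ⟨i', j'⟩ <;> simp_all [sv]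

def hs2 (x : Fin 2) : Bool := decide (x = 1)

lemma hs2_inj : Function.Injective hs2 := by decide

/-- vertices of the tripartite graph as source vertices -/
def hs : TV m n → SV m n
  | ⟨⟨0, _⟩, x⟩ => .z (hs2 x)
  | ⟨⟨1, _⟩, i⟩ => .a i
  | ⟨⟨2, _⟩, j⟩ => .b j

lemma hs_cov {a b : TV m n} (h : (triK 2 m n).Adj a b) :
    ∃ e : SE m n, e ≠ .xy ∧ s(hs a, hs b) = s(sv e false, sv e true) := by
  obtain ⟨p, x⟩ := a
  obtain ⟨q, y⟩ := b
  have h : p ≠ q := h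
  fin_cases p <;> fin_cases q
  · exact absurd rfl h
  · exact ⟨.za (hs2 x) y, by simp, rfl⟩
  · exact ⟨.zb (hs2 x) y, by simp, rfl⟩
  · exact ⟨.za (hs2 y) x, by simp, Sym2.eq_swap⟩
  · exact absurd rfl h
  · exact ⟨.ab x y, by simp, rfl⟩
  · exact ⟨.zb (hs2 y) x, by simp, Sym2.eq_swap⟩
  · exact ⟨.ab y x, by simp, Sym2.eq_swap⟩
  · exact absurd rfl h

lemma hs_inj : Function.Injective (hs (m := m) (n := n)) := by
  rintro ⟨p, x⟩ ⟨q, y⟩ h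
  fin_cases p <;> fin_cases q
  · have := hs2_inj (SV.z.inj h); subst this; rfl
  · cases h
  · cases h
  · cases h
  · have := SV.a.inj h; subst this; rfl
  · cases h
  · cases h
  · cases h
  · have := SV.b.inj h; subst this; rfl

instance : Finite (TV m n) := Finite.of_injective _ hs_inj

lemma hs_adj (a b : TV m n) (h : (triK 2 m n).Adj a b) : (quadK 1 1 m n).Adj (ndq (hs a)) (ndq (hs b)) := by
  obtain ⟨e, -, he⟩ := hs_cov h
  have := edq.adj e
  rcases Sym2.eq_iff.1 he with ⟨h1, h2⟩ | ⟨h1, h2⟩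
  · rw [h1, h2]; exact this
  · rw [h1, h2]; exact this.symm

lemma tri_le (D : Drawing (quadK 1 1 m n)) (hD : D.IsGood) :
    2 * crossingNumber (triK 2 m n) ≤ ∑ q ∈ crF (ofDrawing D hD edq), m2 q.1 * m2 q.2 := by
  have hi : Function.Injective (fun a : TV m n => ndq (hs a)) := ndq_inj.comp hs_inj
  let D' := comapD D (G' := triK 2 m n) (fun a => ndq (hs a)) hi hs_adj
  have hD' : D'.IsGood := comapD_good D _ hi hs_adj hD
  have h1 := crossingNumber_le D' hD'
  have hcov : ∀ d ∈ (triK 2 m n).edgeSet, ∃ e : SE m n, e ≠ .xy ∧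
      d.map (fun a => ndq (hs a)) = EdgeData.ed ndq sv e := by
    intro d
    induction d using Sym2.ind with
    | _ a b =>
      intro h
      obtain ⟨e, he, hab⟩ := hs_cov h
      refine ⟨e, he, ?_⟩
      have := congrArg (Sym2.map ndq) hab
      simpa [EdgeData.ed] using this
  have h2 : Nat.card (xpairs D') ≤ ((crF (ofDrawing D hD edq)).filter fun q => q.1 ≠ .xy ∧ q.2 ≠ .xy).card := by
    have : ∀ q : xpairs D', ∃ z : ((crF (ofDrawing D hD edq)).filter fun q => q.1 ≠ .xy ∧ q.2 ≠ .xy),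
        q.1.1.map (fun a => ndq (hs a)) = EdgeData.ed ndq sv z.1.1 ∧
        q.1.2.map (fun a => ndq (hs a)) = EdgeData.ed ndq sv z.1.2 := by
      rintro ⟨⟨d, d'⟩, p, hp⟩
      obtain ⟨e, he, hde⟩ := hcov d hp.1
      obtain ⟨e', he', hde'⟩ := hcov d' hp.2.1
      refine ⟨⟨(e, e'), Finset.mem_filter.2 ⟨Finset.mem_filter.2 ⟨Finset.mem_univ _, ?_⟩, he, he'⟩⟩, hde, hde'⟩
      refine (ofDrawing_cross_iff D hD edq e e').2 ⟨p, ?_⟩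
      have := comapD_cross D _ hi hs_adj hp
      rw [← hde, ← hde']
      exact this
    choose f hf1 hf2 using this
    have hinj : Function.Injective f := by
      intro q q' h
      have c1 : q.1.1 = q'.1.1 := Sym2.map.injective hi (by rw [hf1, hf1, h])
      have c2 : q.1.2 = q'.1.2 := Sym2.map.injective hi (by rw [hf2, hf2, h])
      exact Subtype.ext (Prod.ext c1 c2)
    refine (Nat.card_le_card_of_injective f hinj).trans (le_of_eq ?_)
    rw [Nat.card_eq_fintype_card, Fintype.card_coe]
  have h3 : ((crF (ofDrawing D hD edq)).filter fun q => q.1 ≠ .xy ∧ q.2 ≠ .xy).card ≤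
      ∑ q ∈ crF (ofDrawing D hD edq), m2 q.1 * m2 q.2 := by
    rw [Finset.card_filter]
    refine Finset.sum_le_sum fun q _ => ?_
    obtain ⟨e, f⟩ := q
    cases e <;> cases f <;> simp [m2]
  rw [← two_crNum D' hD'] at h2
  omega

lemma exists_near (θ : SE m n → Bool → ℝ) (g : SV m n → ℝ) : ∃ r, Near θ g r := by
  refine ⟨fun β => sg (eb true β) (if tB θ true β < g (.z true) then 1 else -1), fun β => ?_⟩
  have : ∀ b r, sg b (sg b r) = r := by decide
  exact this _ _

theorem main_nat (k : ℕ) (hk : n + 1 = 2 * k) :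
    crossingNumber (bipK (m + 1) (n + 2)) + crossingNumber (bipK (m + 3) (n + 2)) +
      2 * crossingNumber (triK 2 m n) ≤ 4 * crossingNumber (quadK 1 1 m n) + (2 * (m * k) + k * k) := by
  obtain ⟨D, hD, hcr⟩ := exists_opt (quadK 1 1 m n)
  let S := ofDrawing D hD edq
  have hS : S.v = sv := rfl
  obtain ⟨u, hu, hud, hQ⟩ := surg_exists S
  obtain ⟨κ, θ, g, h1, h2, h3, h4, h5, h6⟩ := frames S hS k hk u hu hud
  obtain ⟨δ, hδ, h7, h8, hQ⟩ := hQ κ θ g h1 h2 h3 h4 h5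
  obtain ⟨r, hr⟩ := exists_near θ g
  obtain ⟨Q1, a1, a2, a3⟩ := hQ lev1
  obtain ⟨Q3, b1, b2, b3⟩ := hQ (lev3 r)
  have C : Cx S θ g δ k := ⟨hS, hδ, h7, h8, h6⟩
  have F1 : Fit Q1 θ g δ lev1 := ⟨a1, a2, a3⟩
  have F3 : Fit Q3 θ g δ (lev3 r) := ⟨b1, b2, b3⟩
  have e1 := local_total C (by omega) hr F1 F3
  have e2 := cr1_le C F1
  have e3 := cr3_le C hr F3
  have e4 : 2 * crossingNumber (triK 2 m n) ≤ ∑ q ∈ crF S, m2 q.1 * m2 q.2 := tri_le D hD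
  have e5 := m_total hS
  have e6 : (crF S).card ≤ 2 * D.crNum := by rw [crF_card]; exact ofDrawing_card D hD edq
  omega

theorem main_real (m n : ℕ) (hno : Odd n) :
    (crossingNumber (quadK 1 1 m n) : ℝ) ≥
      (1 / 4) * ((crossingNumber (bipK (m + 1) (n + 2)) : ℝ)
        + (crossingNumber (bipK (m + 3) (n + 2)) : ℝ)
        + 2 * (crossingNumber (triK 2 m n) : ℝ)
        - (m : ℝ) * ((n : ℝ) + 1) - (1 / 4) * ((n : ℝ) + 1) ^ 2) := by
  obtain ⟨j, rfl⟩ := hno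
  have h := main_nat (m := m) (n := 2 * j + 1) (j + 1) (by ring)
  have h' : ((crossingNumber (bipK (m + 1) (2 * j + 1 + 2)) + crossingNumber (bipK (m + 3) (2 * j + 1 + 2)) +
      2 * crossingNumber (triK 2 m (2 * j + 1)) : ℕ) : ℝ) ≤
      ((4 * crossingNumber (quadK 1 1 m (2 * j + 1)) + (2 * (m * (j + 1)) + (j + 1) * (j + 1)) : ℕ) : ℝ) :=
    Nat.cast_le.2 h
  push_cast at h' ⊢
  nlinarith [h']

end CrK

/-- If `m` is an even positive integer and `n` is an odd positive integer, then
`cr(K_{1,1,m,n}) ≥ ¼(cr(K_{m+1,n+2}) + cr(K_{m+3,n+2}) + 2·cr(K_{2,m,n})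
− m(n+1) − ¼(n+1)²)`. -/
theorem statement6 (m n : ℕ) (hm : 0 < m) (hn : 0 < n)
    (hme : Even m) (hno : Odd n) :
    (crossingNumber (quadK 1 1 m n) : ℝ) ≥
      (1 / 4) * ((crossingNumber (bipK (m + 1) (n + 2)) : ℝ)
        + (crossingNumber (bipK (m + 3) (n + 2)) : ℝ)
        + 2 * (crossingNumber (triK 2 m n) : ℝ)
        - (m : ℝ) * ((n : ℝ) + 1) - (1 / 4) * ((n : ℝ) + 1) ^ 2) := by
  exact CrK.main_real m n hno
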